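/- arXiv:2310.15918 — 2 statements merged into one kernel-verified Lean document; each statement's English description precedes it below -/
import Mathlib

section
/- For every real a > 0, one has (1/(2π)) ∫_{−∞}^{+∞} a²/(a² + y²)² · (1 − (2 sin(y/2)/y)²) dy = (a² − 4a + 6 − 2e^{−a}(a + 3))/(4a³), where the integrand at y = 0 is interpreted by continuity (equal to 0 there). -/
open Real MeasureTheory

theorem integrableOn_Ioi_one_add_mul_cexp (a : ℝ) {z : ℂ} (hz : 0 < z.re) :
    IntegrableOn (fun t : ℝ ↦ (1 + a * t : ℂ) * Complex.exp (-z * t)) (Set.Ioi 0) := by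
  have h0 := integrableOn_rpow_mul_exp_neg_mul_rpow (s := 0) (p := 1) (by norm_num) one_pos hz
  have h1 := integrableOn_rpow_mul_exp_neg_mul_rpow (s := 1) (p := 1) (by norm_num) one_pos hz
  refine (h0.add (h1.const_mul |a|)).mono' (by fun_prop) ?_
  filter_upwards [ae_restrict_mem measurableSet_Ioi] with t (ht : 0 < t)
  simp only [norm_mul, Complex.norm_exp, rpow_zero, rpow_one, one_mul, Pi.add_apply]
  have : ‖(1 + a * t : ℂ)‖ ≤ 1 + |a| * t := by
    refine (norm_add_le _ _).trans ?_
    simp [abs_of_pos ht]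
  calc _ ≤ (1 + |a| * t) * rexp (-z * t : ℂ).re := by gcongr
    _ = _ := by simp; ring

theorem tendsto_add_mul_cexp (b c : ℂ) {z : ℂ} (hz : 0 < z.re) :
    Filter.Tendsto (fun t : ℝ ↦ (b + c * t) * Complex.exp (-z * t)) Filter.atTop (nhds 0) := by
  rw [tendsto_zero_iff_norm_tendsto_zero]
  have h0 := tendsto_rpow_mul_exp_neg_mul_atTop_nhds_zero 0 z.re hz
  have h1 := tendsto_rpow_mul_exp_neg_mul_atTop_nhds_zero 1 z.re hz
  have h := (h0.const_mul ‖b‖).add (h1.const_mul ‖c‖)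
  simp only [mul_zero, add_zero] at h
  refine squeeze_zero' (Filter.Eventually.of_forall fun _ ↦ norm_nonneg _) ?_ h
  filter_upwards [Filter.eventually_gt_atTop 0] with t ht
  simp only [norm_mul, Complex.norm_exp, rpow_zero, rpow_one, one_mul]
  have : ‖b + c * t‖ ≤ ‖b‖ + ‖c‖ * t := by
    refine (norm_add_le _ _).trans ?_
    simp [abs_of_pos ht]
  calc _ ≤ (‖b‖ + ‖c‖ * t) * rexp (-z * t : ℂ).re := by gcongr
    _ = _ := by simp; ring

theorem integral_Ioi_one_add_mul_cexp (a : ℝ) {z : ℂ} (hz : 0 < z.re) :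
    ∫ t : ℝ in Set.Ioi 0, (1 + a * t : ℂ) * Complex.exp (-z * t) = 1 / z + a / z ^ 2 := by
  have hz0 : z ≠ 0 := by rintro rfl; simp at hz
  have hd (t : ℝ) : HasDerivAt
      (fun t : ℝ ↦ (-(1 / z + a / z ^ 2) + (-(a / z)) * t) * Complex.exp (-z * t))
      ((1 + a * t : ℂ) * Complex.exp (-z * t)) t := by
    have hid : HasDerivAt (fun t : ℝ ↦ (t : ℂ)) 1 t := Complex.ofRealCLM.hasDerivAt
    convert! ((hid.const_mul (-(a / z))).const_add (-(1 / z + a / z ^ 2))).mul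
      (hid.const_mul (-z)).cexp using 1
    field_simp
    ring
  rw [integral_Ioi_of_hasDerivAt_of_tendsto' (fun t _ ↦ hd t)
    (integrableOn_Ioi_one_add_mul_cexp a hz) (tendsto_add_mul_cexp _ _ hz)]
  simp

/-- The Matérn kernel `t ↦ (1 + a|t|) e^{-a|t|}` of smoothness `3 / 2`, as a complex-valued
function. -/
noncomputable def matern (a t : ℝ) : ℂ := ((1 + a * |t|) * rexp (-(a * |t|)) : ℝ)

theorem continuous_matern (a : ℝ) : Continuous (matern a) := by
  unfold matern; fun_prop

theorem cexp_mul_matern_neg (a w t : ℝ) :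
    Complex.exp (((w * -t : ℝ) : ℂ) * Complex.I) * matern a (-t)
      = Complex.exp (((-w * t : ℝ) : ℂ) * Complex.I) * matern a t := by
  simp [matern]

theorem eqOn_cexp_mul_matern (a w : ℝ) :
    Set.EqOn (fun t : ℝ ↦ Complex.exp (((w * t : ℝ) : ℂ) * Complex.I) * matern a t)
      (fun t : ℝ ↦ (1 + a * t : ℂ) * Complex.exp (-(a - w * Complex.I) * t)) (Set.Ioi 0) := by
  intro t (ht : 0 < t)
  simp only [matern, abs_of_pos ht]
  push_cast
  rw [mul_left_comm, ← Complex.exp_add]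
  ring_nf

theorem integrableOn_Ioi_cexp_mul_matern {a : ℝ} (ha : 0 < a) (w : ℝ) :
    IntegrableOn (fun t : ℝ ↦ Complex.exp (((w * t : ℝ) : ℂ) * Complex.I) * matern a t)
      (Set.Ioi 0) :=
  (integrableOn_congr_fun (eqOn_cexp_mul_matern a w) measurableSet_Ioi).2
    (integrableOn_Ioi_one_add_mul_cexp a (by simpa using ha))

theorem integrableOn_Iic_cexp_mul_matern {a : ℝ} (ha : 0 < a) (w : ℝ) :
    IntegrableOn (fun t : ℝ ↦ Complex.exp (((w * t : ℝ) : ℂ) * Complex.I) * matern a t)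
      (Set.Iic 0) := by
  have h := (integrableOn_Ici_iff_integrableOn_Ioi).2 (integrableOn_Ioi_cexp_mul_matern ha (-w))
  rw [← (Measure.measurePreserving_neg (volume : Measure ℝ)).integrableOn_comp_preimage
    (MeasurableEquiv.neg ℝ).measurableEmbedding] at h
  simpa [Function.comp_def, matern] using h

theorem integral_cexp_mul_matern {a : ℝ} (ha : 0 < a) (w : ℝ) :
    ∫ t : ℝ, Complex.exp (((w * t : ℝ) : ℂ) * Complex.I) * matern a t
      = ((4 * a ^ 3 / (a ^ 2 + w ^ 2) ^ 2 : ℝ) : ℂ) := by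
  have hI (w : ℝ) : ∫ t in Set.Ioi (0 : ℝ),
      Complex.exp (((w * t : ℝ) : ℂ) * Complex.I) * matern a t
        = 1 / (a - w * Complex.I) + a / (a - w * Complex.I) ^ 2 := by
    rw [setIntegral_congr_fun measurableSet_Ioi (eqOn_cexp_mul_matern a w),
      integral_Ioi_one_add_mul_cexp a (by simpa using ha)]
  rw [← intervalIntegral.integral_Iic_add_Ioi (integrableOn_Iic_cexp_mul_matern ha w)
    (integrableOn_Ioi_cexp_mul_matern ha w), hI]
  have h := integral_comp_neg_Iic 0
    fun t : ℝ ↦ Complex.exp (((-w * t : ℝ) : ℂ) * Complex.I) * matern a t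
  simp only [cexp_mul_matern_neg, neg_neg, neg_zero, hI] at h
  rw [h]
  have h1 : (a - w * Complex.I : ℂ) ≠ 0 := fun h ↦ ha.ne' (by simpa using congrArg Complex.re h)
  have h2 : (a + w * Complex.I : ℂ) ≠ 0 := fun h ↦ ha.ne' (by simpa using congrArg Complex.re h)
  have h3 : (a ^ 2 + w ^ 2 : ℂ) = (a - w * Complex.I) * (a + w * Complex.I) := by
    linear_combination (w ^ 2 : ℂ) * Complex.I_sq
  push_cast
  rw [h3, neg_mul, sub_neg_eq_add]
  field_simp
  ring

theorem integrable_matern {a : ℝ} (ha : 0 < a) : Integrable (matern a) := by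
  have h := (integrableOn_Iic_cexp_mul_matern ha 0).union (integrableOn_Ioi_cexp_mul_matern ha 0)
  simpa [Set.Iic_union_Ioi, integrableOn_univ] using h

theorem integrable_sq_div_sq_add_sq_sq {a : ℝ} (ha : 0 < a) :
    Integrable fun y : ℝ ↦ a ^ 2 / (a ^ 2 + y ^ 2) ^ 2 := by
  have h := (integrable_inv_one_add_sq.comp_mul_left' (inv_ne_zero ha.ne')).const_mul (a ^ 2)⁻¹
  refine h.mono' (Measurable.aestronglyMeasurable (by fun_prop)) (.of_forall fun y ↦ ?_)
  rw [Real.norm_of_nonneg (by positivity), ← mul_inv, ← one_div, div_le_div_iff₀ (by positivity)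
    (by positivity)]
  field_simp
  nlinarith [sq_nonneg y, sq_nonneg a, mul_nonneg (sq_nonneg y) (sq_nonneg a), sq_nonneg (y ^ 2)]

open scoped FourierTransform in
theorem integral_cos_mul_sq_div_sq_add_sq_sq {a : ℝ} (ha : 0 < a) (t : ℝ) :
    ∫ y : ℝ, cos (y * t) * (a ^ 2 / (a ^ 2 + y ^ 2) ^ 2)
      = π / (2 * a) * ((1 + a * |t|) * rexp (-(a * |t|))) := by
  have hF : 𝓕 (matern a) = fun x : ℝ ↦
      ((4 * a * (a ^ 2 / (a ^ 2 + (2 * π * x) ^ 2) ^ 2) : ℝ) : ℂ) := by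
    ext x
    rw [fourier_real_eq_integral_exp_smul]
    simp only [smul_eq_mul, show ∀ v : ℝ, -2 * π * v * x = -2 * π * x * v from fun v ↦ by ring]
    rw [integral_cexp_mul_matern ha]
    congr 1
    ring
  have hFi : Integrable (𝓕 (matern a)) := by
    rw [hF]
    exact (((integrable_sq_div_sq_add_sq_sq ha).comp_mul_left' two_pi_pos.ne').const_mul
      (4 * a)).ofReal
  have h := congrFun
    ((continuous_matern a).fourierInv_fourier_eq (integrable_matern ha) hFi) t
  have hi : Integrable fun x : ℝ ↦
      Complex.exp ((2 * π * inner ℝ x t : ℝ) * Complex.I) • 𝓕 (matern a) x :=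
    hFi.mono (.mul (by fun_prop) hFi.1)
      (.of_forall fun x ↦ by rw [norm_smul, Complex.norm_exp_ofReal_mul_I, one_mul])
  rw [fourierInv_eq'] at h
  replace h := (integral_re hi).trans (congrArg Complex.re h)
  have hc := Measure.integral_comp_mul_left
    (fun y ↦ cos (y * t) * (4 * a * (a ^ 2 / (a ^ 2 + y ^ 2) ^ 2))) (2 * π)
  have he (x : ℝ) : RCLike.re (Complex.exp ((2 * π * inner ℝ x t : ℝ) * Complex.I) •
      𝓕 (matern a) x) =
        cos (2 * π * x * t) * (4 * a * (a ^ 2 / (a ^ 2 + (2 * π * x) ^ 2) ^ 2)) := by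
    rw [hF, smul_eq_mul, RCLike.re_eq_complex_re, Complex.re_mul_ofReal,
      Complex.exp_ofReal_mul_I_re, show inner ℝ x t = x * t by simp [mul_comm], mul_assoc (2 * π)]
  simp only [he, hc] at h
  simp only [matern, Complex.ofReal_re, mul_left_comm _ (4 * a), integral_const_mul,
    smul_eq_mul, abs_of_pos (inv_pos.2 two_pi_pos)] at h
  rw [← h]
  generalize ∫ y : ℝ, cos (y * t) * (a ^ 2 / (a ^ 2 + y ^ 2) ^ 2) = J
  field_simp
  norm_num

theorem integral_fejer_weight_mul_one_sub_cos {y : ℝ} (hy : y ≠ 0) :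
    ∫ t in (0 : ℝ)..1, 2 * (1 - t) * (1 - cos (y * t)) = 1 - (2 * sin (y / 2) / y) ^ 2 := by
  have hd (t : ℝ) : HasDerivAt
      (fun t ↦ -(1 - t) ^ 2 - 2 * ((1 - t) * (sin (y * t) / y) - cos (y * t) / y ^ 2))
      (2 * (1 - t) * (1 - cos (y * t))) t := by
    have h1 := (hasDerivAt_id' t).const_sub 1
    have h2 := (hasDerivAt_id' t).const_mul y
    convert! (h1.pow 2).neg.sub
      (((h1.mul (h2.sin.div_const y)).sub (h2.cos.div_const (y ^ 2))).const_mul 2) using 1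
    field_simp
    ring
  rw [intervalIntegral.integral_eq_sub_of_hasDerivAt (fun t _ ↦ hd t)
    (Continuous.intervalIntegrable (by fun_prop) _ _), div_pow, mul_pow, sin_sq_eq_half_sub]
  simp only [mul_one, mul_zero, sin_zero, cos_zero, mul_div_cancel₀ y two_ne_zero]
  field_simp
  ring

theorem integral_fejer_weight_mul_one_sub_matern {a : ℝ} (ha : a ≠ 0) :
    ∫ t in (0 : ℝ)..1, 2 * (1 - t) * (1 - (1 + a * t) * rexp (-(a * t)))
      = (a ^ 2 - 4 * a + 6 - 2 * rexp (-a) * (a + 3)) / a ^ 2 := by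
  have hd (t : ℝ) : HasDerivAt
      (fun t ↦ -(1 - t) ^ 2 - 2 * ((1 - t) * (-(t + 2 / a) * rexp (-(a * t)))
        + (t / a + 3 / a ^ 2) * rexp (-(a * t))))
      (2 * (1 - t) * (1 - (1 + a * t) * rexp (-(a * t)))) t := by
    have h0 := hasDerivAt_id' t
    have h1 := h0.const_sub 1
    have h2 := (h0.const_mul a).neg.exp
    convert! (h1.pow 2).neg.sub (((h1.mul ((h0.add_const (2 / a)).neg.mul h2)).add
      (((h0.div_const a).add_const (3 / a ^ 2)).mul h2)).const_mul 2) using 1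
    simp only [Pi.neg_apply, Pi.mul_apply]
    field_simp
    ring
  rw [intervalIntegral.integral_eq_sub_of_hasDerivAt (fun t _ ↦ hd t)
    (Continuous.intervalIntegrable (by fun_prop) _ _)]
  simp only [mul_one, mul_zero, neg_zero, exp_zero]
  field_simp
  ring

/-- The residue computation: for `a > 0`,
`(1/2π) ∫_{-∞}^{∞} a²/(a²+y²)² (1 - sin²(y/2)/(y/2)²) dy = (a²-4a+6-2e^{-a}(a+3))/(4a³)`.
(The integrand differs from its continuous extension only at `y = 0`, a set of measure
zero, so the Lebesgue integral is unaffected.) -/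
theorem residue_integral (a : ℝ) (ha : 0 < a) :
    (1/(2*π)) * (∫ y : ℝ, a^2/(a^2 + y^2)^2 * (1 - (2*Real.sin (y/2)/y)^2))
      = (a^2 - 4*a + 6 - 2*Real.exp (-a)*(a + 3))/(4*a^3) := by
  have hh := integrable_sq_div_sq_add_sq_sq ha
  have hw : Integrable (fun t : ℝ ↦ 2 * (1 - t)) (volume.restrict (Set.uIoc 0 1)) :=
    intervalIntegrable_iff.1 (Continuous.intervalIntegrable (by fun_prop) _ _)
  have hprod : Integrable (Function.uncurry fun t y : ℝ ↦
      2 * (1 - t) * (1 - cos (y * t)) * (a ^ 2 / (a ^ 2 + y ^ 2) ^ 2))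
      ((volume.restrict (Set.uIoc 0 1)).prod volume) := by
    refine ((hw.mul_prod hh).const_mul 2).mono
      (Measurable.aestronglyMeasurable (by unfold Function.uncurry; fun_prop))
      (.of_forall fun p ↦ ?_)
    have : ‖1 - cos (p.2 * p.1)‖ ≤ 2 := by
      rw [norm_eq_abs, abs_le]
      constructor <;> linarith [neg_one_le_cos (p.2 * p.1), cos_le_one (p.2 * p.1)]
    simp only [Function.uncurry, norm_mul _ (1 - cos _), norm_mul _ (_ / _), norm_mul (2 : ℝ) (_ * _)]
    rw [mul_right_comm, mul_comm]
    gcongr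
    simpa using this
  have hswap := intervalIntegral_integral_swap hprod
  have hy : ∀ᵐ y : ℝ, ∫ t in (0 : ℝ)..1,
      2 * (1 - t) * (1 - cos (y * t)) * (a ^ 2 / (a ^ 2 + y ^ 2) ^ 2)
        = a ^ 2 / (a ^ 2 + y ^ 2) ^ 2 * (1 - (2 * sin (y / 2) / y) ^ 2) := by
    filter_upwards [Measure.ae_ne volume (0 : ℝ)] with y hy
    rw [intervalIntegral.integral_mul_const, integral_fejer_weight_mul_one_sub_cos hy, mul_comm]
  have ht : Set.EqOn (fun t : ℝ ↦ ∫ y : ℝ,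
      2 * (1 - t) * (1 - cos (y * t)) * (a ^ 2 / (a ^ 2 + y ^ 2) ^ 2))
      (fun t ↦ π / (2 * a) * (2 * (1 - t) * (1 - (1 + a * t) * rexp (-(a * t)))))
      (Set.uIcc 0 1) := by
    intro t ht
    rw [Set.uIcc_of_le zero_le_one] at ht
    have hcos : Integrable fun y : ℝ ↦ cos (y * t) * (a ^ 2 / (a ^ 2 + y ^ 2) ^ 2) :=
      hh.mono (.mul (by fun_prop) hh.1) (.of_forall fun y ↦ by
        rw [norm_mul]
        exact mul_le_of_le_one_left (norm_nonneg _) (abs_cos_le_one _))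
    have h0 := integral_cos_mul_sq_div_sq_add_sq_sq ha 0
    simp only [mul_zero, cos_zero, one_mul, abs_zero, add_zero, neg_zero, exp_zero, mul_one] at h0
    simp only [mul_assoc (2 * (1 - t)), integral_const_mul, sub_mul (1 : ℝ) (cos _), one_mul]
    rw [integral_sub hh hcos, h0, integral_cos_mul_sq_div_sq_add_sq_sq ha, abs_of_nonneg ht.1]
    ring
  rw [← integral_congr_ae hy, ← hswap, intervalIntegral.integral_congr ht,
    intervalIntegral.integral_const_mul, integral_fejer_weight_mul_one_sub_matern ha.ne']
  field_simp
  ring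
end

section
/- Assume the Riemann Hypothesis. For every fixed real b ≥ 1 there exist constants C > 0, δ > 0 and T₀ > 2 such that for all T ≥ T₀ and all real a with 0 < a ≤ δ, one has J_b(T, a) ≤ C · (log T)³/T. -/
open Complex Real MeasureTheory

/-- The logarithmic derivative ζ'/ζ of the Riemann zeta function. -/
noncomputable def logDerivZeta (s : ℂ) : ℂ := deriv riemannZeta s / riemannZeta s

/-- `f_α(x) = Σ_{m·d ≤ x} Λ(m) d^α`, the summatory function of `Λ * τ_{-α}`
(equal to `0` for `x < 1`). -/
noncomputable def fAlpha (α x : ℝ) : ℝ :=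
  ∑ n ∈ Finset.Icc 1 ⌊x⌋₊, ∑ d ∈ n.divisors,
    ArithmeticFunction.vonMangoldt (n / d) * (d : ℝ) ^ α

/-- `M_α(x) = (-1/(1+α)) (ζ'/ζ)(1+α) x^{1+α} + ζ(1-α) x` (both zeta values are real). -/
noncomputable def MAlpha (α x : ℝ) : ℝ :=
  (-(1/(1+α)) * (logDerivZeta ((1:ℂ) + (α:ℂ)))).re * x ^ (1+α)
    + (riemannZeta ((1:ℂ) - (α:ℂ))).re * x

/-- `J_b(T,a)`, the variance of `f_{a/log T} - M_{a/log T}` over short intervals. -/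
noncomputable def Jb (b T a : ℝ) : ℝ :=
  ∫ x in (1:ℝ)..(T ^ b),
    (fAlpha (a / Real.log T) (x + x/T) - fAlpha (a / Real.log T) x
      - MAlpha (a / Real.log T) (x + x/T) + MAlpha (a / Real.log T) x) ^ 2 / x ^ 2

section

open scoped FourierTransform

/-- Plancherel's theorem on `L¹ ∩ L²`. -/
theorem lintegral_enorm_fourier_sq_eq {f : ℝ → ℂ} (hf : Integrable f) (hf2 : MemLp f 2) :
    ∫⁻ ξ, ‖𝓕 f ξ‖ₑ ^ 2 = ∫⁻ x, ‖f x‖ₑ ^ 2 := by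
  set F : Lp ℂ 2 (volume : Measure ℝ) := hf2.toLp f with hF
  have hae : ∀ᵐ ξ, 𝓕 f ξ = (𝓕 F : Lp ℂ 2 (volume : Measure ℝ)) ξ := by
    apply ae_eq_of_integral_contDiff_smul_eq
    · exact (VectorFourier.fourierIntegral_continuous Real.continuous_fourierChar continuous_inner hf : Continuous (𝓕 f)).locallyIntegrable
    · exact (Lp.memLp _).locallyIntegrable (by norm_num)
    · intro g g_smooth g_cpt
      have hg₁ : HasCompactSupport (Complex.ofRealCLM ∘ g) := g_cpt.comp_left rfl
      have hg₂ : ContDiff ℝ (⊤ : ℕ∞) (Complex.ofRealCLM ∘ g) := by fun_prop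
      set G := hg₁.toSchwartzMap hg₂ with hG
      have h1 : ∫ x, g x • (𝓕 F : Lp ℂ 2 (volume : Measure ℝ)) x
          = Lp.toTemperedDistribution (𝓕 F : Lp ℂ 2 (volume : Measure ℝ)) G := by
        simp [hG]
      rw [h1, ← Lp.fourier_toTemperedDistribution_eq, TemperedDistribution.fourier_apply,
        Lp.toTemperedDistribution_apply]
      have h2 : ∫ x, (𝓕 G) x • F x = ∫ x, f x • (𝓕 G) x := by
        apply integral_congr_ae
        filter_upwards [hf2.coeFn_toLp] with x hx
        rw [hF, hx, smul_eq_mul, smul_eq_mul, mul_comm]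
      rw [h2]
      have h3 := VectorFourier.integral_fourierIntegral_smul_eq_flip (L := innerₗ ℝ)
        (μ := volume) (ν := volume) Real.continuous_fourierChar continuous_inner hf G.integrable
      rw [flip_innerₗ] at h3
      have h4 : ∀ x, g x • 𝓕 f x = VectorFourier.fourierIntegral 𝐞 volume (innerₗ ℝ) f x • G x := by
        intro x
        simp [hG, mul_comm]
        left; rfl
      simp_rw [h4]
      rw [h3]
      rfl
  have e1 : ∫⁻ ξ, ‖𝓕 f ξ‖ₑ ^ 2 = ∫⁻ ξ, ‖(𝓕 F : Lp ℂ 2 (volume : Measure ℝ)) ξ‖ₑ ^ 2 :=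
    lintegral_congr_ae (by filter_upwards [hae] with x hx; rw [hx])
  have e2 : ∫⁻ ξ, ‖f ξ‖ₑ ^ 2 = ∫⁻ ξ, ‖F ξ‖ₑ ^ 2 :=
    lintegral_congr_ae (by filter_upwards [hf2.coeFn_toLp] with x hx; rw [hF, hx])
  have key : ∀ G : Lp ℂ 2 (volume : Measure ℝ), ∫⁻ ξ, ‖G ξ‖ₑ ^ 2 = ‖G‖ₑ ^ 2 := by
    intro G
    rw [Lp.enorm_def, eLpNorm_eq_lintegral_rpow_enorm_toReal (by norm_num) (by norm_num)]
    simp only [ENNReal.toReal_ofNat, ENNReal.rpow_ofNat, one_div]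
    rw [← ENNReal.rpow_natCast, ← ENNReal.rpow_mul]
    norm_num
  rw [e1, e2, key, key]
  congr 1
  rw [← ofReal_norm, ← ofReal_norm, Lp.norm_fourier_eq]

/-- One half of Plancherel's theorem, for integrable functions. -/
theorem lintegral_enorm_fourier_sq_le {f : ℝ → ℂ} (hf : Integrable f) :
    ∫⁻ ξ, ‖𝓕 f ξ‖ₑ ^ 2 ≤ ∫⁻ x, ‖f x‖ₑ ^ 2 := by
  by_cases h : ∫⁻ x, ‖f x‖ₑ ^ 2 = ⊤
  · rw [h]; exact le_top
  · refine (lintegral_enorm_fourier_sq_eq hf ⟨hf.1, ?_⟩).le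
    rw [eLpNorm_lt_top_iff_lintegral_rpow_enorm_lt_top (by norm_num) (by norm_num)]
    simpa using lt_top_iff_ne_top.mpr h

theorem lintegral_eq_ofReal_mul_lintegral_comp_mul (g : ℝ → ENNReal) {a : ℝ} (ha : 0 < a) :
    ∫⁻ t, g t = ENNReal.ofReal a * ∫⁻ t, g (a * t) := by
  conv_lhs => rw [← Real.smul_map_volume_mul_left ha.ne']
  rw [lintegral_smul_measure, abs_of_pos ha, smul_eq_mul,
    (measurableEmbedding_mulLeft₀ ha.ne').lintegral_map]

/-- Plancherel's inequality for the two-sided Laplace transform on a vertical line. -/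
theorem lintegral_enorm_laplace_sq_le {q : ℝ → ℂ} {σ : ℝ}
    (hq : Integrable fun u => q u * cexp (-σ * u)) :
    ∫⁻ t : ℝ, ‖∫ u, q u * cexp (-(σ + t * I) * u)‖ₑ ^ 2
      ≤ ENNReal.ofReal (2 * π) * ∫⁻ u : ℝ, ‖q u‖ₑ ^ 2 * ENNReal.ofReal (rexp (-2 * σ * u)) := by
  have h := lintegral_enorm_fourier_sq_le hq
  have e1 : ∀ u : ℝ, ‖q u * cexp (-σ * u)‖ₑ ^ 2 = ‖q u‖ₑ ^ 2 * ENNReal.ofReal (rexp (-2 * σ * u)) := by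
    intro u
    rw [enorm_mul, mul_pow]
    congr 1
    rw [← ofReal_norm, Complex.norm_exp, ← ENNReal.ofReal_pow (by positivity), ← Real.exp_nat_mul]
    congr 2
    simp; ring
  have hpi : (2 * π) ≠ 0 := by positivity
  have e2 : ∫⁻ t : ℝ, ‖∫ u, q u * cexp (-(σ + t * I) * u)‖ₑ ^ 2
      = ENNReal.ofReal (2 * π) * ∫⁻ ξ : ℝ, ‖∫ u, q u * cexp (-(σ + (2 * π * ξ : ℝ) * I) * u)‖ₑ ^ 2 := by
    exact lintegral_eq_ofReal_mul_lintegral_comp_mul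
      (fun t : ℝ => ‖∫ u, q u * cexp (-(σ + t * I) * u)‖ₑ ^ 2) (by positivity)
  rw [e2]
  refine mul_le_mul_right ?_ _
  calc _ = ∫⁻ ξ, ‖𝓕 (fun u : ℝ => q u * cexp (-σ * u)) ξ‖ₑ ^ 2 := by
        refine lintegral_congr fun ξ => ?_
        rw [Real.fourier_eq']
        congr 3; ext u
        simp only [smul_eq_mul]
        rw [mul_left_comm, ← Complex.exp_add]
        congr 2
        simp
        ring
    _ ≤ _ := h.trans (lintegral_mono fun u => (e1 u).le)

end

theorem one_add_abs_pow_le_exp {ε : ℝ} (hε : 0 < ε) (N : ℕ) :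
    ∃ C : ℝ, 0 < C ∧ ∀ y : ℝ, (1 + |y|) ^ N ≤ C * rexp (ε * y ^ 2) := by
  refine ⟨(2 / ε) ^ N * N.factorial * rexp ε, by positivity, fun y => ?_⟩
  have h1 : 1 + |y| ≤ 2 / ε * (ε * (1 + y ^ 2)) := by
    field_simp
    nlinarith [sq_nonneg (|y| - 1), sq_abs y]
  have h2 := Real.pow_div_factorial_le_exp (ε * (1 + y ^ 2)) (by positivity) N
  rw [div_le_iff₀ (by positivity)] at h2
  calc (1 + |y|) ^ N ≤ (2 / ε * (ε * (1 + y ^ 2))) ^ N := by gcongr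
    _ = (2 / ε) ^ N * (ε * (1 + y ^ 2)) ^ N := by rw [mul_pow]
    _ ≤ (2 / ε) ^ N * (rexp (ε * (1 + y ^ 2)) * N.factorial) := by gcongr
    _ = _ := by rw [mul_add, Real.exp_add]; ring_nf

/-- Shifting a contour integral between two vertical lines. -/
theorem integral_vertical_eq_of_le {F : ℂ → ℂ} {σ c : ℝ} (hσ : σ ≤ c)
    (hF : ∀ s : ℂ, σ ≤ s.re → s.re ≤ c → DifferentiableAt ℂ F s) {g : ℝ → ℝ}
    (hg : Integrable g) (hg1 : Filter.Tendsto g Filter.atTop (nhds 0))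
    (hg2 : Filter.Tendsto g Filter.atBot (nhds 0))
    (hb : ∀ x y : ℝ, σ ≤ x → x ≤ c → ‖F (x + y * I)‖ ≤ g y) :
    Integrable (fun t : ℝ => F (c + t * I)) ∧ Integrable (fun t : ℝ => F (σ + t * I)) ∧
    ∫ t : ℝ, F (c + t * I) = ∫ t : ℝ, F (σ + t * I) := by
  have hcont : ∀ x : ℝ, σ ≤ x → x ≤ c → Continuous (fun t : ℝ => F (x + t * I)) := by
    intro x h1 h2
    rw [continuous_iff_continuousAt]
    intro t
    exact ContinuousAt.comp (f := fun t : ℝ => (x : ℂ) + t * I)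
      (hF _ (by simpa using h1) (by simpa using h2)).continuousAt (by fun_prop)
  have hint : ∀ x : ℝ, σ ≤ x → x ≤ c → Integrable (fun t : ℝ => F (x + t * I)) := by
    intro x h1 h2
    exact hg.mono' (hcont x h1 h2).aestronglyMeasurable
      (Filter.Eventually.of_forall fun t => hb x t h1 h2)
  have ic := hint c hσ le_rfl
  have iσ := hint σ le_rfl hσ
  refine ⟨ic, iσ, ?_⟩
  have hrect : ∀ T : ℝ, I • (∫ y in (-T)..T, F (c + y * I)) - I • (∫ y in (-T)..T, F (σ + y * I))
      = (∫ x in σ..c, F (x + (T:ℝ) * I)) - ∫ x in σ..c, F (x + ((-T : ℝ):ℂ) * I) := by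
    intro T
    have := Complex.integral_boundary_rect_eq_zero_of_differentiableOn F (⟨σ, -T⟩ : ℂ) ⟨c, T⟩ (by
      intro s hs
      rw [mem_reProdIm] at hs
      have := hs.1
      simp only [Set.uIcc_of_le hσ] at this
      exact (hF s this.1 this.2).differentiableWithinAt)
    simp only at this
    linear_combination this
  have l1 := (intervalIntegral_tendsto_integral ic Filter.tendsto_neg_atTop_atBot Filter.tendsto_id)
  have l2 := (intervalIntegral_tendsto_integral iσ Filter.tendsto_neg_atTop_atBot Filter.tendsto_id)
  have l3 := (l1.const_smul I).sub (l2.const_smul I)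
  have bd : ∀ T : ℝ, ‖∫ x in σ..c, F (x + (T:ℝ) * I)‖ ≤ g T * |c - σ| := by
    intro T
    apply intervalIntegral.norm_integral_le_of_norm_le_const
    intro x hx
    rw [Set.uIoc_of_le hσ] at hx
    exact hb x T hx.1.le hx.2
  have z1 : Filter.Tendsto (fun T : ℝ => ∫ x in σ..c, F (x + (T:ℝ) * I)) Filter.atTop (nhds 0) :=
    squeeze_zero_norm bd (by simpa using hg1.mul_const |c - σ|)
  have z2 : Filter.Tendsto (fun T : ℝ => ∫ x in σ..c, F (x + (T:ℝ) * I)) Filter.atBot (nhds 0) :=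
    squeeze_zero_norm bd (by simpa using hg2.mul_const |c - σ|)
  have z3 := z1.sub (z2.comp Filter.tendsto_neg_atTop_atBot)
  have heq := tendsto_nhds_unique (l3.congr fun T => hrect T) z3
  rw [sub_zero, ← smul_sub] at heq
  rcases smul_eq_zero.1 heq with h | h
  · exact absurd h I_ne_zero
  · exact sub_eq_zero.1 h

theorem integral_cexp_gaussian_vertical {ε : ℝ} (hε : 0 < ε) (c w : ℝ) :
    ∫ t : ℝ, cexp ((c + t * I) * w + (ε ^ 2 : ℝ) * (c + t * I) ^ 2)
      = ((√π / ε : ℝ) : ℂ) * ((rexp (-(w ^ 2) / (4 * ε ^ 2)) : ℝ) : ℂ) := by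
  have hb : (-((ε ^ 2 : ℝ) : ℂ)).re < 0 := by
    simp only [neg_re, ofReal_re]; nlinarith [sq_nonneg ε, pow_pos hε 2]
  have := integral_cexp_quadratic hb (I * (2 * ε ^ 2 * c + w)) (ε ^ 2 * c ^ 2 + c * w)
  have hε' : (ε : ℂ) ≠ 0 := by exact_mod_cast hε.ne'
  rw [show ((√π / ε : ℝ) : ℂ) = ((π : ℂ) / -(-((ε ^ 2 : ℝ) : ℂ))) ^ (1 / 2 : ℂ) from ?_]
  · rw [Complex.ofReal_exp, ← show ((ε:ℂ) ^ 2 * c ^ 2 + c * w) - (I * (2 * ε ^ 2 * c + w)) ^ 2 / (4 * (-((ε ^ 2 : ℝ) : ℂ))) = ((-(w ^ 2) / (4 * ε ^ 2) : ℝ) : ℂ) from ?_, ← this]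
    · congr 1; ext t; congr 1
      push_cast
      linear_combination (ε^2 * t^2 : ℂ) * Complex.I_sq
    · push_cast
      field_simp
      linear_combination (-(2 * (ε:ℂ) ^ 2 * c + w)^2 * -1) * Complex.I_sq
  · rw [neg_neg, ← Complex.ofReal_div, show (1 / 2 : ℂ) = ((1 / 2 : ℝ) : ℂ) by norm_num, ← Complex.ofReal_cpow (by positivity),
      ← Real.sqrt_eq_rpow, Real.sqrt_div (by positivity), Real.sqrt_sq hε.le]

section

open scoped FourierTransform

theorem gaussian_mollify_eq {q : ℝ → ℂ} {c : ℝ} {B : ℂ → ℂ}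
    (hqi : Integrable fun u : ℝ => q u * cexp (-c * u))
    (hB : ∀ t : ℝ, B (c + t * I) = ∫ v : ℝ, q v * cexp (-(c + t * I) * v))
    {ε : ℝ} (hε : 0 < ε) (u : ℝ) :
    ∫ t : ℝ, B (c + t * I) * cexp ((c + t * I) * u + (ε ^ 2 : ℝ) * (c + t * I) ^ 2)
      = (√π : ℂ) * ∫ w : ℝ, q (u + ε * w) * (rexp (-(w ^ 2) / 4) : ℝ) := by
  have hE : Integrable fun t : ℝ => cexp ((c + t * I) * u + (ε ^ 2 : ℝ) * (c + t * I) ^ 2) := by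
    have hb : 0 < ((ε ^ 2 : ℝ) : ℂ).re := by
      simp only [ofReal_re]; positivity
    refine (integrable_cexp_quadratic hb (I * (2 * ε ^ 2 * c + u)) (ε ^ 2 * c ^ 2 + c * u)).congr
      (Filter.Eventually.of_forall fun t => ?_)
    simp only
    congr 1
    push_cast
    linear_combination -(ε^2 * t^2 : ℂ) * Complex.I_sq
  have h1 : ∫ t : ℝ, B (c + t * I) * cexp ((c + t * I) * u + (ε ^ 2 : ℝ) * (c + t * I) ^ 2)
      = ∫ t : ℝ, ∫ v : ℝ, q v * cexp (-(c + t * I) * v) *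
        cexp ((c + t * I) * u + (ε ^ 2 : ℝ) * (c + t * I) ^ 2) := by
    congr 1; ext t
    rw [hB, ← integral_mul_const]
  rw [h1, integral_integral_swap]
  · have h2 : ∀ v : ℝ, ∫ t : ℝ, q v * cexp (-(c + t * I) * v) *
        cexp ((c + t * I) * u + (ε ^ 2 : ℝ) * (c + t * I) ^ 2)
        = (√π / ε : ℝ) * (q v * (rexp (-((u - v) ^ 2) / (4 * ε ^ 2)) : ℝ)) := by
      intro v
      rw [mul_left_comm, ← integral_cexp_gaussian_vertical hε c (u - v), ← integral_const_mul]
      congr 1; ext t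
      rw [mul_assoc, ← Complex.exp_add]
      congr 2
      push_cast; ring
    simp_rw [h2]
    rw [integral_const_mul]
    have h3 := Measure.integral_comp_mul_left (fun w : ℝ => q (u + w) * (rexp (-(w ^ 2) / (4 * ε ^ 2)) : ℝ)) ε
    have h4 := integral_add_left_eq_self (μ := volume) (fun v : ℝ => q v * (rexp (-((u - v) ^ 2) / (4 * ε ^ 2)) : ℝ)) u
    rw [← h4]
    simp only [sub_add_cancel_left, neg_sq] at *
    have h5 : ∀ w : ℝ, -(ε * w) ^ 2 / (4 * ε ^ 2) = -w ^ 2 / 4 := by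
      intro w; field_simp
    simp_rw [h5] at h3
    rw [h3, abs_of_pos (by positivity), Complex.real_smul]
    push_cast
    ring
  · have hp := hE.mul_prod hqi
    refine hp.mono ?_ (Filter.Eventually.of_forall fun p => ?_)
    · have hc : Continuous fun p : ℝ × ℝ => cexp (-(p.1 * I) * p.2) := by fun_prop
      refine (hp.aestronglyMeasurable.mul hc.aestronglyMeasurable).congr (Filter.Eventually.of_forall fun p => ?_)
      simp only [Function.uncurry]
      rw [show -((c:ℂ) + p.1 * I) * p.2 = -c * p.2 + -(p.1 * I) * p.2 by ring, Complex.exp_add]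
      simp only [Pi.mul_apply]
      ring
    · simp only [Function.uncurry, norm_mul]
      rw [mul_comm]
      gcongr
      rw [Complex.norm_exp, Complex.norm_exp]
      apply le_of_eq
      simp

theorem tendsto_gaussian_mollify {q : ℝ → ℂ} (hq : Measurable q) {K c₀ : ℝ}
    (hc₀ : 0 ≤ c₀) (hqb : ∀ u, ‖q u‖ ≤ K * rexp (c₀ * |u|)) {u : ℝ} (hu : ContinuousAt q u) :
    Filter.Tendsto (fun n : ℕ => ∫ w : ℝ, q (u + (1 / (n + 1) : ℝ) * w) * (rexp (-(w ^ 2) / 4) : ℝ))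
      Filter.atTop (nhds ((2 * √π : ℝ) * q u)) := by
  have hK : 0 ≤ K := by
    have := hqb 0
    simp at this
    exact (norm_nonneg _).trans this
  have hlim : ((2 * √π : ℝ) * q u) = ∫ w : ℝ, q u * (rexp (-(w ^ 2) / 4) : ℝ) := by
    rw [integral_const_mul, integral_complex_ofReal, mul_comm]
    congr 2
    have := integral_gaussian (1 / 4)
    rw [show π / (1 / 4) = 2 ^ 2 * π by ring, Real.sqrt_mul (by positivity), Real.sqrt_sq (by norm_num)] at this
    rw [← this]
    congr 1; ext x; congr 1; ring
  rw [hlim]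
  apply tendsto_integral_of_dominated_convergence (fun w => K * rexp (c₀ * |u| + 2 * c₀ ^ 2) * rexp (-(1 / 8) * w ^ 2))
  · intro n
    apply Measurable.aestronglyMeasurable
    fun_prop
  · exact (integrable_exp_neg_mul_sq (by norm_num)).const_mul _
  · intro n
    refine Filter.Eventually.of_forall fun w => ?_
    rw [norm_mul, Complex.norm_real, Real.norm_of_nonneg (Real.exp_nonneg _)]
    calc _ ≤ K * rexp (c₀ * |u + (1 / (n + 1) : ℝ) * w|) * rexp (-(w ^ 2) / 4) := by
          gcongr; exact hqb _
      _ ≤ K * rexp (c₀ * (|u| + |w|)) * rexp (-(w ^ 2) / 4) := by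
          gcongr
          refine (abs_add_le _ _).trans ?_
          rw [abs_mul]
          have : |(1 / (n + 1) : ℝ)| ≤ 1 := by
            rw [abs_of_nonneg (by positivity), div_le_one (by positivity)]
            linarith [Nat.cast_nonneg (α := ℝ) n]
          nlinarith [abs_nonneg w]
      _ = K * rexp (c₀ * (|u| + |w|) + -(w ^ 2) / 4) := by rw [mul_assoc, ← Real.exp_add]
      _ ≤ K * rexp (c₀ * |u| + 2 * c₀ ^ 2 + -(1 / 8) * w ^ 2) := by
          gcongr K * rexp ?_
          nlinarith [sq_nonneg (|w| - 4 * c₀), sq_abs w]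
      _ = _ := by rw [Real.exp_add _ (-(1 / 8) * w ^ 2), mul_assoc]
  · refine Filter.Eventually.of_forall fun w => ?_
    refine Filter.Tendsto.mul_const _ ?_
    have ht : Filter.Tendsto (fun n : ℕ => u + (1 / (n + 1) : ℝ) * w) Filter.atTop (nhds u) := by
      simpa using (tendsto_one_div_add_atTop_nhds_zero_nat (𝕜 := ℝ)).mul_const w |>.const_add u
    exact hu.tendsto.comp ht

/-- A Paley–Wiener type bound: the weighted `L²` norm of `q` is controlled by the `L²` norm of the
analytic continuation of its Laplace transform. -/
theorem lintegral_enorm_sq_le_of_laplace {q : ℝ → ℂ} (hq : Measurable q) {K c₀ : ℝ}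
    (hc₀ : 0 ≤ c₀) (hqb : ∀ u, ‖q u‖ ≤ K * rexp (c₀ * |u|)) (hqc : ∀ᵐ u, ContinuousAt q u)
    {c : ℝ} {B : ℂ → ℂ} (hqi : Integrable fun u : ℝ => q u * cexp (-c * u))
    (hB : ∀ t : ℝ, B (c + t * I) = ∫ v : ℝ, q v * cexp (-(c + t * I) * v))
    {σ : ℝ} (hσ : σ ≤ c) (hd : ∀ s : ℂ, σ ≤ s.re → s.re ≤ c → DifferentiableAt ℂ B s)
    {M : ℝ} {N : ℕ} (hg : ∀ s : ℂ, σ ≤ s.re → s.re ≤ c → ‖B s‖ ≤ M * (1 + |s.im|) ^ N) :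
    ∫⁻ u : ℝ, ‖q u‖ₑ ^ 2 * ENNReal.ofReal (rexp (-2 * σ * u))
      ≤ ENNReal.ofReal (rexp (2 * σ ^ 2)) * ∫⁻ t : ℝ, ‖B (σ + t * I)‖ₑ ^ 2 := by
  have hM : 0 ≤ M := by
    have := hg c (by simpa using hσ) (by simp)
    simp at this
    exact (norm_nonneg _).trans this
  set ε : ℕ → ℝ := fun n => 1 / (n + 1) with hεdef
  have hε : ∀ n, 0 < ε n := fun n => by positivity
  have hε1 : ∀ n, ε n ≤ 1 := fun n => by
    rw [hεdef]; simp only; rw [div_le_one (by positivity)]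
    linarith [Nat.cast_nonneg (α := ℝ) n]
  set f : ℕ → ℝ → ℂ := fun n t => B (σ + t * I) * cexp ((ε n ^ 2 : ℝ) * (σ + t * I) ^ 2) with hf
  have hshift : ∀ (n : ℕ) (u : ℝ), Integrable (fun t : ℝ => B (σ + t * I) * cexp ((σ + t * I) * u + (ε n ^ 2 : ℝ) * (σ + t * I) ^ 2)) ∧
      ∫ t : ℝ, B (c + t * I) * cexp ((c + t * I) * u + (ε n ^ 2 : ℝ) * (c + t * I) ^ 2)
      = ∫ t : ℝ, B (σ + t * I) * cexp ((σ + t * I) * u + (ε n ^ 2 : ℝ) * (σ + t * I) ^ 2) := by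
    intro n u
    obtain ⟨C, hC, hCb⟩ := one_add_abs_pow_le_exp (ε := ε n ^ 2 / 2) (by have := hε n; positivity) N
    set L := |σ| + |c| with hL
    have hp : 0 < ε n ^ 2 / 2 := by have := hε n; positivity
    have hgt : Filter.Tendsto (fun y : ℝ => M * C * rexp (L * |u| + L ^ 2) * rexp (-(ε n ^ 2 / 2) * y ^ 2)) (Filter.cocompact ℝ) (nhds 0) := by
      have : Filter.Tendsto (fun y : ℝ => rexp (-(ε n ^ 2 / 2) * y ^ 2)) (Filter.cocompact ℝ) (nhds 0) := by
        have := tendsto_rpow_abs_mul_exp_neg_mul_sq_cocompact hp 0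
        simpa using this
      simpa using this.const_mul (M * C * rexp (L * |u| + L ^ 2))
    rw [cocompact_eq_atBot_atTop] at hgt
    have := integral_vertical_eq_of_le (F := fun s => B s * cexp (s * u + (ε n ^ 2 : ℝ) * s ^ 2)) hσ
      (fun s h1 h2 => (hd s h1 h2).mul (by fun_prop))
      (g := fun y => M * C * rexp (L * |u| + L ^ 2) * rexp (-(ε n ^ 2 / 2) * y ^ 2))
      ((integrable_exp_neg_mul_sq hp).const_mul _)
      (hgt.mono_left le_sup_right) (hgt.mono_left le_sup_left) ?_
    · exact ⟨this.2.1, this.2.2⟩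
    · intro x y h1 h2
      have hx : |x| ≤ L := by
        rw [abs_le]; constructor
        · linarith [neg_abs_le σ, abs_nonneg c]
        · linarith [le_abs_self c, abs_nonneg σ]
      rw [norm_mul, Complex.norm_exp]
      have hre : ((x + y * I : ℂ) * u + (ε n ^ 2 : ℝ) * (x + y * I : ℂ) ^ 2).re = x * u + ε n ^ 2 * (x ^ 2 - y ^ 2) := by
        simp only [add_re, mul_re, ofReal_re, I_re, mul_zero, ofReal_im, I_im, mul_one, sub_self, add_zero,
          add_im, mul_im, zero_add, sub_zero, sq]
        simp
      rw [hre]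
      have hb := hg (x + y * I) (by simpa using h1) (by simpa using h2)
      simp only [add_im, ofReal_im, mul_im, ofReal_re, I_im, mul_one, I_re, mul_zero, add_zero, zero_add] at hb
      calc _ ≤ M * (C * rexp (ε n ^ 2 / 2 * y ^ 2)) * rexp (x * u + ε n ^ 2 * (x ^ 2 - y ^ 2)) := by
            gcongr
            exact hb.trans (by gcongr; exact hCb y)
        _ = M * C * rexp (ε n ^ 2 / 2 * y ^ 2 + (x * u + ε n ^ 2 * (x ^ 2 - y ^ 2))) := by
            rw [Real.exp_add (ε n ^ 2 / 2 * y ^ 2)]; ring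
        _ ≤ M * C * rexp (L * |u| + L ^ 2 + -(ε n ^ 2 / 2) * y ^ 2) := by
            gcongr M * C * rexp ?_
            have h3 : x * u ≤ L * |u| := by
              calc x * u ≤ |x * u| := le_abs_self _
                _ = |x| * |u| := abs_mul _ _
                _ ≤ _ := by gcongr
            have h4 : ε n ^ 2 * x ^ 2 ≤ L ^ 2 := by
              calc ε n ^ 2 * x ^ 2 ≤ 1 * x ^ 2 := by
                    gcongr; exact pow_le_one₀ (hε n).le (hε1 n)
                _ = |x| ^ 2 := by rw [one_mul, sq_abs]
                _ ≤ L ^ 2 := by gcongr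
            linarith
        _ = _ := by rw [Real.exp_add]; ring
  have hfi : ∀ n, Integrable (f n) := by
    intro n
    have := (hshift n 0).1
    simpa [hf] using this
  have hP : ∀ (n : ℕ) (u : ℝ), ∫ w : ℝ, q (u + ε n * w) * (rexp (-(w ^ 2) / 4) : ℝ)
      = ((√π)⁻¹ * rexp (σ * u) : ℝ) * 𝓕 (f n) (-(2 * π)⁻¹ * u) := by
    intro n u
    have h1 := gaussian_mollify_eq hqi hB (hε n) u
    rw [(hshift n u).2] at h1
    have h2 : ∫ t : ℝ, B (σ + t * I) * cexp ((σ + t * I) * u + (ε n ^ 2 : ℝ) * (σ + t * I) ^ 2)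
        = (rexp (σ * u) : ℝ) * 𝓕 (f n) (-(2 * π)⁻¹ * u) := by
      rw [Real.fourier_real_eq_integral_exp_smul, ← integral_const_mul]
      congr 1; ext t
      rw [smul_eq_mul, hf]
      simp only
      rw [mul_left_comm (cexp _), mul_left_comm _ (B _), Complex.ofReal_exp, ← Complex.exp_add, ← Complex.exp_add]
      congr 2
      push_cast
      field_simp
      ring
    have hpi : (√π : ℂ) ≠ 0 := by
      exact_mod_cast (Real.sqrt_pos.2 Real.pi_pos).ne'
    rw [h2] at h1
    push_cast at h1 ⊢
    rw [mul_assoc, h1]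
    field_simp
  have hF : ∀ n, Continuous (𝓕 (f n)) := fun n =>
    (VectorFourier.fourierIntegral_continuous Real.continuous_fourierChar continuous_inner (hfi n))
  set P : ℕ → ℝ → ℂ := fun n u => ((2 * π)⁻¹ * rexp (σ * u) : ℝ) * 𝓕 (f n) (-(2 * π)⁻¹ * u) with hPdef
  have hPt : ∀ u, ContinuousAt q u → Filter.Tendsto (fun n => P n u) Filter.atTop (nhds (q u)) := by
    intro u hu
    have h1 := (tendsto_gaussian_mollify hq hc₀ hqb hu).const_mul ((2 * √π : ℝ) : ℂ)⁻¹
    have hpi : √π ≠ 0 := (Real.sqrt_pos.2 Real.pi_pos).ne'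
    have hpi' : (((2 * √π : ℝ)) : ℂ) ≠ 0 := by
      exact_mod_cast (mul_pos two_pos (Real.sqrt_pos.2 Real.pi_pos)).ne'
    rw [← mul_assoc, inv_mul_cancel₀ hpi', one_mul] at h1
    refine h1.congr fun n => ?_
    rw [hP n u, hPdef]
    simp only
    rw [← mul_assoc, ← Complex.ofReal_inv, ← Complex.ofReal_mul]
    congr 2
    rw [← mul_assoc, ← mul_inv]
    congr 2
    rw [mul_assoc, Real.mul_self_sqrt Real.pi_pos.le]
  have hle : ∀ n, ∫⁻ u, ‖P n u‖ₑ ^ 2 * ENNReal.ofReal (rexp (-2 * σ * u))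
      ≤ ENNReal.ofReal (rexp (2 * σ ^ 2)) * ∫⁻ t : ℝ, ‖B (σ + t * I)‖ₑ ^ 2 := by
    intro n
    have e1 : ∀ u, ‖P n u‖ₑ ^ 2 * ENNReal.ofReal (rexp (-2 * σ * u))
        = ENNReal.ofReal ((2 * π)⁻¹ ^ 2) * ‖𝓕 (f n) (-((2 * π)⁻¹ * u))‖ₑ ^ 2 := by
      intro u
      rw [hPdef]
      simp only
      rw [enorm_mul, mul_pow, mul_right_comm, show -(2 * π)⁻¹ * u = -((2 * π)⁻¹ * u) by ring]
      congr 1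
      rw [← ofReal_norm, Complex.norm_real, Real.norm_of_nonneg (by positivity), ← ENNReal.ofReal_pow (by positivity),
        ← ENNReal.ofReal_mul (by positivity)]
      congr 1
      rw [mul_pow, mul_assoc, ← Real.exp_nat_mul, ← Real.exp_add]
      rw [show ((2:ℕ):ℝ) * (σ * u) + -2 * σ * u = 0 by push_cast; ring]
      simp
    simp_rw [e1]
    rw [lintegral_const_mul _ (by
      apply Measurable.pow_const
      apply Measurable.enorm
      exact ((hF n).comp (by fun_prop : Continuous fun u : ℝ => -((2 * π)⁻¹ * u))).measurable)]
    have h2 := lintegral_eq_ofReal_mul_lintegral_comp_mul (fun x => ‖𝓕 (f n) (-x)‖ₑ ^ 2) (a := (2 * π)⁻¹) (by positivity)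
    have h3 : ∫⁻ x, ‖𝓕 (f n) (-x)‖ₑ ^ 2 = ∫⁻ x, ‖𝓕 (f n) x‖ₑ ^ 2 :=
      lintegral_neg_eq_self (μ := volume) (fun x => ‖𝓕 (f n) x‖ₑ ^ 2)
    rw [sq (2 * π)⁻¹, ENNReal.ofReal_mul (by positivity), mul_assoc, ← h2, h3]
    have h4 := lintegral_enorm_fourier_sq_le (hfi n)
    calc _ ≤ 1 * ∫⁻ t, ‖f n t‖ₑ ^ 2 := by
          gcongr
          rw [← ENNReal.ofReal_one]
          apply ENNReal.ofReal_le_ofReal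
          apply inv_le_one_of_one_le₀
          linarith [Real.pi_gt_three]
      _ ≤ ∫⁻ t : ℝ, ENNReal.ofReal (rexp (2 * σ ^ 2)) * ‖B (σ + t * I)‖ₑ ^ 2 := by
          rw [one_mul]
          apply lintegral_mono
          intro t
          rw [hf]
          simp only
          rw [enorm_mul, mul_pow, mul_comm]
          gcongr
          rw [← ofReal_norm, ← ENNReal.ofReal_pow (by positivity), Complex.norm_exp, ← Real.exp_nat_mul]
          apply ENNReal.ofReal_le_ofReal
          rw [Real.exp_le_exp]
          have hre : (((ε n ^ 2 : ℝ) : ℂ) * (σ + t * I : ℂ) ^ 2).re = ε n ^ 2 * (σ ^ 2 - t ^ 2) := by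
            rw [Complex.re_ofReal_mul]; simp [sq]
          rw [hre]
          push_cast
          have := pow_le_one₀ (n := 2) (hε n).le (hε1 n)
          nlinarith [sq_nonneg σ, sq_nonneg t, mul_nonneg (sq_nonneg (ε n)) (sq_nonneg t), mul_le_mul_of_nonneg_right this (sq_nonneg σ)]
      _ = _ := by
        rw [lintegral_const_mul' _ _ ENNReal.ofReal_ne_top]
  have hPm : ∀ n, Measurable fun u => ‖P n u‖ₑ ^ 2 * ENNReal.ofReal (rexp (-2 * σ * u)) := by
    intro n
    have : Measurable (P n) := by
      refine Continuous.measurable ?_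
      have := (hF n).comp (by fun_prop : Continuous fun u : ℝ => -(2 * π)⁻¹ * u)
      simp only [Function.comp_def] at this
      rw [hPdef]
      fun_prop
    fun_prop
  calc ∫⁻ u : ℝ, ‖q u‖ₑ ^ 2 * ENNReal.ofReal (rexp (-2 * σ * u))
      ≤ ∫⁻ u, Filter.liminf (fun n => ‖P n u‖ₑ ^ 2 * ENNReal.ofReal (rexp (-2 * σ * u))) Filter.atTop := by
        apply lintegral_mono_ae
        filter_upwards [hqc] with u hu
        have h1 : Filter.Tendsto (fun n => ‖P n u‖ₑ ^ 2 * ENNReal.ofReal (rexp (-2 * σ * u))) Filter.atTop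
            (nhds (‖q u‖ₑ ^ 2 * ENNReal.ofReal (rexp (-2 * σ * u)))) := by
          apply ENNReal.Tendsto.mul_const _ (Or.inr ENNReal.ofReal_ne_top)
          exact ((ENNReal.continuous_pow 2).tendsto _).comp ((continuous_enorm.tendsto _).comp (hPt u hu))
        exact h1.liminf_eq.ge
    _ ≤ Filter.liminf (fun n => ∫⁻ u, ‖P n u‖ₑ ^ 2 * ENNReal.ofReal (rexp (-2 * σ * u))) Filter.atTop :=
        lintegral_liminf_le hPm
    _ ≤ _ := by
        refine Filter.liminf_le_of_le ?_ ?_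
        · isBoundedDefault
        · intro b hb
          obtain ⟨n, hn⟩ := hb.exists
          exact hn.trans (hle n)

end

theorem exp_image_univ_eq_Ioi : rexp '' Set.univ = Set.Ioi 0 := by
  rw [Set.image_univ, Real.range_exp]

theorem abs_exp_smul_cpow (s y : ℂ) (u : ℝ) :
    |rexp u| • ((rexp u : ℂ) ^ (-s - 1) • y) = y * cexp (-s * u) := by
  rw [abs_of_pos (Real.exp_pos u), Complex.cpow_def_of_ne_zero (by exact_mod_cast (Real.exp_pos u).ne'),
    ← Complex.ofReal_log (Real.exp_pos u).le, Real.log_exp, smul_eq_mul, Complex.real_smul,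
    Complex.ofReal_exp, ← mul_assoc, ← Complex.exp_add, mul_comm]
  congr 2; ring

/-- A two-sided Laplace transform is a Mellin transform. -/
theorem integral_comp_exp_eq_mellin (h : ℝ → ℂ) (s : ℂ) :
    ∫ u : ℝ, h (rexp u) * cexp (-s * u) = mellin h (-s) := by
  rw [mellin, ← exp_image_univ_eq_Ioi, integral_image_eq_integral_abs_deriv_smul
    MeasurableSet.univ (fun x _ => (Real.hasDerivAt_exp x).hasDerivWithinAt) Real.exp_injective.injOn]
  simp only [abs_exp_smul_cpow, Measure.restrict_univ]

/-- The Laplace transform of a summatory function. -/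
theorem integral_summatory_exp (f : ℕ → ℂ) {r : ℝ} (hr : 0 ≤ r) {s : ℂ} (hs : r < s.re)
    (hS : LSeriesSummable f s)
    (hO : (fun n => ∑ k ∈ Finset.Icc 1 n, f k) =O[Filter.atTop] fun n => (n : ℝ) ^ r) :
    ∫ u : ℝ, (∑ k ∈ Finset.Icc 1 ⌊rexp u⌋₊, f k) * cexp (-s * u) = LSeries f s / s := by
  have h0 : s ≠ 0 := by
    rintro rfl
    simp at hs; linarith
  rw [integral_comp_exp_eq_mellin (fun x => ∑ k ∈ Finset.Icc 1 ⌊x⌋₊, f k), mellin,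
    LSeries_eq_mul_integral f hr hs hS hO, mul_div_cancel_left₀ _ h0,
    ← integral_indicator measurableSet_Ioi, ← integral_indicator measurableSet_Ioi]
  apply integral_congr_ae
  have h1 : ∀ᵐ x : ℝ, x ≠ 1 := by simp [ae_iff]
  filter_upwards [h1] with x hx
  by_cases h : 1 < x
  · rw [Set.indicator_of_mem (show x ∈ Set.Ioi (0:ℝ) from by simp; linarith), Set.indicator_of_mem (show x ∈ Set.Ioi (1:ℝ) from h),
      smul_eq_mul, mul_comm]
    congr 2; ring
  · rw [Set.indicator_of_notMem (show x ∉ Set.Ioi (1:ℝ) from h)]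
    have : ⌊x⌋₊ = 0 := Nat.floor_eq_zero.2 (lt_of_le_of_ne (not_lt.1 h) hx)
    simp [Set.indicator, this]

theorem log_factorial_bounds (n : ℕ) :
    (n + 1) * Real.log (n + 1) - (n + 1) + 1 ≤ ∑ k ∈ Finset.Icc 1 (n + 1), Real.log k ∧
    ∑ k ∈ Finset.Icc 1 (n + 1), Real.log k ≤ (n + 2) * Real.log (n + 1) - (n + 1) + 1 := by
  induction n with
  | zero => simp
  | succ n ih =>
    rw [Finset.sum_Icc_succ_top (by omega)]
    have hn : (0 : ℝ) < n + 1 := by positivity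
    have h1 : Real.log ((n + 2) / (n + 1)) ≤ (n + 2) / (n + 1) - 1 := Real.log_le_sub_one_of_pos (by positivity)
    have h2 := Real.one_sub_inv_le_log_of_pos (show (0:ℝ) < (n + 2) / (n + 1) by positivity)
    rw [Real.log_div (by positivity) (by positivity)] at h1 h2
    rw [inv_div, one_sub_div (by positivity), div_le_iff₀ (by positivity)] at h2
    rw [div_sub_one (by positivity), le_div_iff₀ (by positivity)] at h1
    push_cast
    rw [show (n:ℝ) + 1 + 1 = n + 2 by ring]
    constructor
    · nlinarith [ih.1]
    · nlinarith [ih.2]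

/-- The error term in `log ⌊x⌋! ≈ x log x - x + 1`. -/
noncomputable def logFactorialError (x : ℝ) : ℝ :=
  if x < 1 then 0 else ∑ k ∈ Finset.Icc 1 ⌊x⌋₊, Real.log k - (x * Real.log x - x + 1)

theorem hasDerivAt_mul_log_sub_add_one {x : ℝ} (hx : 0 < x) :
    HasDerivAt (fun x : ℝ => x * Real.log x - x + 1) (Real.log x) x := by
  have := (((hasDerivAt_id x).mul (Real.hasDerivAt_log hx.ne')).sub (hasDerivAt_id x)).add_const (1:ℝ)
  convert! this using 1
  rw [id_eq, mul_inv_cancel₀ hx.ne']; ring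

theorem mul_log_sub_add_one_sub_le {x y : ℝ} (hx : 1 ≤ x) (hxy : x ≤ y) :
    0 ≤ (y * Real.log y - y + 1) - (x * Real.log x - x + 1) ∧
    (y * Real.log y - y + 1) - (x * Real.log x - x + 1) ≤ (y - x) * Real.log y := by
  rcases hxy.eq_or_lt with rfl | h
  · simp
  obtain ⟨z, hz, hz'⟩ := exists_hasDerivAt_eq_slope (fun x : ℝ => x * Real.log x - x + 1) Real.log h
    (fun z hz => (hasDerivAt_mul_log_sub_add_one (by linarith [hz.1])).continuousAt.continuousWithinAt)
    (fun z hz => (hasDerivAt_mul_log_sub_add_one (by linarith [hz.1])))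
  rw [eq_div_iff (by linarith)] at hz'
  rw [← hz']
  have h1 : 0 ≤ Real.log z := Real.log_nonneg (by linarith [hz.1])
  have h2 : Real.log z ≤ Real.log y := Real.log_le_log (by linarith [hz.1]) hz.2.le
  constructor
  · apply mul_nonneg h1; linarith
  · rw [mul_comm]; apply mul_le_mul_of_nonneg_left h2; linarith

theorem abs_logFactorialError_le {x : ℝ} (hx : 1 ≤ x) : |logFactorialError x| ≤ Real.log x := by
  rw [logFactorialError, if_neg (not_lt.2 hx)]
  obtain ⟨n, hn⟩ : ∃ n, ⌊x⌋₊ = n + 1 := Nat.exists_eq_succ_of_ne_zero (Nat.floor_pos.2 hx).ne'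
  have h1 := Nat.floor_le (show 0 ≤ x by linarith)
  have h2 := Nat.lt_floor_add_one x
  obtain ⟨h3, h4⟩ := log_factorial_bounds n
  rw [hn] at h1 h2 ⊢
  push_cast at h1 h2
  have h5 := mul_log_sub_add_one_sub_le (x := n + 1) (y := x) (by linarith [Nat.cast_nonneg (α := ℝ) n]) h1
  have h6 : Real.log (n + 1) ≤ Real.log x := Real.log_le_log (by positivity) h1
  have h7 : 0 ≤ Real.log x := Real.log_nonneg hx
  have h8 : (x - (n + 1)) * Real.log x ≤ 1 * Real.log x := by gcongr; linarith
  rw [abs_le]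
  constructor <;> linarith

theorem measurable_logFactorialError : Measurable logFactorialError := by
  unfold logFactorialError
  apply Measurable.ite measurableSet_Iio measurable_const
  have : Measurable fun x : ℝ => ∑ k ∈ Finset.Icc 1 ⌊x⌋₊, Real.log k :=
    (measurable_from_nat (f := fun n : ℕ => ∑ k ∈ Finset.Icc 1 n, Real.log k)).comp Nat.measurable_floor
  fun_prop

theorem integrable_comp_exp_of_le {h : ℝ → ℂ} (hm : Measurable h) (h0 : ∀ x < 1, h x = 0)
    {K r : ℝ} (hb : ∀ x, 1 ≤ x → ‖h x‖ ≤ K * x ^ r) {s : ℂ} (hs : r < s.re) :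
    Integrable fun u : ℝ => h (rexp u) * cexp (-s * u) := by
  have hint : IntegrableOn (fun u : ℝ => K * rexp ((r - s.re) * u)) (Set.Ici 0) := by
    rw [integrableOn_Ici_iff_integrableOn_Ioi]
    exact (integrableOn_exp_mul_Ioi (by linarith) 0).const_mul K
  rw [← integrable_indicator_iff measurableSet_Ici] at hint
  refine hint.mono' (Measurable.aestronglyMeasurable (by fun_prop)) (Filter.Eventually.of_forall fun u => ?_)
  by_cases hu : 0 ≤ u
  · rw [Set.indicator_of_mem (show u ∈ Set.Ici (0:ℝ) from hu), norm_mul, Complex.norm_exp]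
    have := hb (rexp u) (Real.one_le_exp hu)
    rw [← Real.exp_mul] at this
    calc _ ≤ K * rexp (u * r) * rexp ((-s * u).re) := by gcongr
      _ = _ := by
        rw [mul_assoc, ← Real.exp_add]
        congr 2; simp; ring
  · rw [Set.indicator_of_notMem (show u ∉ Set.Ici (0:ℝ) from hu), h0 _ (by simpa using hu)]
    simp

theorem differentiableAt_laplace_of_le {h : ℝ → ℂ} (hm : Measurable h) (h0 : ∀ x < 1, h x = 0)
    {K r : ℝ} (hb : ∀ x, 1 ≤ x → ‖h x‖ ≤ K * x ^ r) {s : ℂ} (hs : r < s.re) :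
    DifferentiableAt ℂ (fun s : ℂ => ∫ u : ℝ, h (rexp u) * cexp (-s * u)) s := by
  simp_rw [integral_comp_exp_eq_mellin]
  have hK : 0 ≤ K := by
    have := hb 1 le_rfl
    simp at this
    exact (norm_nonneg _).trans this
  have hb' : ∀ x, 0 < x → ‖h x‖ ≤ K * x ^ r := by
    intro x hx
    rcases le_or_gt 1 x with h1 | h1
    · exact hb x h1
    · rw [h0 x h1, norm_zero]; positivity
  have key : DifferentiableAt ℂ (mellin h) (-s) := by
    refine mellin_differentiableAt_of_isBigO_rpow (a := -r) (b := (-s).re - 1) ?_ ?_ (by simpa using hs) ?_ (by linarith)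
    · have hc : ContinuousOn (fun x : ℝ => K * x ^ r) (Set.Ioi 0) := by
        intro x hx
        exact (continuousAt_const.mul (Real.continuousAt_rpow_const _ _ (Or.inl (ne_of_gt hx)))).continuousWithinAt
      have hl := hc.locallyIntegrableOn (μ := volume) measurableSet_Ioi
      intro x hx
      obtain ⟨t, ht, hi⟩ := hl x hx
      refine ⟨t ∩ Set.Ioi 0, Filter.inter_mem ht self_mem_nhdsWithin, ?_⟩
      refine (hi.mono_set Set.inter_subset_left).mono' hm.aestronglyMeasurable.restrict ?_
      have : ∀ᵐ y ∂(volume.restrict (Set.Ioi (0:ℝ))), ‖h y‖ ≤ K * y ^ r :=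
        (ae_restrict_mem measurableSet_Ioi).mono fun y hy => hb' y hy
      exact ae_mono (Measure.restrict_mono Set.inter_subset_right le_rfl) this
    · rw [neg_neg]
      refine Asymptotics.IsBigO.of_bound K ?_
      filter_upwards [Filter.eventually_gt_atTop 0] with x hx
      rw [Real.norm_of_nonneg (by positivity)]
      exact hb' x hx
    · refine Asymptotics.IsBigO.of_bound 1 ?_
      have : Set.Ioo (0:ℝ) 1 ∈ nhdsWithin (0:ℝ) (Set.Ioi 0) := Ioo_mem_nhdsGT one_pos
      filter_upwards [this] with x hx
      rw [h0 x hx.2]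
      simp
  exact key.comp s (differentiableAt_id.neg)

theorem integral_Ioi_mul_exp {a : ℂ} (ha : 0 < a.re) :
    IntegrableOn (fun u : ℝ => (u : ℂ) * cexp (-a * u)) (Set.Ioi 0) ∧
    ∫ u : ℝ in Set.Ioi 0, (u : ℂ) * cexp (-a * u) = 1 / a ^ 2 := by
  have h0 : a ≠ 0 := by rintro rfl; simp at ha
  have hnorm : ∀ u : ℝ, ‖cexp (-a * u)‖ = rexp (-a.re * u) := by
    intro u; rw [Complex.norm_exp]; simp
  have hi : IntegrableOn (fun u : ℝ => (u : ℂ) * cexp (-a * u)) (Set.Ioi 0) := by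
    have h1 := (integrableOn_exp_mul_Ioi (show -(a.re / 2) < 0 by linarith) 0).const_mul (2 / a.re)
    refine h1.mono' (Continuous.aestronglyMeasurable (by fun_prop)) ?_
    filter_upwards [ae_restrict_mem measurableSet_Ioi] with u hu
    have hu : 0 < u := hu
    rw [norm_mul, hnorm, Complex.norm_real, Real.norm_of_nonneg hu.le]
    have h2 := Real.add_one_le_exp (a.re / 2 * u)
    calc u * rexp (-a.re * u) = 2 / a.re * (a.re / 2 * u) * rexp (-a.re * u) := by field_simp
      _ ≤ 2 / a.re * (rexp (a.re / 2 * u)) * rexp (-a.re * u) := by gcongr; linarith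
      _ = _ := by rw [mul_assoc, ← Real.exp_add]; congr 2; ring
  refine ⟨hi, ?_⟩
  have ht : Filter.Tendsto (fun u : ℝ => -cexp (-a * u) * (u / a + 1 / a ^ 2)) Filter.atTop (nhds 0) := by
    have h1 := tendsto_rpow_mul_exp_neg_mul_atTop_nhds_zero 1 a.re ha
    have h2 := tendsto_rpow_mul_exp_neg_mul_atTop_nhds_zero 0 a.re ha
    have h3 := (h1.const_mul (1 / ‖a‖)).add (h2.const_mul (1 / ‖a‖ ^ 2))
    simp only [Real.rpow_one, Real.rpow_zero, one_mul, mul_zero, add_zero] at h3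
    refine squeeze_zero_norm' ?_ h3
    filter_upwards [Filter.eventually_gt_atTop 0] with u hu
    rw [norm_mul, norm_neg, hnorm]
    have : ‖(u : ℂ) / a + 1 / a ^ 2‖ ≤ u / ‖a‖ + 1 / ‖a‖ ^ 2 := by
      refine (norm_add_le _ _).trans ?_
      simp [abs_of_pos hu]
    calc _ ≤ rexp (-a.re * u) * (u / ‖a‖ + 1 / ‖a‖ ^ 2) := by gcongr
      _ = _ := by ring
  have := integral_Ioi_of_hasDerivAt_of_tendsto' (a := 0) (f := fun u : ℝ => -cexp (-a * u) * (u / a + 1 / a ^ 2))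
    (f' := fun u : ℝ => (u : ℂ) * cexp (-a * u)) (fun u _ => ?_) hi ht
  · rw [this]; simp
  · have h1 : HasDerivAt (fun u : ℝ => (u : ℂ)) 1 u := Complex.ofRealCLM.hasDerivAt
    have h2 := ((h1.const_mul (-a)).cexp.neg).mul ((h1.div_const a).add_const (1 / a ^ 2))
    refine h2.congr_deriv ?_
    simp only [Pi.neg_apply]
    field_simp
    ring

theorem integral_main_logFactorial {s : ℂ} (hs : 1 < s.re) :
    Integrable (fun u : ℝ => Set.indicator (Set.Ioi 0)
      (fun u : ℝ => ((rexp u * u - rexp u + 1 : ℝ) : ℂ) * cexp (-s * u)) u) ∧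
    ∫ u : ℝ, Set.indicator (Set.Ioi 0)
      (fun u : ℝ => ((rexp u * u - rexp u + 1 : ℝ) : ℂ) * cexp (-s * u)) u = 1 / (s * (s - 1) ^ 2) := by
  obtain ⟨i1, e1⟩ := integral_Ioi_mul_exp (a := s - 1) (by simpa using hs)
  have i2 := integrableOn_exp_mul_complex_Ioi (a := -(s - 1)) (by simpa using hs) 0
  have e2 := integral_exp_mul_complex_Ioi (a := -(s - 1)) (by simpa using hs) 0
  have i3 := integrableOn_exp_mul_complex_Ioi (a := -s) (by simp; linarith) 0
  have e3 := integral_exp_mul_complex_Ioi (a := -s) (by simp; linarith) 0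
  have hfun : (fun u : ℝ => ((rexp u * u - rexp u + 1 : ℝ) : ℂ) * cexp (-s * u))
      = fun u : ℝ => ((u : ℂ) * cexp (-(s - 1) * u) - cexp (-(s - 1) * u)) + cexp (-s * u) := by
    ext u
    have : cexp (-(s - 1) * u) = rexp u * cexp (-s * u) := by
      rw [Complex.ofReal_exp, ← Complex.exp_add]; congr 1; ring
    rw [this]
    push_cast
    ring
  have h0 : s ≠ 0 := by rintro rfl; simp at hs; linarith
  have h1 : s - 1 ≠ 0 := by intro h; rw [sub_eq_zero] at h; subst h; simp at hs
  rw [integrable_indicator_iff measurableSet_Ioi, integral_indicator measurableSet_Ioi, hfun]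
  refine ⟨(i1.sub i2).add i3, ?_⟩
  rw [integral_add (by exact i1.sub i2) i3, integral_sub i1 i2, e1, e2, e3]
  simp only [ofReal_zero, mul_zero, Complex.exp_zero]
  field_simp
  ring

theorem logFactorialError_of_lt {x : ℝ} (hx : x < 1) : logFactorialError x = 0 := by
  simp [logFactorialError, hx]

theorem abs_logFactorialError_le_rpow {r : ℝ} (hr : 0 < r) {x : ℝ} (hx : 1 ≤ x) :
    ‖(logFactorialError x : ℂ)‖ ≤ 1 / r * x ^ r := by
  rw [Complex.norm_real, Real.norm_eq_abs]
  refine (abs_logFactorialError_le hx).trans ?_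
  have := Real.log_le_rpow_div (show 0 ≤ x by linarith) hr
  rwa [div_eq_mul_one_div, mul_comm] at this

theorem integral_logFactorialError_exp_of_two_lt {s : ℂ} (hs : 2 < s.re) :
    ∫ u : ℝ, (logFactorialError (rexp u) : ℂ) * cexp (-s * u) = -deriv riemannZeta₀ s / s := by
  have h0 : s ≠ 0 := by rintro rfl; simp at hs; linarith
  have h1 : s ≠ 1 := by rintro rfl; norm_num at hs
  have h1' : s - 1 ≠ 0 := sub_ne_zero.2 h1
  have habs : LSeries.abscissaOfAbsConv (1 : ℕ → ℂ) < s.re := by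
    rw [LSeries.abscissaOfAbsConv_one]
    exact_mod_cast (by linarith : (1:ℝ) < s.re)
  have hS := LSeriesSummable_logMul_of_lt_re habs
  have hL : LSeries (LSeries.logMul 1) s = -deriv riemannZeta s := by
    rw [← neg_eq_iff_eq_neg, ← LSeries_deriv habs]
    apply Filter.EventuallyEq.deriv_eq
    have : {z : ℂ | 1 < z.re} ∈ nhds s :=
      (isOpen_lt continuous_const continuous_re).mem_nhds (show 1 < s.re by linarith)
    filter_upwards [this] with z hz
    exact LSeries_one_eq_riemannZeta hz
  have hO : (fun n => ∑ k ∈ Finset.Icc 1 n, LSeries.logMul (1 : ℕ → ℂ) k) =O[Filter.atTop]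
      fun n => (n : ℝ) ^ (2 : ℝ) := by
    refine Asymptotics.IsBigO.of_bound 1 (Filter.Eventually.of_forall fun n => ?_)
    rw [one_mul, Real.norm_of_nonneg (by positivity)]
    refine (norm_sum_le _ _).trans ?_
    have : ∀ k ∈ Finset.Icc 1 n, ‖LSeries.logMul (1 : ℕ → ℂ) k‖ ≤ n := by
      intro k hk
      rw [Finset.mem_Icc] at hk
      have hk1 : (1 : ℝ) ≤ k := by exact_mod_cast hk.1
      simp only [LSeries.logMul, Pi.one_apply, mul_one]
      rw [Complex.natCast_log.symm, Complex.norm_real, Real.norm_of_nonneg (Real.log_nonneg hk1)]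
      calc Real.log k ≤ k - 1 := Real.log_le_sub_one_of_pos (by linarith)
        _ ≤ k := by linarith
        _ ≤ n := by exact_mod_cast hk.2
    refine (Finset.sum_le_card_nsmul _ _ _ this).trans ?_
    simp [sq]
  have e1 := integral_summatory_exp (LSeries.logMul 1) (r := 2) (by norm_num) hs hS hO
  obtain ⟨i2, e2⟩ := integral_main_logFactorial (s := s) (by linarith)
  have hsplit : ∀ u : ℝ, (logFactorialError (rexp u) : ℂ) * cexp (-s * u) =
      (∑ k ∈ Finset.Icc 1 ⌊rexp u⌋₊, LSeries.logMul (1 : ℕ → ℂ) k) * cexp (-s * u) -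
      Set.indicator (Set.Ioi 0)
      (fun u : ℝ => ((rexp u * u - rexp u + 1 : ℝ) : ℂ) * cexp (-s * u)) u := by
    intro u
    rcases lt_trichotomy u 0 with hu | hu | hu
    · have : rexp u < 1 := by simpa using hu
      rw [logFactorialError_of_lt this, Nat.floor_eq_zero.2 this, Set.indicator_of_notMem (by simp; linarith)]
      simp
    · subst hu
      simp [logFactorialError]
    · have : ¬ rexp u < 1 := by simp; linarith
      rw [logFactorialError, if_neg this, Set.indicator_of_mem (show u ∈ Set.Ioi (0:ℝ) from hu), Real.log_exp, ← sub_mul]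
      congr 1
      push_cast
      congr 1
      apply Finset.sum_congr rfl
      intro k _
      simp [LSeries.logMul]
  have i0 : Integrable fun u : ℝ => (logFactorialError (rexp u) : ℂ) * cexp (-s * u) :=
    integrable_comp_exp_of_le (h := fun x => (logFactorialError x : ℂ))
      (by have := measurable_logFactorialError; fun_prop) (fun x hx => by simp [logFactorialError_of_lt hx])
      (K := 1 / 1) (r := 1) (fun x hx => abs_logFactorialError_le_rpow one_pos hx) (by linarith)
  have i1 : Integrable fun u : ℝ => (∑ k ∈ Finset.Icc 1 ⌊rexp u⌋₊, LSeries.logMul (1 : ℕ → ℂ) k) * cexp (-s * u) := by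
    refine (i0.add i2).congr (Filter.Eventually.of_forall fun u => ?_)
    simp only [Pi.add_apply]
    rw [hsplit u, sub_add_cancel]
  simp_rw [hsplit]
  rw [integral_sub i1 i2, e1, e2, hL, deriv_riemannZeta_eq_neg_inv_sub_sq_add h1]
  field_simp
  ring

theorem integral_logFactorialError_exp {s : ℂ} (hs : 0 < s.re) :
    ∫ u : ℝ, (logFactorialError (rexp u) : ℂ) * cexp (-s * u) = -deriv riemannZeta₀ s / s := by
  have hopen : IsOpen {z : ℂ | 0 < z.re} := isOpen_lt continuous_const continuous_re
  have hA : AnalyticOnNhd ℂ (fun s : ℂ => ∫ u : ℝ, (logFactorialError (rexp u) : ℂ) * cexp (-s * u)) {z : ℂ | 0 < z.re} := by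
    apply DifferentiableOn.analyticOnNhd _ hopen
    intro z hz
    have hz : 0 < z.re := hz
    exact (differentiableAt_laplace_of_le (h := fun x => (logFactorialError x : ℂ))
      (by have := measurable_logFactorialError; fun_prop) (fun x hx => by simp [logFactorialError_of_lt hx])
      (r := z.re / 2) (fun x hx => abs_logFactorialError_le_rpow (by positivity) hx) (by linarith)).differentiableWithinAt
  have hB : AnalyticOnNhd ℂ (fun s : ℂ => -deriv riemannZeta₀ s / s) {z : ℂ | 0 < z.re} := by
    apply DifferentiableOn.analyticOnNhd _ hopen
    intro z hz
    have hz : 0 < z.re := hz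
    have hz0 : z ≠ 0 := by rintro rfl; simp at hz
    have : DifferentiableAt ℂ (deriv riemannZeta₀) z :=
      (differentiable_riemannZeta₀.analyticAt z).deriv.differentiableAt
    exact (this.neg.div differentiableAt_id hz0).differentiableWithinAt
  have hpre : IsPreconnected {z : ℂ | 0 < z.re} := (convex_halfSpace_re_gt 0).isPreconnected
  refine hA.eqOn_of_preconnected_of_eventuallyEq hB hpre (z₀ := 3) (by simp) ?_ hs
  have : {z : ℂ | 2 < z.re} ∈ nhds (3 : ℂ) :=
      (isOpen_lt continuous_const continuous_re).mem_nhds (by simp; norm_num)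
  filter_upwards [this] with z hz
  exact integral_logFactorialError_exp_of_two_lt hz

theorem sq_sum_log_le {T x : ℝ} (hT : 0 < T) (hx : 1 ≤ x) (hxT : x < T) :
    (∑ k ∈ Finset.Icc 1 ⌊x * (1 + 1 / T)⌋₊, Real.log k - ∑ k ∈ Finset.Icc 1 ⌊x⌋₊, Real.log k) ^ 2
      ≤ ∑ n ∈ Finset.Icc 1 ⌊2 * T⌋₊, if x < n ∧ n ≤ x * (1 + 1 / T) then Real.log n ^ 2 else 0 := by
  have hx1 : x ≤ x * (1 + 1 / T) := by
    have : 0 ≤ x * (1 / T) := by positivity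
    linarith
  have hx2 : x * (1 + 1 / T) ≤ x + 1 := by
    have : x * (1 / T) ≤ 1 := by rw [mul_one_div, div_le_one hT]; exact hxT.le
    linarith
  have h1 : ∑ k ∈ Finset.Icc 1 ⌊x * (1 + 1 / T)⌋₊, Real.log k - ∑ k ∈ Finset.Icc 1 ⌊x⌋₊, Real.log k
      = ∑ k ∈ Finset.Ioc ⌊x⌋₊ ⌊x * (1 + 1 / T)⌋₊, Real.log k := by
    have hfl := Nat.floor_mono hx1
    rw [sub_eq_iff_eq_add, ← Finset.sum_union]
    · apply Finset.sum_congr _ (fun _ _ => rfl)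
      ext k; simp only [Finset.mem_Icc, Finset.mem_union, Finset.mem_Ioc]; omega
    · rw [Finset.disjoint_left]
      intro k; simp only [Finset.mem_Icc, Finset.mem_Ioc]; omega
  have hcard : ((Finset.Ioc ⌊x⌋₊ ⌊x * (1 + 1 / T)⌋₊).card : ℝ) ≤ 1 := by
    rw [Nat.card_Ioc]
    have : ⌊x * (1 + 1 / T)⌋₊ ≤ ⌊x⌋₊ + 1 := by
      rw [← Nat.floor_add_one (by linarith)]
      exact Nat.floor_mono hx2
    exact_mod_cast (by omega : ⌊x * (1 + 1 / T)⌋₊ - ⌊x⌋₊ ≤ 1)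
  rw [h1, ← Finset.sum_filter]
  calc _ ≤ ((Finset.Ioc ⌊x⌋₊ ⌊x * (1 + 1 / T)⌋₊).card : ℝ) * ∑ k ∈ Finset.Ioc ⌊x⌋₊ ⌊x * (1 + 1 / T)⌋₊, Real.log k ^ 2 :=
        sq_sum_le_card_mul_sum_sq
    _ ≤ 1 * ∑ k ∈ Finset.Ioc ⌊x⌋₊ ⌊x * (1 + 1 / T)⌋₊, Real.log k ^ 2 := by
        gcongr
    _ ≤ _ := by
        rw [one_mul]
        apply Finset.sum_le_sum_of_subset_of_nonneg
        · intro k hk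
          rw [Finset.mem_Ioc] at hk
          have h3 : x < k := (Nat.floor_lt (by linarith)).1 hk.1
          have h4 : (k : ℝ) ≤ x * (1 + 1 / T) := (Nat.le_floor_iff (by positivity)).1 hk.2
          rw [Finset.mem_filter, Finset.mem_Icc]
          refine ⟨⟨by omega, Nat.le_floor ?_⟩, h3, h4⟩
          linarith
        · intros; positivity

/-- The majorant used to estimate the short-interval variance of `logFactorialError`. -/
noncomputable def logFactorialMajorant (T : ℝ) (u : ℝ) : ℝ :=
  Set.indicator (Set.Ico (-Real.log (1 + 1 / T)) 0) (fun _ => 4 / T ^ 2) u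
  + (∑ n ∈ Finset.Icc 1 ⌊2 * T⌋₊, Set.indicator (Set.Ico (Real.log n - Real.log (1 + 1 / T)) (Real.log n))
      (fun u => 2 * Real.log n ^ 2 * rexp (-u)) u)
  + Set.indicator (Set.Iic (Real.log T)) (fun u => 2 * Real.log (2 * T) ^ 2 / T ^ 2 * rexp u) u
  + Set.indicator (Set.Ici (Real.log T)) (fun u => 100 * Real.log (2 * T) ^ 2 / √T * rexp (-(1 / 2) * u)) u

theorem logFactorialMajorant_nonneg {T : ℝ} (u : ℝ) :
    0 ≤ logFactorialMajorant T u := by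
  unfold logFactorialMajorant
  have h1 : 0 ≤ Set.indicator (Set.Ico (-Real.log (1 + 1 / T)) 0) (fun _ => 4 / T ^ 2) u :=
    Set.indicator_nonneg (fun _ _ => by positivity) _
  have h2 : 0 ≤ ∑ n ∈ Finset.Icc 1 ⌊2 * T⌋₊, Set.indicator (Set.Ico (Real.log n - Real.log (1 + 1 / T)) (Real.log n))
      (fun u => 2 * Real.log n ^ 2 * rexp (-u)) u :=
    Finset.sum_nonneg fun n _ => Set.indicator_nonneg (fun _ _ => by positivity) _
  have h3 : 0 ≤ Set.indicator (Set.Iic (Real.log T)) (fun u => 2 * Real.log (2 * T) ^ 2 / T ^ 2 * rexp u) u :=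
    Set.indicator_nonneg (fun _ _ => by positivity) _
  have h4 : 0 ≤ Set.indicator (Set.Ici (Real.log T)) (fun u => 100 * Real.log (2 * T) ^ 2 / √T * rexp (-(1 / 2) * u)) u :=
    Set.indicator_nonneg (fun _ _ => by positivity) _
  positivity

theorem sq_sub_logFactorialError_le {T σ : ℝ} (hT : 3 ≤ T) (hσ : 1 / 2 ≤ σ) (hσ' : σ ≤ 1) (u : ℝ) :
    (logFactorialError (rexp u * (1 + 1 / T)) - logFactorialError (rexp u)) ^ 2 * rexp (-2 * σ * u)
      ≤ logFactorialMajorant T u := by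
  have hT0 : 0 < T := by linarith
  set l := Real.log (1 + 1 / T) with hl
  have hlam : rexp l = 1 + 1 / T := Real.exp_log (by positivity)
  have hl0 : 0 ≤ l := Real.log_nonneg (by linarith [show 0 ≤ 1 / T by positivity])
  have hl1 : l ≤ 1 / T := by
    have := Real.log_le_sub_one_of_pos (show 0 < 1 + 1 / T by positivity)
    rw [hl]; linarith
  have hT1 : 1 / T ≤ 1 / 3 := one_div_le_one_div_of_le (by norm_num) hT
  have h1 : 0 ≤ Set.indicator (Set.Ico (-l) 0) (fun _ => 4 / T ^ 2) u :=
    Set.indicator_nonneg (fun _ _ => by positivity) _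
  have h2 : 0 ≤ ∑ n ∈ Finset.Icc 1 ⌊2 * T⌋₊, Set.indicator (Set.Ico (Real.log n - l) (Real.log n))
      (fun u => 2 * Real.log n ^ 2 * rexp (-u)) u :=
    Finset.sum_nonneg fun n _ => Set.indicator_nonneg (fun _ _ => by positivity) _
  have h3 : 0 ≤ Set.indicator (Set.Iic (Real.log T)) (fun u => 2 * Real.log (2 * T) ^ 2 / T ^ 2 * rexp u) u :=
    Set.indicator_nonneg (fun _ _ => by positivity) _
  have h4 : 0 ≤ Set.indicator (Set.Ici (Real.log T)) (fun u => 100 * Real.log (2 * T) ^ 2 / √T * rexp (-(1 / 2) * u)) u :=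
    Set.indicator_nonneg (fun _ _ => by positivity) _
  unfold logFactorialMajorant
  rw [← hl]
  rcases lt_or_ge u (-l) with hu | hu
  · have e1 : rexp u * (1 + 1 / T) < 1 := by
      rw [← hlam, ← Real.exp_add, Real.exp_lt_one_iff]; linarith
    have e2 : rexp u < 1 := by rw [Real.exp_lt_one_iff]; linarith
    rw [logFactorialError_of_lt e1, logFactorialError_of_lt e2]
    simp only [sub_self, ne_eq, OfNat.ofNat_ne_zero, not_false_eq_true, zero_pow, zero_mul]
    positivity
  rcases lt_or_ge u 0 with hu0 | hu0
  · have e1 : 1 ≤ rexp u * (1 + 1 / T) := by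
      rw [← hlam, ← Real.exp_add, Real.one_le_exp_iff]; linarith
    have e2 : rexp u < 1 := by rw [Real.exp_lt_one_iff]; linarith
    have e3 := abs_logFactorialError_le e1
    rw [← hlam, ← Real.exp_add, Real.log_exp, Real.exp_add, hlam] at e3
    rw [logFactorialError_of_lt e2, sub_zero, ← sq_abs, Set.indicator_of_mem (show u ∈ Set.Ico (-l) 0 from ⟨hu, hu0⟩)]
    have e4 : |logFactorialError (rexp u * (1 + 1 / T))| ≤ 1 / T := by linarith
    have e5 : rexp (-2 * σ * u) ≤ 4 := by
      have : -2 * σ * u ≤ 2 * l := by nlinarith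
      calc _ ≤ rexp (2 * l) := Real.exp_le_exp.2 this
        _ = (1 + 1 / T) ^ 2 := by rw [← hlam, ← Real.exp_nat_mul]; norm_num
        _ ≤ (1 + 1 / 3) ^ 2 := by gcongr
        _ ≤ 4 := by norm_num
    have : |logFactorialError (rexp u * (1 + 1 / T))| ^ 2 * rexp (-2 * σ * u) ≤ 4 / T ^ 2 := by
      calc _ ≤ (1 / T) ^ 2 * 4 := by gcongr
        _ = _ := by ring
    linarith
  have e0 : rexp (-2 * σ * u) ≤ rexp (-u) := Real.exp_le_exp.2 (by nlinarith)
  have x1 : 1 ≤ rexp u := Real.one_le_exp hu0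
  have x2 : rexp u ≤ rexp u * (1 + 1 / T) := by
    have : 0 ≤ rexp u * (1 / T) := by positivity
    linarith
  have x3 : rexp u * (1 + 1 / T) ≤ 2 * rexp u := by nlinarith
  have L1 : 1 ≤ Real.log (2 * T) := by
    rw [Real.le_log_iff_exp_le (by positivity)]
    linarith [Real.exp_one_lt_d9]
  rcases lt_or_ge u (Real.log T) with hu1 | hu1
  · have x4 : rexp u < T := by rwa [← Real.lt_log_iff_exp_lt hT0]
    have s1 := sq_sum_log_le hT0 x1 x4
    obtain ⟨m1, m2⟩ := mul_log_sub_add_one_sub_le x1 x2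
    set S := ∑ k ∈ Finset.Icc 1 ⌊rexp u * (1 + 1 / T)⌋₊, Real.log k - ∑ k ∈ Finset.Icc 1 ⌊rexp u⌋₊, Real.log k
    set m := (rexp u * (1 + 1 / T) * Real.log (rexp u * (1 + 1 / T)) - rexp u * (1 + 1 / T) + 1)
      - (rexp u * Real.log (rexp u) - rexp u + 1)
    have e1 : logFactorialError (rexp u * (1 + 1 / T)) - logFactorialError (rexp u) = S - m := by
      rw [logFactorialError, logFactorialError, if_neg (by linarith), if_neg (by linarith)]
      ring
    have e2 : m ≤ rexp u / T * Real.log (2 * T) := by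
      refine m2.trans ?_
      rw [show rexp u * (1 + 1 / T) - rexp u = rexp u / T by ring]
      exact mul_le_mul_of_nonneg_left (Real.log_le_log (by positivity) (by linarith)) (by positivity)
    have e3 : m ^ 2 ≤ (rexp u / T * Real.log (2 * T)) ^ 2 := by gcongr
    rw [e1, Set.indicator_of_mem (show u ∈ Set.Iic (Real.log T) from hu1.le)]
    have e4 : (S - m) ^ 2 ≤ 2 * S ^ 2 + 2 * m ^ 2 := by nlinarith [sq_nonneg (S + m)]
    have e5 : 2 * S ^ 2 * rexp (-u) ≤ ∑ n ∈ Finset.Icc 1 ⌊2 * T⌋₊, Set.indicator (Set.Ico (Real.log n - l) (Real.log n))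
      (fun u => 2 * Real.log n ^ 2 * rexp (-u)) u := by
      calc 2 * S ^ 2 * rexp (-u) ≤ 2 * (∑ n ∈ Finset.Icc 1 ⌊2 * T⌋₊, if rexp u < n ∧ n ≤ rexp u * (1 + 1 / T) then Real.log n ^ 2 else 0) * rexp (-u) := by gcongr
        _ = ∑ n ∈ Finset.Icc 1 ⌊2 * T⌋₊, 2 * (if rexp u < n ∧ n ≤ rexp u * (1 + 1 / T) then Real.log n ^ 2 else 0) * rexp (-u) := by
          rw [Finset.mul_sum, Finset.sum_mul]
        _ ≤ _ := by
          apply Finset.sum_le_sum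
          intro n hn
          rw [Finset.mem_Icc] at hn
          have hn0 : (0:ℝ) < n := by exact_mod_cast hn.1
          split_ifs with hc
          · rw [Set.indicator_of_mem]
            refine ⟨?_, ?_⟩
            · rw [sub_le_iff_le_add, Real.log_le_iff_le_exp hn0, Real.exp_add, hlam]
              exact hc.2
            · rw [Real.lt_log_iff_exp_lt hn0]; exact hc.1
          · rw [mul_zero, zero_mul]
            exact Set.indicator_nonneg (fun _ _ => by positivity) _
    have e6 : 2 * m ^ 2 * rexp (-u) ≤ 2 * Real.log (2 * T) ^ 2 / T ^ 2 * rexp u := by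
      calc _ ≤ 2 * (rexp u / T * Real.log (2 * T)) ^ 2 * rexp (-u) := by gcongr
        _ = 2 * Real.log (2 * T) ^ 2 / T ^ 2 * rexp u * (rexp u * rexp (-u)) := by ring
        _ = _ := by rw [← Real.exp_add]; simp
    calc (S - m) ^ 2 * rexp (-2 * σ * u) ≤ (2 * S ^ 2 + 2 * m ^ 2) * rexp (-u) := by gcongr
      _ = 2 * S ^ 2 * rexp (-u) + 2 * m ^ 2 * rexp (-u) := by ring
      _ ≤ _ := by linarith
  · have b1 := abs_logFactorialError_le x1
    have b2 := abs_logFactorialError_le (x1.trans x2)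
    have b3 : Real.log (rexp u * (1 + 1 / T)) ≤ Real.log (2 * rexp u) := Real.log_le_log (by positivity) x3
    have b4 : Real.log (rexp u) ≤ Real.log (2 * rexp u) := Real.log_le_log (by positivity) (by linarith)
    have b5 : Real.log (2 * rexp u) ≤ 5 * Real.log (2 * T) * rexp ((u - Real.log T) / 4) := by
      have c1 : Real.log (2 * rexp u) = Real.log (2 * T) + (u - Real.log T) := by
        rw [Real.log_mul two_ne_zero (Real.exp_pos u).ne', Real.log_mul two_ne_zero hT0.ne', Real.log_exp]; ring
      have c2 := Real.add_one_le_exp ((u - Real.log T) / 4)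
      have c3 : 1 ≤ rexp ((u - Real.log T) / 4) := Real.one_le_exp (by linarith)
      rw [c1]
      nlinarith
    have b6 : |logFactorialError (rexp u * (1 + 1 / T)) - logFactorialError (rexp u)|
        ≤ 10 * Real.log (2 * T) * rexp ((u - Real.log T) / 4) := by
      refine (abs_sub _ _).trans ?_
      linarith
    rw [Set.indicator_of_mem (show u ∈ Set.Ici (Real.log T) from hu1), ← sq_abs]
    have b7 : (10 * Real.log (2 * T) * rexp ((u - Real.log T) / 4)) ^ 2 * rexp (-u)
        = 100 * Real.log (2 * T) ^ 2 / √T * rexp (-(1 / 2) * u) := by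
      rw [mul_pow, ← Real.exp_nat_mul, mul_assoc, ← Real.exp_add, div_mul_eq_mul_div, mul_div_assoc]
      congr 1
      · ring
      · have hs : √T = rexp (Real.log T / 2) := by rw [Real.exp_half, Real.exp_log hT0]
        rw [eq_div_iff (by positivity), hs, ← Real.exp_add]
        congr 1
        push_cast
        ring
    calc _ ≤ (10 * Real.log (2 * T) * rexp ((u - Real.log T) / 4)) ^ 2 * rexp (-u) := by gcongr
      _ ≤ _ := by rw [b7]; linarith


theorem integrable_logFactorialMajorant {T : ℝ} : Integrable (logFactorialMajorant T) := by
  unfold logFactorialMajorant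
  refine ((Integrable.add (Integrable.add ?_ ?_) ?_).add ?_)
  · exact (integrableOn_const (by simp)).integrable_indicator measurableSet_Ico
  · refine integrable_finsetSum _ fun n _ => ?_
    refine IntegrableOn.integrable_indicator ?_ measurableSet_Ico
    exact (Continuous.integrableOn_Icc (by fun_prop)).mono_set Set.Ico_subset_Icc_self
  · exact IntegrableOn.integrable_indicator ((integrableOn_exp_Iic _).const_mul _) measurableSet_Iic
  · refine IntegrableOn.integrable_indicator (Integrable.const_mul ?_ _) measurableSet_Ici
    exact (integrableOn_Ici_iff_integrableOn_Ioi).2 (integrableOn_exp_mul_Ioi (by norm_num) _)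

theorem integral_logFactorialMajorant_le {T : ℝ} (hT : 3 ≤ T) :
    ∫ u, logFactorialMajorant T u ≤ 2000 * Real.log T ^ 3 / T := by
  have hT0 : 0 < T := by linarith
  unfold logFactorialMajorant
  set l := Real.log (1 + 1 / T) with hl
  have hlam : rexp l = 1 + 1 / T := Real.exp_log (by positivity)
  have hl0 : 0 ≤ l := Real.log_nonneg (by linarith [show 0 ≤ 1 / T by positivity])
  have hl1 : l ≤ 1 / T := by
    have := Real.log_le_sub_one_of_pos (show 0 < 1 + 1 / T by positivity)
    rw [hl]; linarith
  have L1 : 1 ≤ Real.log (2 * T) := by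
    rw [Real.le_log_iff_exp_le (by positivity)]
    linarith [Real.exp_one_lt_d9]
  have i1 : Integrable (Set.indicator (Set.Ico (-l) 0) (fun _ => 4 / T ^ 2)) :=
    (integrableOn_const (by simp)).integrable_indicator measurableSet_Ico
  have i2 : ∀ n ∈ Finset.Icc 1 ⌊2 * T⌋₊, Integrable (Set.indicator (Set.Ico (Real.log n - l) (Real.log n))
      (fun u => 2 * Real.log n ^ 2 * rexp (-u))) := fun n _ =>
    IntegrableOn.integrable_indicator ((Continuous.integrableOn_Icc (by fun_prop)).mono_set Set.Ico_subset_Icc_self)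
      measurableSet_Ico
  have i3 : Integrable (Set.indicator (Set.Iic (Real.log T)) (fun u => 2 * Real.log (2 * T) ^ 2 / T ^ 2 * rexp u)) :=
    IntegrableOn.integrable_indicator ((integrableOn_exp_Iic _).const_mul _) measurableSet_Iic
  have i4 : Integrable (Set.indicator (Set.Ici (Real.log T)) (fun u => 100 * Real.log (2 * T) ^ 2 / √T * rexp (-(1 / 2) * u))) :=
    IntegrableOn.integrable_indicator (Integrable.const_mul ((integrableOn_Ici_iff_integrableOn_Ioi).2
      (integrableOn_exp_mul_Ioi (by norm_num) _)) _) measurableSet_Ici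
  have i2' := integrable_finsetSum _ i2
  rw [integral_add (by exact (i1.add i2').add i3) i4, integral_add (by exact i1.add i2') i3, integral_add i1 i2',
    integral_finsetSum _ i2]
  have v1 : ∫ u, Set.indicator (Set.Ico (-l) 0) (fun _ => 4 / T ^ 2) u ≤ 4 * Real.log (2 * T) ^ 3 / T := by
    rw [integral_indicator measurableSet_Ico, setIntegral_const, Real.volume_real_Ico_of_le (by linarith),
      smul_eq_mul]
    have t1 : 1 / T ≤ 1 := (div_le_one hT0).2 (by linarith)
    calc (0 - -l) * (4 / T ^ 2) ≤ 1 * (4 / T ^ 2) := by gcongr; linarith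
      _ = 4 * 1 / T * (1 / T) := by ring
      _ ≤ 4 * 1 ^ 3 / T * 1 := by gcongr; norm_num
      _ ≤ 4 * Real.log (2 * T) ^ 3 / T * 1 := by gcongr
      _ = _ := by ring
  have v2 : ∀ n ∈ Finset.Icc 1 ⌊2 * T⌋₊, ∫ u, Set.indicator (Set.Ico (Real.log n - l) (Real.log n))
      (fun u => 2 * Real.log n ^ 2 * rexp (-u)) u ≤ 2 * Real.log (2 * T) ^ 2 / T * (n : ℝ)⁻¹ := by
    intro n hn
    rw [Finset.mem_Icc] at hn
    have hn1 : (1:ℝ) ≤ n := by exact_mod_cast hn.1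
    have hn2 : (n:ℝ) ≤ 2 * T := (Nat.le_floor_iff (by positivity)).1 hn.2
    rw [integral_indicator measurableSet_Ico, integral_Ico_eq_integral_Ioc,
      ← intervalIntegral.integral_of_le (by linarith), intervalIntegral.integral_const_mul]
    have : ∫ u in (Real.log n - l)..(Real.log n), rexp (-u) = 1 / T * (n:ℝ)⁻¹ := by
      rw [intervalIntegral.integral_comp_neg (fun u => rexp u), integral_exp, neg_sub, Real.exp_sub, hlam,
        Real.exp_neg, Real.exp_log (by linarith)]
      field_simp
      ring
    rw [this]
    calc _ ≤ 2 * Real.log (2 * T) ^ 2 * (1 / T * (n:ℝ)⁻¹) := by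
          have := Real.log_nonneg hn1
          gcongr
      _ = _ := by ring
  have v2' : ∑ n ∈ Finset.Icc 1 ⌊2 * T⌋₊, ∫ u, Set.indicator (Set.Ico (Real.log n - l) (Real.log n))
      (fun u => 2 * Real.log n ^ 2 * rexp (-u)) u ≤ 4 * Real.log (2 * T) ^ 3 / T := by
    refine (Finset.sum_le_sum v2).trans ?_
    rw [← Finset.mul_sum]
    have h := harmonic_le_one_add_log ⌊2 * T⌋₊
    rw [harmonic_eq_sum_Icc] at h
    push_cast at h
    have h' : Real.log (⌊2 * T⌋₊ : ℝ) ≤ Real.log (2 * T) := by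
      apply Real.log_le_log
      · exact_mod_cast Nat.floor_pos.2 (by linarith)
      · exact Nat.floor_le (by positivity)
    calc _ ≤ 2 * Real.log (2 * T) ^ 2 / T * (2 * Real.log (2 * T)) := by gcongr; linarith
      _ = _ := by ring
  have v3 : ∫ u, Set.indicator (Set.Iic (Real.log T)) (fun u => 2 * Real.log (2 * T) ^ 2 / T ^ 2 * rexp u) u
      ≤ 2 * Real.log (2 * T) ^ 3 / T := by
    rw [integral_indicator measurableSet_Iic, integral_const_mul, integral_exp_Iic, Real.exp_log hT0]
    calc _ = 2 * Real.log (2 * T) ^ 2 / T := by field_simp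
      _ ≤ 2 * Real.log (2 * T) ^ 3 / T := by gcongr; norm_num
  have v4 : ∫ u, Set.indicator (Set.Ici (Real.log T)) (fun u => 100 * Real.log (2 * T) ^ 2 / √T * rexp (-(1 / 2) * u)) u
      ≤ 200 * Real.log (2 * T) ^ 3 / T := by
    rw [integral_indicator measurableSet_Ici, integral_const_mul, integral_Ici_eq_integral_Ioi,
      integral_exp_mul_Ioi (by norm_num)]
    have hs : rexp (-(1 / 2) * Real.log T) = (√T)⁻¹ := by
      rw [← Real.exp_log (show 0 < √T by positivity), ← Real.exp_neg, Real.log_sqrt hT0.le]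
      congr 1; ring
    rw [hs]
    calc _ = 200 * Real.log (2 * T) ^ 2 / (√T * √T) := by field_simp; norm_num
      _ = 200 * Real.log (2 * T) ^ 2 / T := by rw [Real.mul_self_sqrt hT0.le]
      _ ≤ 200 * Real.log (2 * T) ^ 3 / T := by gcongr; norm_num
  have hL : Real.log (2 * T) ≤ 2 * Real.log T := by
    rw [Real.log_mul two_ne_zero hT0.ne']
    have := Real.log_le_log two_pos (by linarith : 2 ≤ T)
    linarith
  calc _ ≤ 4 * Real.log (2 * T) ^ 3 / T + 4 * Real.log (2 * T) ^ 3 / T + 2 * Real.log (2 * T) ^ 3 / T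
        + 200 * Real.log (2 * T) ^ 3 / T := by linarith
    _ = 210 * Real.log (2 * T) ^ 3 / T := by ring
    _ ≤ 210 * (2 * Real.log T) ^ 3 / T := by gcongr
    _ = 1680 * Real.log T ^ 3 / T := by ring
    _ ≤ _ := by
      have := Real.log_nonneg (by linarith : 1 ≤ T)
      gcongr
      norm_num

theorem lintegral_sub_logFactorialError_le {T σ : ℝ} (hT : 3 ≤ T) (hσ : 1 / 2 ≤ σ) (hσ' : σ ≤ 1) :
    ∫⁻ u : ℝ, ‖((logFactorialError (rexp u * (1 + 1 / T)) : ℂ) - (logFactorialError (rexp u) : ℂ))‖ₑ ^ 2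
        * ENNReal.ofReal (rexp (-2 * σ * u))
      ≤ ENNReal.ofReal (2000 * Real.log T ^ 3 / T) := by
  calc _ ≤ ∫⁻ u : ℝ, ENNReal.ofReal (logFactorialMajorant T u) := by
        refine lintegral_mono fun u => ?_
        rw [← Complex.ofReal_sub, ← ofReal_norm, Complex.norm_real, ← ENNReal.ofReal_pow (norm_nonneg _),
          ← ENNReal.ofReal_mul (by positivity), Real.norm_eq_abs, sq_abs]
        exact ENNReal.ofReal_le_ofReal (sq_sub_logFactorialError_le hT hσ hσ' u)
    _ = ENNReal.ofReal (∫ u, logFactorialMajorant T u) :=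
        (ofReal_integral_eq_lintegral_ofReal integrable_logFactorialMajorant
          (Filter.Eventually.of_forall logFactorialMajorant_nonneg)).symm
    _ ≤ _ := ENNReal.ofReal_le_ofReal (integral_logFactorialMajorant_le hT)

theorem integral_comp_add_mul_cexp (g : ℝ → ℂ) (s : ℂ) (l : ℝ) :
    ∫ u : ℝ, g (u + l) * cexp (-s * u) = cexp (s * l) * ∫ u : ℝ, g u * cexp (-s * u) := by
  rw [← integral_const_mul, ← integral_add_right_eq_self (fun u : ℝ => cexp (s * l) * (g u * cexp (-s * u))) l]
  congr 1
  ext u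
  rw [mul_left_comm, ← Complex.exp_add]
  congr 2
  push_cast
  ring

theorem integrable_comp_add_mul_cexp {g : ℝ → ℂ} {s : ℂ} (l : ℝ)
    (hg : Integrable fun u : ℝ => g u * cexp (-s * u)) :
    Integrable fun u : ℝ => g (u + l) * cexp (-s * u) := by
  have := (hg.comp_add_right l).const_mul (cexp (s * l))
  refine this.congr (Filter.Eventually.of_forall fun u => ?_)
  simp only
  rw [mul_left_comm, ← Complex.exp_add]
  congr 2
  push_cast
  ring

theorem log_one_add_inv_le {T : ℝ} (hT : 0 < T) : Real.log (1 + 1 / T) ≤ 1 / T := by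
  have := Real.log_le_sub_one_of_pos (show 0 < 1 + 1 / T by positivity)
  linarith

theorem le_log_one_add_inv {T : ℝ} (hT : 1 ≤ T) : 1 / (2 * T) ≤ Real.log (1 + 1 / T) := by
  have h0 : 0 < T := by linarith
  have := Real.one_sub_inv_le_log_of_pos (show 0 < 1 + 1 / T by positivity)
  refine le_trans ?_ this
  rw [show 1 - (1 + 1 / T)⁻¹ = 1 / (T + 1) by field_simp; ring]
  exact one_div_le_one_div_of_le (by positivity) (by linarith)

theorem le_norm_cexp_sub_one {T : ℝ} (hT : 3 ≤ T) {s : ℂ} (h0 : 0 ≤ s.re) (h1 : s.re ≤ 1) (hs : |s.im| ≤ T / 2) :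
    ‖s‖ / (12 * T) ≤ ‖cexp (s * Real.log (1 + 1 / T)) - 1‖ := by
  have hT0 : 0 < T := by linarith
  set l := Real.log (1 + 1 / T)
  have hl := log_one_add_inv_le hT0
  have hl' := le_log_one_add_inv (show 1 ≤ T by linarith)
  have hl0 : 0 ≤ l := le_trans (by positivity) hl'
  have hn : ‖s * l‖ = ‖s‖ * l := by rw [norm_mul, Complex.norm_real, Real.norm_of_nonneg hl0]
  have hs1 : ‖s‖ ≤ 1 + T / 2 := by
    refine (Complex.norm_le_abs_re_add_abs_im s).trans ?_
    rw [abs_of_nonneg h0]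
    linarith
  have hz : ‖s * l‖ ≤ 5 / 6 := by
    rw [hn]
    calc _ ≤ (1 + T / 2) * (1 / T) := by gcongr
      _ = 1 / T + 1 / 2 := by field_simp
      _ ≤ 1 / 3 + 1 / 2 := by gcongr
      _ = _ := by norm_num
  have h2 := Complex.norm_exp_sub_one_sub_id_le (hz.trans (by norm_num))
  have h3 : ‖s * l‖ ≤ ‖cexp (s * l) - 1‖ + ‖cexp (s * l) - 1 - s * l‖ := by
    calc _ = ‖(cexp (s * l) - 1) - (cexp (s * l) - 1 - s * l)‖ := by congr 1; ring
      _ ≤ _ := norm_sub_le _ _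
  have h4 : ‖s * l‖ ^ 2 ≤ ‖s * l‖ * (5 / 6) := by rw [sq]; gcongr
  have h5 : ‖s‖ * (1 / (2 * T)) ≤ ‖s * l‖ := by rw [hn]; gcongr
  have h6 : ‖s‖ / (12 * T) = ‖s‖ * (1 / (2 * T)) / 6 := by field_simp; ring
  linarith

theorem lintegral_deriv_riemannZeta₀_sq_le {T σ : ℝ} (hT : 3 ≤ T) (hσ : 1 / 2 ≤ σ) (hσ' : σ ≤ 1) :
    ∫⁻ t in Set.Icc (-(T / 2)) (T / 2), ‖deriv riemannZeta₀ (σ + t * I)‖ₑ ^ 2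
      ≤ ENNReal.ofReal (4000000 * T * Real.log T ^ 3) := by
  have hT0 : 0 < T := by linarith
  set l := Real.log (1 + 1 / T) with hl
  have hlam : rexp l = 1 + 1 / T := Real.exp_log (by positivity)
  have hm : Measurable fun x => (logFactorialError x : ℂ) :=
    Complex.measurable_ofReal.comp measurable_logFactorialError
  have hint : ∀ s : ℂ, 1 / 4 < s.re → Integrable fun u : ℝ => (logFactorialError (rexp u) : ℂ) * cexp (-s * u) := fun s hs =>
    integrable_comp_exp_of_le (h := fun x => (logFactorialError x : ℂ)) hm
      (fun x hx => by simp [logFactorialError_of_lt hx])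
      (fun x hx => abs_logFactorialError_le_rpow (show (0:ℝ) < 1 / 4 by norm_num) hx) hs
  set q : ℝ → ℂ := fun u => (logFactorialError (rexp u * (1 + 1 / T)) : ℂ) - (logFactorialError (rexp u) : ℂ) with hq
  have hq' : ∀ u, q u = (fun u : ℝ => (logFactorialError (rexp u) : ℂ)) (u + l) - (logFactorialError (rexp u) : ℂ) := by
    intro u; simp only [hq]; rw [Real.exp_add, hlam]
  have hqi : ∀ s : ℂ, 1 / 4 < s.re → Integrable fun u : ℝ => q u * cexp (-s * u) := fun s hs => by
    simp_rw [hq', sub_mul]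
    exact (integrable_comp_add_mul_cexp l (hint s hs)).sub (hint s hs)
  have hlap : ∀ s : ℂ, 1 / 4 < s.re → ∫ u : ℝ, q u * cexp (-s * u) =
      (cexp (s * l) - 1) * (-deriv riemannZeta₀ s / s) := fun s hs => by
    simp_rw [hq', sub_mul]
    rw [integral_sub (integrable_comp_add_mul_cexp l (hint s hs)) (hint s hs), integral_comp_add_mul_cexp
      (fun u : ℝ => (logFactorialError (rexp u) : ℂ)),
      integral_logFactorialError_exp (by linarith)]
    ring
  have key := (lintegral_enorm_laplace_sq_le (q := q) (σ := σ) (hqi σ (by simp; linarith))).trans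
    (mul_le_mul_right (lintegral_sub_logFactorialError_le hT hσ hσ') _)
  calc _ ≤ ∫⁻ t in Set.Icc (-(T / 2)) (T / 2), ENNReal.ofReal ((12 * T) ^ 2) *
          ‖∫ u, q u * cexp (-(σ + t * I) * u)‖ₑ ^ 2 := by
        refine setLIntegral_mono' measurableSet_Icc fun t ht => ?_
        have hre : ((σ:ℂ) + t * I).re = σ := by simp
        have him : ((σ:ℂ) + t * I).im = t := by simp
        rw [hlap _ (by rw [hre]; linarith)]
        have h1 := le_norm_cexp_sub_one hT (s := σ + t * I) (by rw [hre]; linarith) (by rw [hre]; linarith)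
          (by rw [him]; exact abs_le.2 ht)
        have hs0 : 0 < ‖(σ:ℂ) + t * I‖ := by
          rw [norm_pos_iff]; intro h; rw [h] at hre; simp at hre; linarith
        rw [← ofReal_norm, ← ofReal_norm, ← ENNReal.ofReal_pow (norm_nonneg _), ← ENNReal.ofReal_pow (norm_nonneg _),
          ← ENNReal.ofReal_mul (by positivity), ← mul_pow]
        refine ENNReal.ofReal_le_ofReal (pow_le_pow_left₀ (norm_nonneg _) ?_ _)
        rw [norm_mul, norm_div, norm_neg]
        calc ‖deriv riemannZeta₀ (σ + t * I)‖ = 12 * T * (‖(σ:ℂ) + t * I‖ / (12 * T) *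
                (‖deriv riemannZeta₀ (σ + t * I)‖ / ‖(σ:ℂ) + t * I‖)) := by field_simp
          _ ≤ _ := by gcongr
    _ ≤ ∫⁻ t : ℝ, ENNReal.ofReal ((12 * T) ^ 2) *
          ‖∫ u, q u * cexp (-(σ + t * I) * u)‖ₑ ^ 2 := setLIntegral_le_lintegral _ _
    _ = ENNReal.ofReal ((12 * T) ^ 2) * ∫⁻ t : ℝ, ‖∫ u, q u * cexp (-(σ + t * I) * u)‖ₑ ^ 2 :=
        lintegral_const_mul' _ _ ENNReal.ofReal_ne_top
    _ ≤ ENNReal.ofReal ((12 * T) ^ 2) * (ENNReal.ofReal (2 * π) * ENNReal.ofReal (2000 * Real.log T ^ 3 / T)) :=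
        mul_le_mul_right key _
    _ ≤ _ := by
        have hlog := Real.log_nonneg (by linarith : 1 ≤ T)
        rw [← ENNReal.ofReal_mul (by positivity), ← ENNReal.ofReal_mul (by positivity)]
        refine ENNReal.ofReal_le_ofReal ?_
        calc _ = 576000 * π * (T * Real.log T ^ 3) := by field_simp; ring
          _ ≤ 576000 * 4 * (T * Real.log T ^ 3) := by gcongr; exact Real.pi_le_four
          _ ≤ 4000000 * (T * Real.log T ^ 3) := by gcongr; norm_num
          _ = _ := by ring

theorem lintegral_norm_deriv_riemannZeta₀_add_one_sq_le :
    ∃ C > (0:ℝ), ∀ U σ : ℝ, 3 ≤ U → 1 / 2 ≤ σ → σ ≤ 1 →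
    ∫⁻ t in Set.Icc (-U) U, ENNReal.ofReal ((‖deriv riemannZeta₀ (σ + t * I)‖ + 1) ^ 2)
      ≤ ENNReal.ofReal (C * U * Real.log U ^ 3) := by
  refine ⟨2 * (4000000 * 2 * 8) + 4, by norm_num, fun U σ hU hσ hσ' => ?_⟩
  have h := lintegral_deriv_riemannZeta₀_sq_le (T := 2 * U) (by linarith) hσ hσ'
  rw [mul_div_cancel_left₀ _ (two_ne_zero' ℝ)] at h
  have L1 : 1 ≤ Real.log U := by
    rw [Real.le_log_iff_exp_le (by positivity)]
    linarith [Real.exp_one_lt_d9]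
  have L2 : Real.log (2 * U) ≤ 2 * Real.log U := by
    rw [Real.log_mul two_ne_zero (by positivity)]
    have := Real.log_le_log two_pos (by linarith : 2 ≤ U)
    linarith
  calc _ ≤ ∫⁻ t in Set.Icc (-U) U, (ENNReal.ofReal 2 * ‖deriv riemannZeta₀ (σ + t * I)‖ₑ ^ 2 + ENNReal.ofReal 2) := by
        refine lintegral_mono fun t => ?_
        rw [← ofReal_norm, ← ENNReal.ofReal_pow (norm_nonneg _), ← ENNReal.ofReal_mul (by positivity),
          ← ENNReal.ofReal_add (by positivity) (by positivity)]
        refine ENNReal.ofReal_le_ofReal ?_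
        nlinarith [sq_nonneg (‖deriv riemannZeta₀ (σ + t * I)‖ - 1)]
    _ = ENNReal.ofReal 2 * (∫⁻ t in Set.Icc (-U) U, ‖deriv riemannZeta₀ (σ + t * I)‖ₑ ^ 2)
          + ENNReal.ofReal 2 * ENNReal.ofReal (2 * U) := by
        rw [lintegral_add_right _ measurable_const, lintegral_const_mul' _ _ ENNReal.ofReal_ne_top,
          setLIntegral_const, Real.volume_Icc]
        congr 3; ring
    _ ≤ ENNReal.ofReal 2 * ENNReal.ofReal (4000000 * (2 * U) * Real.log (2 * U) ^ 3)
          + ENNReal.ofReal 2 * ENNReal.ofReal (2 * U) := by gcongr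
    _ ≤ _ := by
        have hlog := Real.log_nonneg (by linarith : 1 ≤ 2 * U)
        rw [← ENNReal.ofReal_mul (by positivity), ← ENNReal.ofReal_mul (by positivity),
          ← ENNReal.ofReal_add (by positivity) (by positivity)]
        refine ENNReal.ofReal_le_ofReal ?_
        calc _ ≤ 2 * (4000000 * (2 * U) * (2 * Real.log U) ^ 3) + 2 * (2 * U) * 1 ^ 3 := by
              rw [one_pow, mul_one]; gcongr
          _ ≤ 2 * (4000000 * (2 * U) * (2 * Real.log U) ^ 3) + 2 * (2 * U) * Real.log U ^ 3 := by gcongr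
          _ = _ := by ring

theorem norm_deriv_riemannZeta₀_le {s : ℂ} (hs : 1 / 4 ≤ s.re) : ‖deriv riemannZeta₀ s‖ ≤ 64 * ‖s‖ := by
  have hs0 : s ≠ 0 := by rintro rfl; simp at hs; linarith
  have h := integral_logFactorialError_exp (s := s) (by linarith)
  have hb : ‖∫ u : ℝ, (logFactorialError (rexp u) : ℂ) * cexp (-s * u)‖ ≤ 64 := by
    calc _ ≤ ∫ u : ℝ, Set.indicator (Set.Ioi 0) (fun u => 8 * rexp (-(1 / 8) * u)) u := by
          refine norm_integral_le_of_norm_le (IntegrableOn.integrable_indicator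
            ((integrableOn_exp_mul_Ioi (by norm_num) _).const_mul _) measurableSet_Ioi) ?_
          filter_upwards [Measure.ae_ne volume (0:ℝ)] with u hu
          rcases lt_or_gt_of_ne hu with hu | hu
          · rw [logFactorialError_of_lt (Real.exp_lt_one_iff.2 hu)]
            simp [Set.indicator_of_notMem, hu.le]
          · rw [Set.indicator_of_mem (Set.mem_Ioi.2 hu), norm_mul, Complex.norm_exp]
            have h1 := abs_logFactorialError_le_rpow (show (0:ℝ) < 1 / 8 by norm_num) (Real.one_le_exp hu.le)
            rw [← Real.exp_mul] at h1
            have h2 : (-s * (u:ℂ)).re ≤ -(1 / 4) * u := by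
              have : (-s * (u:ℂ)).re = -s.re * u := by simp
              rw [this]
              nlinarith
            calc _ ≤ (1 / (1 / 8) * rexp (u * (1 / 8))) * rexp (-(1 / 4) * u) := by gcongr
              _ = 8 * rexp (-(1 / 8) * u) := by
                rw [mul_assoc, ← Real.exp_add]
                congr 1
                · norm_num
                · congr 1; ring
      _ = 64 := by
          rw [integral_indicator measurableSet_Ioi, integral_const_mul, integral_exp_mul_Ioi (by norm_num)]
          norm_num
  have e : deriv riemannZeta₀ s = -(s * ∫ u : ℝ, (logFactorialError (rexp u) : ℂ) * cexp (-s * u)) := by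
    rw [h]; field_simp
  rw [e, norm_neg, norm_mul, mul_comm]
  gcongr

theorem exists_norm_riemannZeta₀_le : ∃ C ≥ (0:ℝ), ∀ s : ℂ, 1 / 4 ≤ s.re → ‖riemannZeta₀ s‖ ≤ C * (1 + ‖s‖) ^ 2 := by
  refine ⟨‖riemannZeta₀ 2‖ + 256, by positivity, fun s hs => ?_⟩
  have hconv : Convex ℝ ({z : ℂ | 1 / 4 ≤ z.re} ∩ Metric.closedBall 0 (‖s‖ + 2)) :=
    (convex_halfSpace_re_ge _).inter (convex_closedBall _ _)
  have h := hconv.norm_image_sub_le_of_norm_deriv_le (f := riemannZeta₀) (C := 64 * (‖s‖ + 2)) (x := 2) (y := s)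
    (fun z _ => differentiable_riemannZeta₀ z) (fun z hz => (norm_deriv_riemannZeta₀_le hz.1).trans (by
      have := hz.2; rw [mem_closedBall_zero_iff] at this; gcongr))
    ⟨by norm_num, by simp⟩ ⟨hs, by simp⟩
  have h2 : ‖s - 2‖ ≤ ‖s‖ + 2 := by
    refine (norm_sub_le _ _).trans ?_; norm_num
  have h3 : ‖riemannZeta₀ s‖ ≤ ‖riemannZeta₀ s - riemannZeta₀ 2‖ + ‖riemannZeta₀ 2‖ := by
    simpa using norm_add_le (riemannZeta₀ s - riemannZeta₀ 2) (riemannZeta₀ 2)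
  have h4 : 64 * (‖s‖ + 2) * ‖s - 2‖ ≤ 64 * (‖s‖ + 2) * (‖s‖ + 2) := by gcongr
  have n0 := norm_nonneg (riemannZeta₀ 2)
  have n1 := norm_nonneg s
  nlinarith [mul_nonneg n0 n1, mul_nonneg n0 (sq_nonneg ‖s‖)]

theorem exists_norm_riemannZeta₁_le : ∃ C ≥ (0:ℝ), ∀ s : ℂ, 1 / 4 ≤ s.re → ‖riemannZeta₁ s‖ ≤ C * (1 + ‖s‖) ^ 3 := by
  obtain ⟨C, hC, h⟩ := exists_norm_riemannZeta₀_le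
  refine ⟨1 + C, by positivity, fun s hs => ?_⟩
  have n1 := norm_nonneg s
  have h1 : ‖s - 1‖ ≤ 1 + ‖s‖ := by
    refine (norm_sub_le _ _).trans ?_; rw [norm_one, add_comm]
  calc ‖riemannZeta₁ s‖ ≤ 1 + ‖s - 1‖ * ‖riemannZeta₀ s‖ := by
        rw [riemannZeta₁]; refine (norm_add_le _ _).trans ?_; rw [norm_one, norm_mul]
    _ ≤ (1 + ‖s‖) ^ 3 + (1 + ‖s‖) * (C * (1 + ‖s‖) ^ 2) := by
        gcongr
        · exact one_le_pow₀ (by linarith)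
        · exact h s hs
    _ = _ := by ring

/-- A holomorphic function without zeros on a disc which is not much larger than its value at the
centre is not much smaller either. -/
theorem le_norm_of_forall_ne_zero {f : ℂ → ℂ} {R M : ℝ} (hR : 0 < R) (hM : 0 < M)
    (hf : DifferentiableOn ℂ f (Metric.ball 0 R)) (h0 : ∀ z ∈ Metric.ball 0 R, f z ≠ 0)
    (hfM : ∀ z ∈ Metric.ball 0 R, ‖f z‖ ≤ ‖f 0‖ * rexp M) {z : ℂ} (hz : z ∈ Metric.ball 0 R) :
    ‖f 0‖ * rexp (-(2 * M * ‖z‖ / (R - ‖z‖))) ≤ ‖f z‖ := by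
  have hz0 : (0:ℂ) ∈ Metric.ball 0 R := Metric.mem_ball_self hR
  have hd : DifferentiableOn ℂ (fun z => deriv f z / f z) (Metric.ball 0 R) :=
    (hf.deriv Metric.isOpen_ball).div hf h0
  obtain ⟨G, hG0, hG⟩ := hd.isExactOn_ball.with_val_at 0 0
  have hGd : DifferentiableOn ℂ G (Metric.ball 0 R) := fun x hx => (hG x hx).differentiableAt.differentiableWithinAt
  have hconst : ∀ z ∈ Metric.ball 0 R, f z * cexp (-G z) = f 0 := by
    intro z hz
    have := Metric.isOpen_ball.is_const_of_deriv_eq_zero (convex_ball (0:ℂ) R).isPreconnected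
      (f := fun z => f z * cexp (-G z)) (hf.mul hGd.neg.cexp) (fun w hw => by
        have h1 : HasDerivAt f (deriv f w) w := (hf.differentiableAt (Metric.isOpen_ball.mem_nhds hw)).hasDerivAt
        have h2 := h1.mul (hG w hw).neg.cexp
        have h3 := h2.deriv
        have h4 := h0 w hw
        refine h3.trans ?_
        simp only [Pi.zero_apply]
        field_simp
        ring) hz hz0
    simpa [hG0] using this
  have hfG : ∀ z ∈ Metric.ball 0 R, ‖f z‖ = ‖f 0‖ * rexp (G z).re := by
    intro z hz
    rw [← hconst z hz, norm_mul, Complex.norm_exp, mul_assoc, ← Real.exp_add]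
    simp
  have hf0 : 0 < ‖f 0‖ := norm_pos_iff.2 (h0 0 hz0)
  have hb := borelCaratheodory_zero hM hGd (fun w hw => by
    have := hfM w hw
    rw [hfG w hw] at this
    exact Real.exp_le_exp.1 (le_of_mul_le_mul_left this hf0)) hR hz hG0
  rw [hfG z hz]
  gcongr
  have := (abs_le.1 (Complex.abs_re_le_norm (G z))).1
  linarith

theorem riemannZeta₁_ne_zero (hRH : RiemannHypothesis) {s : ℂ} (hs : 1 / 2 < s.re) : riemannZeta₁ s ≠ 0 := by
  intro h
  have h1 : s ≠ 1 := by rintro rfl; simp [riemannZeta₁_one] at h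
  have hz : riemannZeta s = 0 := by rw [riemannZeta_eq_inv_sub_mul h1, h, mul_zero]
  have := hRH s hz (by
    rintro ⟨n, rfl⟩
    simp at hs
    have : (0:ℝ) ≤ n := n.cast_nonneg
    linarith) h1
  linarith

theorem exists_one_le_mul_norm_riemannZeta : ∃ S > (0:ℝ), ∀ s : ℂ, s.re = 5 → 1 ≤ S * ‖riemannZeta s‖ := by
  have hsum : Summable fun n => ‖LSeries.term (fun n => ((ArithmeticFunction.moebius n : ℤ) : ℂ)) 5 n‖ :=
    (ArithmeticFunction.LSeriesSummable_moebius_iff.2 (by norm_num)).norm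
  refine ⟨∑' n, ‖LSeries.term (fun n => ((ArithmeticFunction.moebius n : ℤ) : ℂ)) 5 n‖ + 1, by positivity, fun s hs => ?_⟩
  have h1 : 1 < s.re := by rw [hs]; norm_num
  have h := ArithmeticFunction.LSeries_zeta_mul_Lseries_moebius h1
  rw [ArithmeticFunction.LSeries_zeta_eq_riemannZeta h1] at h
  have e : ∀ n, ‖LSeries.term (fun n => ((ArithmeticFunction.moebius n : ℤ) : ℂ)) s n‖
      = ‖LSeries.term (fun n => ((ArithmeticFunction.moebius n : ℤ) : ℂ)) 5 n‖ := fun n => by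
    rw [LSeries.norm_term_eq, LSeries.norm_term_eq, hs]; norm_num
  have h2 : ‖LSeries (fun n => ((ArithmeticFunction.moebius n : ℤ) : ℂ)) s‖
      ≤ ∑' n, ‖LSeries.term (fun n => ((ArithmeticFunction.moebius n : ℤ) : ℂ)) 5 n‖ := by
    rw [LSeries, ← tsum_congr e]
    exact norm_tsum_le_tsum_norm (by simpa only [e] using hsum)
  calc (1:ℝ) = ‖riemannZeta s‖ * ‖LSeries (fun n => ((ArithmeticFunction.moebius n : ℤ) : ℂ)) s‖ := by
        rw [← norm_mul, h, norm_one]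
    _ ≤ ‖riemannZeta s‖ * (∑' n, ‖LSeries.term (fun n => ((ArithmeticFunction.moebius n : ℤ) : ℂ)) 5 n‖ + 1) := by
        gcongr; linarith
    _ = _ := mul_comm _ _

/-- Under the Riemann hypothesis `1 / ζ` has polynomial growth to the right of the critical line. -/
theorem exists_inv_norm_riemannZeta₁_le (hRH : RiemannHypothesis) {σ : ℝ} (hσ : 1 / 2 < σ) :
    ∃ K ≥ (0:ℝ), ∃ N : ℕ, ∀ s : ℂ, σ ≤ s.re → s.re ≤ 5 → ‖riemannZeta₁ s‖⁻¹ ≤ K * (1 + |s.im|) ^ N := by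
  obtain ⟨C, hC, hZ⟩ := exists_norm_riemannZeta₁_le
  obtain ⟨S, hS, hS1⟩ := exists_one_le_mul_norm_riemannZeta
  set k := ⌈2 * (5 - σ) / (σ - 1 / 2)⌉₊ with hk
  set K₁ := S * C * 12 ^ 3 + 2 with hK₁
  refine ⟨S * K₁ ^ k, by positivity, 3 * k, fun s hs hs5 => ?_⟩
  set t := s.im with ht
  set w : ℂ := 5 + t * I with hw
  have hre : w.re = 5 := by simp [hw]
  have hw1 : w ≠ 1 := by intro h; rw [h] at hre; norm_num at hre
  have him : w.im = t := by simp [hw]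
  have hwn : ‖w‖ ≤ 5 + |t| := by
    refine (Complex.norm_le_abs_re_add_abs_im w).trans ?_
    rw [hre, him]; norm_num
  have hf0 : 1 ≤ S * ‖riemannZeta₁ w‖ := by
    have h1 : riemannZeta₁ w = (w - 1) * riemannZeta w := by
      rw [riemannZeta_eq_inv_sub_mul hw1, mul_inv_cancel_left₀ (sub_ne_zero.2 hw1)]
    have h2 : 1 ≤ ‖w - 1‖ := by
      refine le_trans ?_ (Complex.abs_re_le_norm _)
      rw [Complex.sub_re, hre]; norm_num
    rw [h1, norm_mul]
    calc (1:ℝ) ≤ S * ‖riemannZeta w‖ := hS1 w hre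
      _ ≤ S * (‖w - 1‖ * ‖riemannZeta w‖) := by
        gcongr
        exact le_mul_of_one_le_left (norm_nonneg _) h2
  have hX : 1 < K₁ * (1 + |t|) ^ 3 := by
    have h1 : 1 ≤ (1 + |t|) ^ 3 := one_le_pow₀ (by linarith [abs_nonneg t])
    have h2 : 2 ≤ K₁ := by
      have : 0 ≤ S * C * 12 ^ 3 := by positivity
      linarith
    nlinarith
  have hball : ∀ z ∈ Metric.ball (0:ℂ) (9 / 2), 1 / 2 < (w + z).re := by
    intro z hz
    rw [mem_ball_zero_iff] at hz
    have := (abs_lt.1 ((Complex.abs_re_le_norm z).trans_lt hz)).1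
    rw [Complex.add_re, hre]; linarith
  have hz : s - w = ((s.re - 5 : ℝ) : ℂ) := by
    apply Complex.ext <;> simp [hw, ht]
  have hzn : ‖s - w‖ = 5 - s.re := by
    rw [hz, Complex.norm_real, Real.norm_eq_abs, abs_of_nonpos (by linarith)]; ring
  have key := le_norm_of_forall_ne_zero (f := fun z => riemannZeta₁ (w + z)) (R := 9 / 2) (by norm_num)
    (Real.log_pos hX) (differentiable_riemannZeta₁.comp (by fun_prop)).differentiableOn
    (fun z hz => riemannZeta₁_ne_zero hRH (hball z hz)) (fun z hz => by
      rw [Real.exp_log (by linarith), add_zero]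
      have hz' := mem_ball_zero_iff.1 hz
      have h1 : ‖w + z‖ ≤ 5 + |t| + 9 / 2 := (norm_add_le _ _).trans (by linarith)
      have h2 : 1 + ‖w + z‖ ≤ 12 * (1 + |t|) := by linarith [abs_nonneg t]
      calc ‖riemannZeta₁ (w + z)‖ ≤ C * (1 + ‖w + z‖) ^ 3 := hZ _ (by linarith [hball z hz])
        _ ≤ C * (12 * (1 + |t|)) ^ 3 := by gcongr
        _ = 1 * (C * 12 ^ 3 * (1 + |t|) ^ 3) := by ring
        _ ≤ (S * ‖riemannZeta₁ w‖) * (C * 12 ^ 3 * (1 + |t|) ^ 3) := by gcongr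
        _ = ‖riemannZeta₁ w‖ * (S * C * 12 ^ 3 * (1 + |t|) ^ 3) := by ring
        _ ≤ ‖riemannZeta₁ w‖ * (K₁ * (1 + |t|) ^ 3) := by gcongr; linarith)
    (z := s - w) (by rw [mem_ball_zero_iff, hzn]; linarith)
  simp only [add_zero, add_sub_cancel] at key
  have hexp : rexp (Real.log (K₁ * (1 + |t|) ^ 3) * k) = (K₁ * (1 + |t|) ^ 3) ^ k := by
    rw [mul_comm, Real.exp_nat_mul, Real.exp_log (by linarith)]
  have hcmp : 2 * Real.log (K₁ * (1 + |t|) ^ 3) * ‖s - w‖ / (9 / 2 - ‖s - w‖) ≤ Real.log (K₁ * (1 + |t|) ^ 3) * k := by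
    have hlog := (Real.log_pos hX).le
    rw [hzn]
    calc _ = Real.log (K₁ * (1 + |t|) ^ 3) * (2 * (5 - s.re) / (s.re - 1 / 2)) := by
          rw [show 9 / 2 - (5 - s.re) = s.re - 1 / 2 by ring]; ring
      _ ≤ Real.log (K₁ * (1 + |t|) ^ 3) * (2 * (5 - σ) / (σ - 1 / 2)) := by
          have h5 : 0 < σ - 1 / 2 := by linarith
          gcongr
          linarith
      _ ≤ _ := by gcongr; exact Nat.le_ceil _
  have h1 : ‖riemannZeta₁ w‖ * ((K₁ * (1 + |t|) ^ 3) ^ k)⁻¹ ≤ ‖riemannZeta₁ s‖ := by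
    refine le_trans ?_ key
    rw [← hexp, ← Real.exp_neg]
    gcongr
  have hX0 : 0 < (K₁ * (1 + |t|) ^ 3) ^ k := by positivity
  have hs0 : 0 < ‖riemannZeta₁ s‖ := norm_pos_iff.2 (riemannZeta₁_ne_zero hRH (by linarith))
  rw [inv_le_iff_one_le_mul₀ hs0]
  calc (1:ℝ) ≤ S * ‖riemannZeta₁ w‖ := hf0
    _ = S * (K₁ * (1 + |t|) ^ 3) ^ k * (‖riemannZeta₁ w‖ * ((K₁ * (1 + |t|) ^ 3) ^ k)⁻¹) := by field_simp
    _ ≤ S * (K₁ * (1 + |t|) ^ 3) ^ k * ‖riemannZeta₁ s‖ := by gcongr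
    _ = _ := by rw [mul_pow, ← pow_mul]; ring

theorem norm_Gammaℝ_conj (s : ℂ) : ‖Gammaℝ ((starRingEnd ℂ) s)‖ = ‖Gammaℝ s‖ := by
  have h : (starRingEnd ℂ) s / 2 = (starRingEnd ℂ) (s / 2) := by
    rw [map_div₀, map_ofNat]
  rw [Gammaℝ_def, Gammaℝ_def, h, Complex.Gamma_conj, norm_mul, norm_mul,
    RCLike.norm_conj, Complex.norm_cpow_eq_rpow_re_of_pos Real.pi_pos, Complex.norm_cpow_eq_rpow_re_of_pos Real.pi_pos]
  simp

theorem norm_Gamma_le_Gamma_re {s : ℂ} (hs : 0 < s.re) : ‖Complex.Gamma s‖ ≤ Real.Gamma s.re := by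
  rw [Complex.Gamma_eq_integral hs, Complex.GammaIntegral, Real.Gamma_eq_integral hs]
  refine (norm_integral_le_integral_norm _).trans (le_of_eq ?_)
  refine setIntegral_congr_fun measurableSet_Ioi fun x hx => ?_
  have hx : 0 < x := hx
  simp only [norm_mul]
  rw [Complex.norm_cpow_eq_rpow_re_of_pos hx, Complex.norm_real, Real.norm_of_nonneg (Real.exp_pos _).le]
  simp

theorem exists_norm_Gamma_le : ∃ G ≥ (0:ℝ), ∀ s : ℂ, 1 / 2 ≤ s.re → s.re ≤ 3 / 2 → ‖Complex.Gamma s‖ ≤ G := by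
  have hc : ContinuousOn Real.Gamma (Set.Icc (1 / 2) (3 / 2)) := fun x hx =>
    (Real.differentiableAt_Gamma fun m => by
      have := hx.1
      have hm : (0:ℝ) ≤ m := m.cast_nonneg
      linarith).continuousAt.continuousWithinAt
  obtain ⟨G, hG⟩ := isCompact_Icc.exists_bound_of_continuousOn hc
  refine ⟨max G 0, le_max_right _ _, fun s h1 h2 => ?_⟩
  exact ((norm_Gamma_le_Gamma_re (by linarith)).trans (le_abs_self _)).trans
    ((hG s.re ⟨h1, h2⟩).trans (le_max_left _ _))

theorem norm_Gammaℂ_mul_cos_of_re_eq_half {s : ℂ} (hs : s.re = 1 / 2) : ‖Gammaℂ s * Complex.cos (π * s / 2)‖ = 1 := by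
  rw [← Gammaℝ_div_Gammaℝ_one_sub fun n h => by
    have := congrArg Complex.re h; simp [hs] at this
    have hn : (0:ℝ) ≤ n := n.cast_nonneg
    linarith]
  have h : 1 - s = (starRingEnd ℂ) s := by
    apply Complex.ext <;> simp [hs]; norm_num
  rw [h, norm_div, norm_Gammaℝ_conj, div_self]
  rw [norm_ne_zero_iff]
  exact Gammaℝ_ne_zero_of_re_pos (by rw [hs]; norm_num)

theorem norm_Gammaℂ_mul_cos_of_re_eq_three_halves {s : ℂ} (hs : s.re = 3 / 2) :
    ‖Gammaℂ s * Complex.cos (π * s / 2)‖ = ‖1 - s‖ / (2 * π) := by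
  rw [← Gammaℝ_div_Gammaℝ_one_sub fun n h => by
    have := congrArg Complex.re h; simp [hs] at this
    have hn : (0:ℝ) ≤ n := n.cast_nonneg
    linarith]
  have h : 1 - s + 2 = (starRingEnd ℂ) s := by
    apply Complex.ext <;> simp [hs]; norm_num
  have h1 : 1 - s ≠ 0 := by
    intro h0; have := congrArg Complex.re h0; simp [hs] at this; norm_num at this
  have h2 := Gammaℝ_add_two h1
  have h3 : Gammaℝ s ≠ 0 := Gammaℝ_ne_zero_of_re_pos (by rw [hs]; norm_num)
  have h4 : ‖Gammaℝ s‖ = ‖Gammaℝ (1 - s)‖ * (‖1 - s‖ / (2 * π)) := by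
    rw [← norm_Gammaℝ_conj, ← h, h2, norm_div, norm_div, norm_mul, Complex.norm_real,
      Real.norm_of_nonneg Real.pi_pos.le]
    norm_num
    ring
  have h5 : ‖Gammaℝ (1 - s)‖ ≠ 0 := by
    intro h0; rw [h0, zero_mul, norm_eq_zero] at h4; exact h3 h4
  rw [norm_div, h4, mul_div_cancel_left₀ _ h5]

theorem norm_cexp_sub_mul_I_sq (s : ℂ) (t₀ : ℝ) : ‖cexp ((s - t₀ * I) ^ 2)‖ = rexp (s.re ^ 2 - (s.im - t₀) ^ 2) := by
  rw [Complex.norm_exp]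
  congr 1
  simp [sq]

theorem norm_cos_le_exp_norm (z : ℂ) : ‖Complex.cos z‖ ≤ rexp ‖z‖ := by
  rw [Complex.cos, norm_div]
  have h1 := Complex.norm_exp_le_exp_norm (z * I)
  have h2 := Complex.norm_exp_le_exp_norm (-z * I)
  rw [norm_mul, Complex.norm_I, mul_one] at h1 h2
  rw [norm_neg] at h2
  have := norm_add_le (cexp (z * I)) (cexp (-z * I))
  rw [div_le_iff₀ (by norm_num), Complex.norm_ofNat]
  linarith

theorem bddAbove_norm_Gammaℂ_mul_cos (t₀ : ℝ) :
    BddAbove ((norm ∘ fun s => Gammaℂ s * Complex.cos (π * s / 2) * cexp ((s - t₀ * I) ^ 2)) ''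
      HadamardThreeLines.verticalClosedStrip (1 / 2) (3 / 2)) := by
  obtain ⟨G, hG, h⟩ := exists_norm_Gamma_le
  refine ⟨2 * 1 * G * rexp (π / 2 * (3 / 2 + |t₀|) + 4), ?_⟩
  rintro _ ⟨s, ⟨hs1, hs2⟩, rfl⟩
  simp only [Function.comp_apply, norm_mul]
  have hp : ‖((2 * π : ℂ) ^ (-s))‖ ≤ 1 := by
    have : (2 * π : ℂ) = ((2 * π : ℝ) : ℂ) := by push_cast; ring
    rw [this, Complex.norm_cpow_eq_rpow_re_of_pos (by positivity)]
    apply Real.rpow_le_one_of_one_le_of_nonpos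
    · linarith [Real.pi_gt_three]
    · simp; linarith
  have hc : ‖Complex.cos (π * s / 2)‖ ≤ rexp (π / 2 * (3 / 2 + |s.im|)) := by
    refine (norm_cos_le_exp_norm _).trans (Real.exp_le_exp.2 ?_)
    rw [norm_div, norm_mul, Complex.norm_real, Real.norm_of_nonneg Real.pi_pos.le]
    have h1 : ‖s‖ ≤ 3 / 2 + |s.im| := by
      refine (Complex.norm_le_abs_re_add_abs_im s).trans ?_
      rw [abs_of_nonneg (by linarith)]
      linarith
    calc _ = π / 2 * ‖s‖ := by norm_num; ring
      _ ≤ _ := by gcongr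
  rw [norm_cexp_sub_mul_I_sq, Gammaℂ_def, norm_mul, norm_mul]
  calc _ ≤ 2 * 1 * G * rexp (π / 2 * (3 / 2 + |s.im|)) * rexp (s.re ^ 2 - (s.im - t₀) ^ 2) := by
        gcongr
        · norm_num
        · exact h s hs1 hs2
    _ = 2 * 1 * G * rexp (π / 2 * (3 / 2 + |s.im|) + (s.re ^ 2 - (s.im - t₀) ^ 2)) := by
        rw [mul_assoc, ← Real.exp_add]
    _ ≤ _ := by
        gcongr 2 * 1 * G * rexp ?_
        have h1 : |s.im| ≤ |t₀| + |s.im - t₀| := by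
          have := abs_add_le t₀ (s.im - t₀); rwa [add_sub_cancel] at this
        have h2 : s.re ^ 2 ≤ 9 / 4 := by nlinarith
        have h3 : π / 2 * |s.im - t₀| ≤ (s.im - t₀) ^ 2 + 1 := by
          rw [← sq_abs (s.im - t₀)]
          have := Real.pi_le_four
          nlinarith [sq_nonneg (|s.im - t₀| - 1), abs_nonneg (s.im - t₀)]
        have h4 : π / 2 * |s.im| ≤ π / 2 * (|t₀| + |s.im - t₀|) := by gcongr
        linarith

theorem exists_norm_Gammaℂ_mul_cos_le : ∃ C > (0:ℝ), ∀ s : ℂ, 1 / 2 ≤ s.re → s.re ≤ 3 / 2 →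
    ‖Gammaℂ s * Complex.cos (π * s / 2)‖ ≤ C * (1 + |s.im|) ^ (s.re - 1 / 2) := by
  refine ⟨rexp (1 / 4) * (2 * rexp (9 / 4)), by positivity, fun s hs1 hs2 => ?_⟩
  set t₀ := s.im with ht
  have key := HadamardThreeLines.norm_le_interp_of_mem_verticalClosedStrip'
    (f := fun s => Gammaℂ s * Complex.cos (π * s / 2) * cexp ((s - t₀ * I) ^ 2)) (z := s)
    (a := rexp (1 / 4)) (b := 2 * rexp (9 / 4) * (1 + |t₀|)) (l := 1 / 2) (u := 3 / 2) (by norm_num) ⟨hs1, hs2⟩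
    (by
      apply DifferentiableOn.diffContOnCl
      intro z hz
      have hz' : 0 < z.re := by
        have : z ∈ HadamardThreeLines.verticalClosedStrip (1 / 2) (3 / 2) :=
          closure_minimal (Set.preimage_mono Set.Ioo_subset_Icc_self)
            (isClosed_Icc.preimage continuous_re) hz
        linarith [this.1]
      have h1 : DifferentiableAt ℂ Complex.Gamma z := Complex.differentiableAt_Gamma z fun m h => by
        rw [h] at hz'; simp at hz'
        have hn : (0:ℝ) ≤ m := m.cast_nonneg
        linarith
      have h2 : DifferentiableAt ℂ Gammaℂ z := by
        unfold Gammaℂ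
        refine DifferentiableAt.mul ?_ h1
        refine (DifferentiableAt.const_cpow (by fun_prop) ?_).const_mul 2
        left; simp [Real.pi_ne_zero]
      exact ((h2.mul (by fun_prop)).mul (by fun_prop)).differentiableWithinAt)
    (bddAbove_norm_Gammaℂ_mul_cos t₀)
    (fun z hz => by
      have hz : z.re = 1 / 2 := hz
      rw [norm_mul, norm_Gammaℂ_mul_cos_of_re_eq_half hz, norm_cexp_sub_mul_I_sq, one_mul, hz]
      apply Real.exp_le_exp.2
      nlinarith [sq_nonneg (z.im - t₀)])
    (fun z hz => by
      have hz : z.re = 3 / 2 := hz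
      rw [norm_mul, norm_Gammaℂ_mul_cos_of_re_eq_three_halves hz, norm_cexp_sub_mul_I_sq, hz]
      have h1 : ‖1 - z‖ ≤ 1 + |z.im| := by
        refine (Complex.norm_le_abs_re_add_abs_im _).trans ?_
        simp only [Complex.sub_re, Complex.sub_im, hz, Complex.one_re, Complex.one_im, zero_sub, abs_neg]
        norm_num
      have h2 : ‖1 - z‖ / (2 * π) ≤ 1 + |z.im| := by
        rw [div_le_iff₀ (by positivity)]
        have := Real.pi_gt_three
        have := abs_nonneg z.im
        nlinarith
      have h3 : |z.im| ≤ |t₀| + |z.im - t₀| := by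
        have := abs_add_le t₀ (z.im - t₀); rwa [add_sub_cancel] at this
      have h4 : 1 + |z.im| ≤ (1 + |t₀|) * (1 + |z.im - t₀|) := by
        nlinarith [mul_nonneg (abs_nonneg t₀) (abs_nonneg (z.im - t₀))]
      have h5 : 1 + |z.im - t₀| ≤ 2 * rexp ((z.im - t₀) ^ 2) := by
        have := Real.add_one_le_exp ((z.im - t₀) ^ 2)
        rw [← sq_abs] at this ⊢
        nlinarith [sq_nonneg (|z.im - t₀| - 1)]
      calc _ ≤ ((1 + |t₀|) * (2 * rexp ((z.im - t₀) ^ 2))) * rexp ((3 / 2) ^ 2 - (z.im - t₀) ^ 2) := by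
            gcongr
            exact h2.trans (h4.trans (by gcongr))
        _ = 2 * (1 + |t₀|) * (rexp ((z.im - t₀) ^ 2) * rexp ((3 / 2) ^ 2 - (z.im - t₀) ^ 2)) := by ring
        _ = 2 * (1 + |t₀|) * rexp (9 / 4) := by
            rw [← Real.exp_add]; congr 2; ring
        _ ≤ _ := le_of_eq (by ring))
  have h0 : (1:ℝ) ≤ 1 + |t₀| := by linarith [abs_nonneg t₀]
  simp only [norm_mul (Gammaℂ s * Complex.cos (π * s / 2))] at key
  rw [norm_cexp_sub_mul_I_sq, show (3 / 2 - 1 / 2 : ℝ) = 1 by norm_num, div_one] at key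
  have h1 : 1 ≤ rexp (s.re ^ 2 - (s.im - t₀) ^ 2) := by
    rw [Real.one_le_exp_iff, ht]; simp; positivity
  calc _ ≤ ‖Gammaℂ s * Complex.cos (π * s / 2)‖ * rexp (s.re ^ 2 - (s.im - t₀) ^ 2) :=
        le_mul_of_one_le_right (norm_nonneg _) h1
    _ ≤ _ := key
    _ ≤ rexp (1 / 4) ^ (1:ℝ) * ((2 * rexp (9 / 4)) ^ (1:ℝ) * (1 + |t₀|) ^ (s.re - 1 / 2)) := by
        rw [Real.mul_rpow (by positivity) (by positivity)]
        gcongr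
        · exact Real.one_le_exp (by norm_num)
        · linarith
        · linarith [Real.add_one_le_exp (9 / 4)]
        · linarith
    _ = _ := by rw [Real.rpow_one, Real.rpow_one]; ring

/-- The functional equation compares `ζ(1 - s̄)` with `ζ(s)`. -/
theorem exists_norm_riemannZeta_one_sub_conj_le : ∃ C > (0:ℝ), ∀ s : ℂ, 1 / 2 ≤ s.re → s.re < 1 →
    ‖riemannZeta (1 - (starRingEnd ℂ) s)‖ ≤ C * (1 + |s.im|) ^ (s.re - 1 / 2) * ‖riemannZeta s‖ := by
  obtain ⟨C, hC, h⟩ := exists_norm_Gammaℂ_mul_cos_le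
  refine ⟨C, hC, fun s hs1 hs2 => ?_⟩
  have e : 1 - (starRingEnd ℂ) s = (starRingEnd ℂ) (1 - s) := by simp
  rw [e, riemannZeta_conj, RCLike.norm_conj, riemannZeta_one_sub (fun n h => by
    rw [h] at hs1; simp at hs1
    have hn : (0:ℝ) ≤ n := n.cast_nonneg
    linarith) (by rintro rfl; simp at hs2), ← Gammaℂ_def, norm_mul]
  gcongr
  exact h s hs1 (by linarith)

theorem sum_divisors_vonMangoldt_mul_rpow_nonneg (α : ℝ) (n : ℕ) :
    0 ≤ ∑ d ∈ n.divisors, ArithmeticFunction.vonMangoldt (n / d) * (d : ℝ) ^ α :=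
  Finset.sum_nonneg fun d _ => mul_nonneg ArithmeticFunction.vonMangoldt_nonneg (by positivity)

theorem sum_divisors_vonMangoldt_mul_rpow_le {α : ℝ} (hα' : α ≤ 1) {n : ℕ} (hn : 1 ≤ n) :
    ∑ d ∈ n.divisors, ArithmeticFunction.vonMangoldt (n / d) * (d : ℝ) ^ α ≤ (n : ℝ) ^ 2 := by
  have hn1 : (1:ℝ) ≤ n := by exact_mod_cast hn
  calc _ ≤ ∑ d ∈ n.divisors, ArithmeticFunction.vonMangoldt (n / d) * (n : ℝ) := by
        refine Finset.sum_le_sum fun d hd => mul_le_mul_of_nonneg_left ?_ ArithmeticFunction.vonMangoldt_nonneg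
        have h1 : (1:ℝ) ≤ d := by exact_mod_cast Nat.pos_of_mem_divisors hd
        have h2 : (d:ℝ) ≤ n := by exact_mod_cast Nat.divisor_le hd
        calc (d:ℝ) ^ α ≤ (d:ℝ) ^ (1:ℝ) := Real.rpow_le_rpow_of_exponent_le h1 hα'
          _ ≤ n := by rwa [Real.rpow_one]
    _ = Real.log n * n := by
        rw [← Finset.sum_mul, Nat.sum_div_divisors n (fun m => ArithmeticFunction.vonMangoldt m),
          ArithmeticFunction.vonMangoldt_sum]
    _ ≤ n * n := by
        gcongr
        exact (Real.log_le_sub_one_of_pos (by linarith)).trans (by linarith)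
    _ = _ := (sq _).symm

theorem fAlpha_nonneg (α x : ℝ) : 0 ≤ fAlpha α x :=
  Finset.sum_nonneg fun n _ => sum_divisors_vonMangoldt_mul_rpow_nonneg α n

theorem sum_sum_divisors_le {α : ℝ} (hα' : α ≤ 1) (N : ℕ) :
    ∑ n ∈ Finset.Icc 1 N, ∑ d ∈ n.divisors, ArithmeticFunction.vonMangoldt (n / d) * (d : ℝ) ^ α ≤ (N : ℝ) ^ 3 := by
  calc _ ≤ ∑ n ∈ Finset.Icc 1 N, (N : ℝ) ^ 2 := by
        refine Finset.sum_le_sum fun n hn => ?_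
        rw [Finset.mem_Icc] at hn
        refine (sum_divisors_vonMangoldt_mul_rpow_le hα' hn.1).trans ?_
        have : (n:ℝ) ≤ N := by exact_mod_cast hn.2
        gcongr
    _ = _ := by simp; ring

theorem fAlpha_le {α : ℝ} (hα' : α ≤ 1) {x : ℝ} (hx : 0 ≤ x) : fAlpha α x ≤ x ^ 3 :=
  (sum_sum_divisors_le hα' ⌊x⌋₊).trans (by gcongr; exact Nat.floor_le hx)

theorem fAlpha_of_lt {α x : ℝ} (hx : x < 1) : fAlpha α x = 0 := by
  have : ⌊x⌋₊ = 0 := Nat.floor_eq_zero.2 hx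
  simp [fAlpha, this]

theorem measurable_fAlpha (α : ℝ) : Measurable (fAlpha α) :=
  (measurable_from_nat (f := fun N : ℕ => ∑ n ∈ Finset.Icc 1 N, ∑ d ∈ n.divisors,
    ArithmeticFunction.vonMangoldt (n / d) * (d : ℝ) ^ α)).comp Nat.measurable_floor

theorem measurable_MAlpha (α : ℝ) : Measurable (MAlpha α) := by
  unfold MAlpha
  fun_prop

/-- The remainder `f_α - M_α`, cut off to `[1, ∞)`. -/
noncomputable def remainderAlpha (α x : ℝ) : ℝ := if x < 1 then 0 else fAlpha α x - MAlpha α x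

theorem remainderAlpha_of_lt {α x : ℝ} (hx : x < 1) : remainderAlpha α x = 0 := if_pos hx

theorem remainderAlpha_of_le {α x : ℝ} (hx : 1 ≤ x) : remainderAlpha α x = fAlpha α x - MAlpha α x :=
  if_neg hx.not_gt

theorem measurable_remainderAlpha (α : ℝ) : Measurable (remainderAlpha α) :=
  Measurable.ite measurableSet_Iio measurable_const ((measurable_fAlpha α).sub (measurable_MAlpha α))

theorem exists_abs_remainderAlpha_le {α : ℝ} (hα' : α ≤ 1) :
    ∃ K ≥ (0:ℝ), ∀ x, 1 ≤ x → ‖(remainderAlpha α x : ℂ)‖ ≤ K * x ^ (3:ℝ) := by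
  refine ⟨1 + |(-(1/(1+α)) * (logDerivZeta ((1:ℂ) + (α:ℂ)))).re| + |(riemannZeta ((1:ℂ) - (α:ℂ))).re|,
    by positivity, fun x hx => ?_⟩
  have h0 : 0 < x := by linarith
  rw [Complex.norm_real, Real.norm_eq_abs, remainderAlpha_of_le hx]
  have h1 : x ^ (1 + α) ≤ x ^ (3:ℝ) := Real.rpow_le_rpow_of_exponent_le hx (by linarith)
  have h2 : x ≤ x ^ (3:ℝ) := by
    conv_lhs => rw [← Real.rpow_one x]
    exact Real.rpow_le_rpow_of_exponent_le hx (by norm_num)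
  have h3 : |fAlpha α x| ≤ x ^ (3:ℝ) := by
    rw [abs_of_nonneg (fAlpha_nonneg _ _)]
    refine (fAlpha_le hα' h0.le).trans (le_of_eq ?_)
    norm_cast
  unfold MAlpha
  set a := (-(1/(1+α)) * (logDerivZeta ((1:ℂ) + (α:ℂ)))).re
  set b := (riemannZeta ((1:ℂ) - (α:ℂ))).re
  calc _ ≤ |fAlpha α x| + |a * x ^ (1 + α) + b * x| := abs_sub _ _
    _ ≤ |fAlpha α x| + (|a| * x ^ (1 + α) + |b| * x) := by
        gcongr
        refine (abs_add_le _ _).trans ?_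
        rw [abs_mul, abs_mul, abs_of_pos h0, abs_of_nonneg (Real.rpow_nonneg h0.le _)]
    _ ≤ x ^ (3:ℝ) + (|a| * x ^ (3:ℝ) + |b| * x ^ (3:ℝ)) := by gcongr
    _ = _ := by ring

theorem continuousAt_fAlpha {α x : ℝ} (hx : 0 ≤ x) (hx' : ∀ n : ℕ, x ≠ n) : ContinuousAt (fAlpha α) x := by
  have h : ∀ᶠ y in nhds x, fAlpha α y = fAlpha α x := by
    have h1 : ((⌊x⌋₊ : ℕ) : ℝ) < x := lt_of_le_of_ne (Nat.floor_le hx) (hx' _).symm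
    filter_upwards [Ioo_mem_nhds h1 (Nat.lt_floor_add_one x)] with y hy
    have : ⌊y⌋₊ = ⌊x⌋₊ := by
      rw [Nat.floor_eq_iff ((Nat.cast_nonneg _).trans hy.1.le)]
      exact ⟨hy.1.le, hy.2⟩
    rw [fAlpha, fAlpha, this]
  exact continuousAt_const.congr (h.mono fun y hy => hy.symm)

theorem continuousAt_remainderAlpha {α x : ℝ} (hx : 0 < x) (hx' : ∀ n : ℕ, x ≠ n) :
    ContinuousAt (remainderAlpha α) x := by
  rcases lt_or_gt_of_ne (show x ≠ 1 by simpa using hx' 1) with h | h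
  · refine (continuousAt_const (y := (0:ℝ))).congr ?_
    filter_upwards [Iio_mem_nhds h] with y hy
    exact (remainderAlpha_of_lt hy).symm
  · have h1 : ContinuousAt (MAlpha α) x := by
      unfold MAlpha
      have : ContinuousAt (fun x : ℝ => x ^ (1 + α)) x := Real.continuousAt_rpow_const _ _ (Or.inl hx.ne')
      exact (this.const_mul _).add (continuousAt_id.const_mul _)
    refine ((continuousAt_fAlpha (α := α) hx.le hx').sub h1).congr ?_
    filter_upwards [Ioi_mem_nhds h] with y hy
    exact (remainderAlpha_of_le (le_of_lt hy)).symm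

theorem ae_continuousAt_remainderAlpha_exp (α l : ℝ) :
    ∀ᵐ u : ℝ, ContinuousAt (fun u : ℝ => (remainderAlpha α (rexp (u + l)) : ℂ)) u := by
  have hc : (Set.range fun n : ℕ => Real.log n - l).Countable := Set.countable_range _
  filter_upwards [hc.ae_notMem volume] with u hu
  have h1 : ContinuousAt (remainderAlpha α) (rexp (u + l)) := continuousAt_remainderAlpha (Real.exp_pos _) fun n hn => by
    apply hu
    exact ⟨n, by simp only; rw [← hn, Real.log_exp]; ring⟩
  have h2 : ContinuousAt (fun u : ℝ => rexp (u + l)) u := by fun_prop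
  exact Complex.continuous_ofReal.continuousAt.comp (ContinuousAt.comp (f := fun u : ℝ => rexp (u + l)) h1 h2)

theorem integral_fAlpha_exp {α : ℝ} (hα' : α ≤ 1) {s : ℂ} (hs : 3 < s.re) :
    ∫ u : ℝ, (fAlpha α (rexp u) : ℂ) * cexp (-s * u) =
      -deriv riemannZeta s / riemannZeta s * riemannZeta (s - α) / s := by
  set g : ℕ → ℂ := fun n => (n : ℂ) ^ (α : ℂ) with hg
  have hterm : ∀ n, LSeries.term g s n = LSeries.term 1 (s - α) n := fun n => by
    rcases Nat.eq_zero_or_pos n with rfl | hn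
    · simp
    · have hn0 : (n:ℂ) ≠ 0 := by exact_mod_cast hn.ne'
      rw [LSeries.term_of_ne_zero hn.ne', LSeries.term_of_ne_zero hn.ne', hg, Complex.cpow_sub _ _ hn0]
      simp only [Pi.one_apply, one_div, inv_div]
  have hre : 1 < (s - α).re := by simp; linarith
  have hgs : LSeriesSummable g s := by
    have := LSeriesSummable_one_iff.2 hre
    rw [LSeriesSummable] at this ⊢
    exact this.congr fun n => (hterm n).symm
  have hgL : LSeries g s = riemannZeta (s - α) := by
    rw [← LSeries_one_eq_riemannZeta hre, LSeries, LSeries]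
    exact tsum_congr hterm
  have hΛ := ArithmeticFunction.LSeriesSummable_vonMangoldt (s := s) (by linarith)
  have hf : ∀ n : ℕ, ((∑ d ∈ n.divisors, ArithmeticFunction.vonMangoldt (n / d) * (d : ℝ) ^ α : ℝ) : ℂ)
      = LSeries.convolution g (fun n => (ArithmeticFunction.vonMangoldt n : ℂ)) n := fun n => by
    rw [LSeries.convolution_def]
    simp only
    rw [Nat.sum_divisorsAntidiagonal (fun a b => g a * (ArithmeticFunction.vonMangoldt b : ℂ))]
    push_cast
    refine Finset.sum_congr rfl fun d hd => ?_
    rw [mul_comm, hg, Complex.ofReal_cpow (Nat.cast_nonneg d)]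
    simp
  have key := integral_summatory_exp (fun n => ((∑ d ∈ n.divisors, ArithmeticFunction.vonMangoldt (n / d) * (d : ℝ) ^ α : ℝ) : ℂ))
    (r := 3) (by norm_num) hs (by
      have := hgs.convolution hΛ
      rwa [← funext hf] at this) (by
      refine Asymptotics.IsBigO.of_bound 1 (Filter.Eventually.of_forall fun N => ?_)
      have h0 : 0 ≤ ∑ n ∈ Finset.Icc 1 N, ∑ d ∈ n.divisors, ArithmeticFunction.vonMangoldt (n / d) * (d : ℝ) ^ α :=
        Finset.sum_nonneg fun n _ => sum_divisors_vonMangoldt_mul_rpow_nonneg α n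
      rw [← Complex.ofReal_sum, Complex.norm_real, Real.norm_of_nonneg h0, one_mul, Real.norm_of_nonneg (by positivity)]
      exact_mod_cast sum_sum_divisors_le hα' N)
  rw [funext hf, LSeries_convolution' hgs hΛ, hgL,
    ArithmeticFunction.LSeries_vonMangoldt_eq_deriv_riemannZeta_div (by linarith)] at key
  rw [mul_comm (riemannZeta (s - α))] at key
  rw [← key]
  refine integral_congr_ae (Filter.Eventually.of_forall fun u => ?_)
  simp only [fAlpha]
  rw [Complex.ofReal_sum]
  simp only [hf]

theorem integral_remainderAlpha_exp {α : ℝ} (hα' : α ≤ 1) {s : ℂ} (hs : 3 < s.re) :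
    ∫ u : ℝ, (remainderAlpha α (rexp u) : ℂ) * cexp (-s * u) =
      -deriv riemannZeta s / riemannZeta s * riemannZeta (s - α) / s
        - (((-(1/(1+α)) * (logDerivZeta ((1:ℂ) + (α:ℂ)))).re : ℝ) : ℂ) / (s - 1 - α)
        - (((riemannZeta ((1:ℂ) - (α:ℂ))).re : ℝ) : ℂ) / (s - 1) := by
  set a := (-(1/(1+α)) * (logDerivZeta ((1:ℂ) + (α:ℂ)))).re with ha
  set b := (riemannZeta ((1:ℂ) - (α:ℂ))).re with hb
  have r1 : (-(s - 1 - α)).re < 0 := by simp; linarith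
  have r2 : (-(s - 1)).re < 0 := by simp; linarith
  have i1 := (integrableOn_exp_mul_complex_Ioi r1 0).const_mul (a : ℂ)
  have i2 := (integrableOn_exp_mul_complex_Ioi r2 0).const_mul (b : ℂ)
  have e1 := integral_exp_mul_complex_Ioi r1 0
  have e2 := integral_exp_mul_complex_Ioi r2 0
  have iM : IntegrableOn (fun u : ℝ => (MAlpha α (rexp u) : ℂ) * cexp (-s * u)) (Set.Ioi 0) ∧
      ∫ u in Set.Ioi (0:ℝ), (MAlpha α (rexp u) : ℂ) * cexp (-s * u) = a / (s - 1 - α) + b / (s - 1) := by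
    have hM : ∀ u : ℝ, (MAlpha α (rexp u) : ℂ) * cexp (-s * u) =
        a * cexp (-(s - 1 - α) * u) + b * cexp (-(s - 1) * u) := fun u => by
      rw [MAlpha, ← ha, ← hb, ← Real.exp_mul]
      push_cast
      rw [add_mul, mul_assoc, mul_assoc, ← Complex.exp_add, ← Complex.exp_add]
      congr 3 <;> ring
    simp_rw [hM]
    refine ⟨i1.add i2, ?_⟩
    rw [integral_add i1 i2, integral_const_mul, integral_const_mul, e1, e2]
    simp only [Complex.ofReal_zero, mul_zero, Complex.exp_zero]
    rw [neg_div_neg_eq, neg_div_neg_eq]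
    ring
  have iM' : Integrable (Set.indicator (Set.Ioi 0) (fun u : ℝ => (MAlpha α (rexp u) : ℂ) * cexp (-s * u))) :=
    iM.1.integrable_indicator measurableSet_Ioi
  have iF : Integrable fun u : ℝ => (fAlpha α (rexp u) : ℂ) * cexp (-s * u) :=
    integrable_comp_exp_of_le (h := fun x => (fAlpha α x : ℂ)) (K := 1) (r := 3)
      (Complex.measurable_ofReal.comp (measurable_fAlpha α)) (fun x hx => by simp [fAlpha_of_lt hx])
      (fun x hx => by
        rw [Complex.norm_real, Real.norm_of_nonneg (fAlpha_nonneg _ _), one_mul]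
        exact_mod_cast fAlpha_le hα' (by linarith)) hs
  calc _ = ∫ u : ℝ, ((fAlpha α (rexp u) : ℂ) * cexp (-s * u) -
        Set.indicator (Set.Ioi 0) (fun u : ℝ => (MAlpha α (rexp u) : ℂ) * cexp (-s * u)) u) := by
        apply integral_congr_ae
        filter_upwards [Measure.ae_ne volume (0:ℝ)] with u hu
        rcases lt_or_gt_of_ne hu with hu | hu
        · have := Real.exp_lt_one_iff.2 hu
          rw [remainderAlpha_of_lt this, fAlpha_of_lt this, Set.indicator_of_notMem (by simp [hu.le])]
          simp
        · rw [remainderAlpha_of_le (Real.one_le_exp hu.le), Set.indicator_of_mem (Set.mem_Ioi.2 hu)]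
          push_cast; ring
    _ = _ := by
        rw [integral_sub iF iM', integral_indicator measurableSet_Ioi, iM.2, integral_fAlpha_exp hα' hs]
        ring

theorem ofReal_re_riemannZeta_ofReal (x : ℝ) : ((riemannZeta (x : ℂ)).re : ℂ) = riemannZeta x := by
  rw [← Complex.conj_eq_iff_re, ← riemannZeta_conj, Complex.conj_ofReal]

theorem ofReal_re_deriv_riemannZeta_ofReal (x : ℝ) :
    ((deriv riemannZeta (x : ℂ)).re : ℂ) = deriv riemannZeta x := by
  rw [← Complex.conj_eq_iff_re]
  have h := congrFun (deriv_conj_conj (f := riemannZeta)) (x : ℂ)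
  have e : (starRingEnd ℂ) ∘ riemannZeta ∘ (starRingEnd ℂ) = riemannZeta := by
    ext s; simp [riemannZeta_conj]
  rw [e, Function.comp_apply, Function.comp_apply, Complex.conj_ofReal] at h
  exact h.symm

theorem ofReal_re_logDerivZeta_coeff (α : ℝ) :
    (((-(1/(1+α)) * (logDerivZeta ((1:ℂ) + (α:ℂ)))).re : ℝ) : ℂ) =
      -(1/(1+α)) * (logDerivZeta ((1:ℂ) + (α:ℂ))) := by
  have h1 := ofReal_re_riemannZeta_ofReal (1 + α)
  have h2 := ofReal_re_deriv_riemannZeta_ofReal (1 + α)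
  push_cast at h1 h2
  rw [logDerivZeta, ← h1, ← h2]
  norm_cast

theorem ofReal_re_riemannZeta_one_sub (α : ℝ) :
    (((riemannZeta ((1:ℂ) - (α:ℂ))).re : ℝ) : ℂ) = riemannZeta ((1:ℂ) - (α:ℂ)) := by
  have h1 := ofReal_re_riemannZeta_ofReal (1 - α)
  push_cast at h1
  exact h1

theorem mul_riemannZeta_one_sub {z : ℂ} (hz : z ≠ 0) : z * riemannZeta (1 - z) = -riemannZeta₁ (1 - z) := by
  rw [riemannZeta_eq_inv_sub_mul fun h => hz (by linear_combination -h), sub_sub_cancel_left]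
  field_simp

theorem mul_logDerivZeta_one_add {z : ℂ} (hz : z ≠ 0) (h : riemannZeta₁ (1 + z) ≠ 0) :
    z * (-(1/(1+z)) * logDerivZeta (1 + z)) =
      (riemannZeta₁ (1 + z) - z * deriv riemannZeta₁ (1 + z)) / riemannZeta₁ (1 + z) / (1 + z) := by
  have h1 : 1 + z ≠ 1 := by simpa using hz
  rw [logDerivZeta, deriv_riemannZeta_eq_neg_inv_sub_sq_mul_add h1, riemannZeta_eq_inv_sub_mul h1, add_sub_cancel_left]
  field_simp
  ring

/-- The two residues at `1 + α` and `1` cancel to leading order as `α → 0`. -/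
theorem exists_norm_residues_le (hRH : RiemannHypothesis) : ∃ C ≥ (0:ℝ), ∀ α : ℝ, 0 < α → α ≤ 1 / 8 →
    ‖(-(1/(1+α)) * (logDerivZeta ((1:ℂ) + (α:ℂ)))) + riemannZeta ((1:ℂ) - (α:ℂ))‖ ≤ C ∧
      ‖(α:ℂ) * riemannZeta ((1:ℂ) - (α:ℂ))‖ ≤ C := by
  set H : ℂ → ℂ := fun z => (riemannZeta₁ (1 + z) - z * deriv riemannZeta₁ (1 + z)) / riemannZeta₁ (1 + z) / (1 + z)
    - riemannZeta₁ (1 - z) with hH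
  have hd : Differentiable ℂ (deriv riemannZeta₁) := differentiable_riemannZeta₁.deriv
  set U : Set ℂ := {z | -(1 / 2) < z.re} with hU
  have hUo : IsOpen U := isOpen_lt continuous_const Complex.continuous_re
  have hHd : DifferentiableOn ℂ H U := fun z hz => by
    have hz' : -(1 / 2) < z.re := hz
    have h0 : 1 + z ≠ 0 := fun h => by
      have := congrArg Complex.re h; simp at this; linarith
    have h1 : riemannZeta₁ (1 + z) ≠ 0 := riemannZeta₁_ne_zero hRH (by simp; linarith)
    have : DifferentiableAt ℂ H z := by
      simp only [hH]
      fun_prop (disch := assumption)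
    exact this.differentiableWithinAt
  have hc : ContinuousOn (dslope H 0) U :=
    ((Complex.differentiableOn_dslope (hUo.mem_nhds (by simp [hU]))).2 hHd).continuousOn
  have hI : ∀ x ∈ Set.Icc (0:ℝ) (1/8), (x : ℂ) ∈ U := fun x hx => by
    simp only [hU, Set.mem_ofPred_eq, Complex.ofReal_re]; linarith [hx.1]
  obtain ⟨C₁, h1⟩ := (isCompact_Icc (a := (0:ℝ)) (b := 1/8)).exists_bound_of_continuousOn
    (f := fun x : ℝ => dslope H 0 x) (hc.comp Complex.continuous_ofReal.continuousOn hI)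
  obtain ⟨C₂, h2⟩ := (isCompact_Icc (a := (0:ℝ)) (b := 1/8)).exists_bound_of_continuousOn
    (f := fun x : ℝ => riemannZeta₁ (1 - x)) (by
      have := differentiable_riemannZeta₁.continuous
      fun_prop)
  refine ⟨max |C₁| |C₂|, by positivity, fun α hα hα' => ?_⟩
  have hα0 : (α : ℂ) ≠ 0 := by exact_mod_cast hα.ne'
  have hZ : riemannZeta₁ (1 + α) ≠ 0 := riemannZeta₁_ne_zero hRH (by simp; linarith)
  have g1 := h1 α ⟨hα.le, hα'⟩
  have g2 := h2 α ⟨hα.le, hα'⟩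
  constructor
  · refine le_trans (le_of_eq ?_) (g1.trans ((le_abs_self _).trans (le_max_left _ _)))
    have e0 : H 0 = 0 := by simp [hH]
    rw [dslope_of_ne _ hα0, slope_def_field, e0, sub_zero, sub_zero]
    congr 1
    rw [eq_div_iff hα0]
    simp only [hH]
    rw [← mul_logDerivZeta_one_add hα0 hZ]
    linear_combination mul_riemannZeta_one_sub hα0
  · rw [mul_riemannZeta_one_sub hα0, norm_neg]
    exact g2.trans ((le_abs_self _).trans (le_max_right _ _))

/-- The analytic continuation of the Laplace transform of the remainder `f_α - M_α`. -/
theorem exists_differentiableAt_laplace_remainderAlpha (hRH : RiemannHypothesis) {α : ℝ} (hα : 0 < α) :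
    ∃ A : ℂ → ℂ, (∀ s : ℂ, 1 / 2 < s.re → DifferentiableAt ℂ A s) ∧ ∀ s : ℂ, 1 / 2 < s.re → s ≠ 1 → s ≠ 1 + α →
      A s = -deriv riemannZeta s / riemannZeta s * riemannZeta (s - α) / s
        - (((-(1/(1+α)) * (logDerivZeta ((1:ℂ) + (α:ℂ)))).re : ℝ) : ℂ) / (s - 1 - α)
        - (((riemannZeta ((1:ℂ) - (α:ℂ))).re : ℝ) : ℂ) / (s - 1) := by
  have hαc : (α : ℂ) ≠ 0 := by exact_mod_cast hα.ne'
  have hα1 : (1 : ℂ) + α ≠ 0 := by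
    have : (1 + α : ℝ) ≠ 0 := by positivity
    exact_mod_cast this
  rw [ofReal_re_logDerivZeta_coeff, ofReal_re_riemannZeta_one_sub]
  set c₁ := -(1/(1+α)) * (logDerivZeta ((1:ℂ) + (α:ℂ))) with hc₁
  set c₂ := riemannZeta ((1:ℂ) - (α:ℂ)) with hc₂
  set G : ℂ → ℂ := fun s => (riemannZeta₁ s - (s - 1) * deriv riemannZeta₁ s) / riemannZeta₁ s * riemannZeta₁ (s - α) / s
    - c₁ * (s - 1) - c₂ * (s - 1 - α) with hG
  have hne1 : (1:ℂ) + α ≠ 1 := by simpa using hαc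
  have hZα : riemannZeta₁ (1 + α) ≠ 0 := riemannZeta₁_ne_zero hRH (by simp; linarith)
  have hG1 : G 1 = 0 := by
    simp only [hG, riemannZeta₁_one]
    have : (α:ℂ) * c₂ = -riemannZeta₁ (1 - α) := mul_riemannZeta_one_sub hαc
    linear_combination this
  have hG2 : G (1 + α) = 0 := by
    have e1 : (1:ℂ) + α - 1 = α := by ring
    have e2 : (1:ℂ) + α - α = 1 := by ring
    simp only [hG]
    rw [e1, e2, riemannZeta₁_one, sub_self, mul_one, ← mul_logDerivZeta_one_add hαc hZα]
    ring
  set U : Set ℂ := {s | 1 / 2 < s.re} with hU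
  have hUo : IsOpen U := isOpen_lt continuous_const Complex.continuous_re
  have hd : Differentiable ℂ (deriv riemannZeta₁) :=
    differentiable_riemannZeta₁.deriv
  have hGd : DifferentiableOn ℂ G U := fun s hs => by
    have h0 : s ≠ 0 := by rintro rfl; simp [hU] at hs; linarith
    have h1 := riemannZeta₁_ne_zero hRH hs
    have hd' := hd s
    have : DifferentiableAt ℂ G s := by
      simp only [hG]
      fun_prop (disch := assumption)
    exact this.differentiableWithinAt
  have m1 : U ∈ nhds (1:ℂ) := hUo.mem_nhds (by simp [hU]; norm_num)
  have m2 : U ∈ nhds (1 + α:ℂ) := hUo.mem_nhds (by simp [hU]; linarith)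
  have hA : DifferentiableOn ℂ (dslope (dslope G 1) (1 + α)) U :=
    (Complex.differentiableOn_dslope m2).2 ((Complex.differentiableOn_dslope m1).2 hGd)
  refine ⟨_, fun s hs => (hA s hs).differentiableAt (hUo.mem_nhds hs), fun s hs h1 h2 => ?_⟩
  have h0 : s ≠ 0 := by rintro rfl; simp at hs; linarith
  have hZ := riemannZeta₁_ne_zero hRH hs
  have h1' := sub_ne_zero.2 h1
  have h2' : s - 1 - α ≠ 0 := by rw [sub_sub]; exact sub_ne_zero.2 h2
  have h3 : s - α ≠ 1 := fun h => h2 (by rw [← h]; ring)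
  rw [dslope_of_ne _ h2, slope_def_field, dslope_of_ne _ h1, dslope_of_ne _ hne1, slope_def_field, slope_def_field, hG1, hG2]
  rw [deriv_riemannZeta_eq_neg_inv_sub_sq_mul_add h1, riemannZeta_eq_inv_sub_mul h1, riemannZeta_eq_inv_sub_mul h3]
  have e3 : s - α - 1 = s - 1 - α := by ring
  have e4 : s - (1 + α) = s - 1 - α := by ring
  rw [e3, e4]
  simp only [hG]
  clear_value c₁ c₂
  field_simp
  ring

theorem exists_norm_laplace_remainderAlpha_le (hRH : RiemannHypothesis) {α σ : ℝ} (hα : 0 < α) (hα' : α ≤ 1 / 8)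
    (hσ : 1 / 2 < σ) {c₁ c₂ : ℂ} {A : ℂ → ℂ} (hA : ∀ s : ℂ, 1 / 2 < s.re → DifferentiableAt ℂ A s)
    (hAs : ∀ s : ℂ, 1 / 2 < s.re → s ≠ 1 → s ≠ 1 + α →
      A s = -deriv riemannZeta s / riemannZeta s * riemannZeta (s - α) / s - c₁ / (s - 1 - α) - c₂ / (s - 1)) :
    ∃ (M : ℝ) (N : ℕ), ∀ s, σ ≤ s.re → s.re ≤ 5 → ‖A s‖ ≤ M * (1 + |s.im|) ^ N := by
  obtain ⟨C, hC, h0⟩ := exists_norm_riemannZeta₀_le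
  obtain ⟨K, hK, N, hZ⟩ := exists_inv_norm_riemannZeta₁_le hRH hσ
  have hcomp : IsCompact (Set.Icc σ 5 ×ℂ Set.Icc (-1) (1:ℝ)) := isCompact_Icc.reProdIm isCompact_Icc
  obtain ⟨M₀, hM₀⟩ := hcomp.exists_bound_of_continuousOn (f := A) fun s hs =>
    (hA s (hσ.trans_le hs.1.1)).continuousAt.continuousWithinAt
  refine ⟨|M₀| + ((1 + 64 * 6) * (7 * K) * (1 + C * 8 ^ 2) + ‖c₁‖ + ‖c₂‖), N + 4, fun s h1 h2 => ?_⟩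
  set y := 1 + |s.im| with hy
  have hy1 : 1 ≤ y := by simp [hy]
  have hyN : 1 ≤ y ^ (N + 4) := one_le_pow₀ hy1
  rcases le_or_gt |s.im| 1 with hi | hi
  · have := hM₀ s ⟨⟨h1, h2⟩, abs_le.1 hi⟩
    refine this.trans ((le_abs_self _).trans ?_)
    have : |M₀| ≤ |M₀| + ((1 + 64 * 6) * (7 * K) * (1 + C * 8 ^ 2) + ‖c₁‖ + ‖c₂‖) := by
      linarith [show 0 ≤ ((1 + 64 * 6) * (7 * K) * (1 + C * 8 ^ 2) + ‖c₁‖ + ‖c₂‖) by positivity]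
    exact this.trans (le_mul_of_one_le_right (by positivity) hyN)
  · have hn : ∀ z : ℂ, z.im = s.im → 1 ≤ ‖z‖ := fun z hz => by
      have := Complex.abs_im_le_norm z
      rw [hz] at this; linarith
    have hn0 : ∀ z : ℂ, z.im = s.im → z ≠ 0 := fun z hz h => by
      have := hn z hz; rw [h] at this; simp at this; linarith
    have i1 : (s - 1).im = s.im := by simp
    have i2 : (s - 1 - α).im = s.im := by simp
    have i3 : (s - α - 1).im = s.im := by simp
    have s1 : s ≠ 1 := sub_ne_zero.1 (hn0 _ i1)
    have s2 : s ≠ 1 + α := fun h => hn0 _ i2 (by rw [h]; ring)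
    have s3 : s - α ≠ 1 := sub_ne_zero.1 (hn0 _ i3)
    have hs : ‖s‖ ≤ 6 * y := by
      have := Complex.norm_le_abs_re_add_abs_im s
      rw [abs_of_pos (a := s.re) (by linarith)] at this
      linarith
    have hinv : ∀ z : ℂ, z.im = s.im → ‖z⁻¹‖ ≤ 1 := fun z hz => by
      rw [norm_inv]; exact inv_le_one_of_one_le₀ (hn z hz)
    have hs1 : ‖s - 1‖ ≤ 7 * y := (norm_sub_le _ _).trans (by rw [norm_one]; linarith)
    have b1 : ‖deriv riemannZeta s‖ ≤ (1 + 64 * 6) * y := by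
      rw [deriv_riemannZeta_eq_neg_inv_sub_sq_add s1]
      refine (norm_add_le _ _).trans ?_
      rw [norm_neg, norm_pow]
      have := pow_le_one₀ (n := 2) (norm_nonneg _) (hinv _ i1)
      have := norm_deriv_riemannZeta₀_le (s := s) (by linarith)
      linarith
    have b2 : ‖riemannZeta s‖⁻¹ ≤ 7 * K * y ^ (N + 1) := by
      rw [riemannZeta_eq_inv_sub_mul s1, norm_mul, norm_inv, mul_inv, inv_inv]
      calc _ ≤ (7 * y) * (K * y ^ N) := by gcongr; exact hZ s h1 h2
        _ = _ := by ring
    have b3 : ‖riemannZeta (s - α)‖ ≤ (1 + C * 8 ^ 2) * y ^ 2 := by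
      rw [riemannZeta_eq_inv_sub_add s3]
      refine (norm_add_le _ _).trans ?_
      have e1 := hinv _ i3
      have e2 := h0 (s - α) (by simp; linarith)
      have e3 : ‖s - α‖ ≤ 7 * y := (norm_sub_le _ _).trans (by
        rw [Complex.norm_real, Real.norm_of_nonneg hα.le]; linarith)
      calc _ ≤ 1 * y ^ 2 + C * (1 * y + 7 * y) ^ 2 := by
            refine add_le_add (e1.trans ?_) (e2.trans ?_)
            · rw [one_mul]; exact one_le_pow₀ hy1
            · gcongr; linarith
        _ = _ := by ring
    rw [hAs s (by linarith) s1 s2]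
    have hD : ‖-deriv riemannZeta s / riemannZeta s * riemannZeta (s - α) / s‖ ≤
        (1 + 64 * 6) * (7 * K) * (1 + C * 8 ^ 2) * y ^ (N + 4) := by
      rw [norm_div, norm_mul, norm_div, norm_neg]
      calc _ ≤ ‖deriv riemannZeta s‖ / ‖riemannZeta s‖ * ‖riemannZeta (s - α)‖ := div_le_self (by positivity) (hn _ rfl)
        _ ≤ ((1 + 64 * 6) * y) * (7 * K * y ^ (N + 1)) * ((1 + C * 8 ^ 2) * y ^ 2) := by
            rw [div_eq_mul_inv]; gcongr
        _ = _ := by ring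
    have d1 : ‖c₁ / (s - 1 - α)‖ ≤ ‖c₁‖ := by rw [norm_div]; exact div_le_self (norm_nonneg _) (hn _ i2)
    have d2 : ‖c₂ / (s - 1)‖ ≤ ‖c₂‖ := by rw [norm_div]; exact div_le_self (norm_nonneg _) (hn _ i1)
    have d1' := d1.trans (le_mul_of_one_le_right (norm_nonneg c₁) hyN)
    have d2' := d2.trans (le_mul_of_one_le_right (norm_nonneg c₂) hyN)
    calc _ ≤ _ := (norm_sub_le _ _).trans (add_le_add_left (norm_sub_le _ _) _)
      _ ≤ 0 * y ^ (N + 4) + ((1 + 64 * 6) * (7 * K) * (1 + C * 8 ^ 2) * y ^ (N + 4) + ‖c₁‖ * y ^ (N + 4) + ‖c₂‖ * y ^ (N + 4)) := by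
          linarith
      _ ≤ |M₀| * y ^ (N + 4) + _ := by gcongr; exact abs_nonneg _
      _ = _ := by ring

/-- On the line `re s = 1/2 + α/2` the points `s - α` and `1 - conj s` agree, which bounds the
continued transform of `f_α - M_α` by the derivative of zeta. -/
theorem exists_norm_laplace_remainderAlpha_line_le (hRH : RiemannHypothesis) : ∃ C > (0:ℝ), ∀ α : ℝ, 0 < α → α ≤ 1 / 8 →
    ∀ s : ℂ, s.re = 1 / 2 + α / 2 →
      ‖-deriv riemannZeta s / riemannZeta s * riemannZeta (s - α) / s
        - (((-(1/(1+α)) * (logDerivZeta ((1:ℂ) + (α:ℂ)))).re : ℝ) : ℂ) / (s - 1 - α)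
        - (((riemannZeta ((1:ℂ) - (α:ℂ))).re : ℝ) : ℂ) / (s - 1)‖ ≤
      C * ((1 + |s.im|) ^ (α / 2) / (1 + |s.im|)) * (‖deriv riemannZeta₀ s‖ + 1) := by
  obtain ⟨C, hC, hres⟩ := exists_norm_residues_le hRH
  obtain ⟨C', hC', hfun⟩ := exists_norm_riemannZeta_one_sub_conj_le
  refine ⟨24 * C' + 16 * C, by positivity, fun α hα hα' s hs => ?_⟩
  obtain ⟨h1, h2⟩ := hres α hα hα'
  rw [ofReal_re_logDerivZeta_coeff, ofReal_re_riemannZeta_one_sub]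
  set c₁ := -(1/(1+α)) * (logDerivZeta ((1:ℂ) + (α:ℂ)))
  set c₂ := riemannZeta ((1:ℂ) - (α:ℂ))
  set y := 1 + |s.im| with hy
  have hy1 : 1 ≤ y := by simp [hy]
  have hy0 : 0 < y := by linarith
  have hp : 1 ≤ y ^ (α / 2) := Real.one_le_rpow hy1 (by linarith)
  have hnorm : ∀ z : ℂ, z.im = s.im → 7 / 16 ≤ |z.re| → y ≤ 4 * ‖z‖ ∧ 7 / 16 ≤ ‖z‖ := fun z hz hr => by
    have e1 := Complex.abs_im_le_norm z
    have e2 := Complex.abs_re_le_norm z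
    rw [hz] at e1
    constructor <;> linarith
  obtain ⟨n0, n0'⟩ := hnorm s rfl (by rw [hs, abs_of_pos] <;> linarith)
  obtain ⟨n1, n1'⟩ := hnorm (s - 1) (by simp) (by
    rw [Complex.sub_re, hs, Complex.one_re, abs_of_neg] <;> linarith)
  obtain ⟨n2, n2'⟩ := hnorm (s - 1 - α) (by simp) (by
    rw [Complex.sub_re, Complex.sub_re, hs, Complex.one_re, Complex.ofReal_re, abs_of_neg] <;> linarith)
  have z1 : s - 1 ≠ 0 := fun h => by rw [h, norm_zero] at n1'; linarith
  have z2 : s - 1 - α ≠ 0 := fun h => by rw [h, norm_zero] at n2'; linarith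
  have b1 : ‖deriv riemannZeta s‖ ≤ 6 * (‖deriv riemannZeta₀ s‖ + 1) := by
    rw [deriv_riemannZeta_eq_neg_inv_sub_sq_add (sub_ne_zero.1 z1)]
    refine (norm_add_le _ _).trans ?_
    rw [norm_neg, norm_pow, norm_inv]
    have : ‖s - 1‖⁻¹ ≤ 16 / 7 := by
      rw [inv_le_comm₀ (by linarith) (by norm_num)]; linarith
    have : ‖s - 1‖⁻¹ ^ 2 ≤ (16 / 7) ^ 2 := by gcongr
    linarith [norm_nonneg (deriv riemannZeta₀ s)]
  have b2 : ‖riemannZeta (s - α)‖ ≤ C' * y ^ (α / 2) * ‖riemannZeta s‖ := by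
    have e : s - α = 1 - (starRingEnd ℂ) s := by
      apply Complex.ext
      · simp [hs]; ring
      · simp
    rw [e]
    refine (hfun s (by linarith) (by linarith)).trans (le_of_eq ?_)
    rw [hs]; congr 3; ring
  have inv_le : ∀ z : ℂ, y ≤ 4 * ‖z‖ → 7 / 16 ≤ ‖z‖ → ‖z‖⁻¹ ≤ 4 / y := fun z h h' => by
    rw [inv_le_comm₀ (by linarith) (by positivity), inv_div]; linarith
  have main : ‖-deriv riemannZeta s / riemannZeta s * riemannZeta (s - α) / s‖ ≤
      24 * C' * (y ^ (α / 2) / y) * (‖deriv riemannZeta₀ s‖ + 1) := by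
    rw [norm_div, norm_mul, norm_div, norm_neg]
    calc _ ≤ ‖deriv riemannZeta s‖ / ‖riemannZeta s‖ * (C' * y ^ (α / 2) * ‖riemannZeta s‖) / ‖s‖ := by gcongr
      _ = ‖deriv riemannZeta s‖ * (C' * y ^ (α / 2)) * (‖riemannZeta s‖ / ‖riemannZeta s‖) * ‖s‖⁻¹ := by ring
      _ ≤ (6 * (‖deriv riemannZeta₀ s‖ + 1)) * (C' * y ^ (α / 2)) * 1 * (4 / y) := by
          gcongr
          · exact div_self_le_one _
          · exact inv_le s n0 n0'
      _ = _ := by ring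
  have res : ‖c₁ / (s - 1 - α) + c₂ / (s - 1)‖ ≤ 16 * C * (1 / y) := by
    have e : c₁ / (s - 1 - α) + c₂ / (s - 1) = (c₁ + c₂) * (s - 1 - α)⁻¹ - α * c₂ * ((s - 1 - α)⁻¹ * (s - 1)⁻¹) := by
      field_simp; ring
    rw [e]
    refine (norm_sub_le _ _).trans ?_
    rw [norm_mul, norm_mul _ (_ * _), norm_mul _⁻¹, norm_inv, norm_inv]
    have i1 := inv_le _ n2 n2'
    have i2 : ‖s - 1‖⁻¹ ≤ 3 := by rw [inv_le_comm₀ (by linarith) (by norm_num)]; linarith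
    calc _ ≤ C * (4 / y) + C * (4 / y * 3) := by gcongr
      _ = _ := by ring
  rw [sub_sub]
  calc _ ≤ _ := norm_sub_le _ _
    _ ≤ 24 * C' * (y ^ (α / 2) / y) * (‖deriv riemannZeta₀ s‖ + 1) + 16 * C * (y ^ (α / 2) / y) * (‖deriv riemannZeta₀ s‖ + 1) := by
        refine add_le_add main (res.trans ?_)
        rw [mul_assoc (16 * C)]
        refine mul_le_mul_of_nonneg_left ?_ (by positivity : 0 ≤ 16 * C)
        have : 1 / y ≤ y ^ (α / 2) / y := by gcongr
        exact this.trans (le_mul_of_one_le_right (by positivity) (by linarith [norm_nonneg (deriv riemannZeta₀ s)]))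
    _ = _ := by ring

theorem norm_cexp_sub_one_le_three_mul {w : ℂ} (hw : w.re ≤ 1 / 2) : ‖cexp w - 1‖ ≤ 3 * min 1 ‖w‖ := by
  have h3 : ‖cexp w - 1‖ ≤ 3 := by
    refine (norm_sub_le _ _).trans ?_
    rw [Complex.norm_exp, norm_one]
    have h1 : rexp w.re ≤ rexp (1 / 2) := Real.exp_le_exp.2 hw
    have h2 : rexp (1 / 2) * rexp (1 / 2) ≤ 3 := by
      rw [← Real.exp_add]; norm_num; linarith [Real.exp_one_lt_d9]
    nlinarith [Real.exp_pos (1 / 2)]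
  rcases le_total ‖w‖ 1 with h | h
  · rw [min_eq_right h]
    linarith [Complex.norm_exp_sub_one_le h, norm_nonneg w]
  · rw [min_eq_left h]; linarith

theorem two_rpow_le {α : ℝ} (hα : 0 ≤ α) (hα' : α ≤ 1 / 8) : (2:ℝ) ^ α ≤ 3 / 2 := by
  have := rpow_one_add_le_one_add_mul_self (s := 1) (p := α) (by norm_num) hα (by linarith)
  norm_num at this
  linarith

/-- A dyadic decomposition of the frequency weight `(1+|t|)^α min(1/(1+|t|), 1/T)²`. -/
theorem exists_weight_le_dyadic {T α : ℝ} (hT : 3 ≤ T) (hα : 0 ≤ α) (hα' : α ≤ 1 / 8) (t : ℝ) :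
    ∃ k : ℕ, |t| ≤ 2 ^ k * T ∧
      (1 + |t|) ^ α * (min 1 ((1 + |t|) / T) / (1 + |t|)) ^ 2 ≤ T ^ α * (4 * (3 / 2) ^ (k + 1) / 4 ^ k) / T ^ 2 := by
  have hT0 : 0 < T := by linarith
  have hex : ∃ k : ℕ, |t| ≤ 2 ^ k * T := by
    obtain ⟨k, hk⟩ := pow_unbounded_of_one_lt |t| (one_lt_two (α := ℝ))
    exact ⟨k, hk.le.trans (le_mul_of_one_le_right (by positivity) (by linarith))⟩
  classical
  refine ⟨Nat.find hex, Nat.find_spec hex, ?_⟩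
  set k := Nat.find hex with hk
  have hspec : |t| ≤ 2 ^ k * T := Nat.find_spec hex
  set y := 1 + |t| with hy
  have hy0 : 0 < y := by positivity
  have hk1 : (1:ℝ) ≤ 2 ^ k := one_le_pow₀ (by norm_num)
  have hyle : y ≤ 2 ^ (k + 1) * T := by
    rw [pow_succ]; nlinarith
  have h1 : y ^ α ≤ T ^ α * (3 / 2) ^ (k + 1) := by
    calc y ^ α ≤ (2 ^ (k + 1) * T) ^ α := by gcongr
      _ = (2 ^ α) ^ (k + 1) * T ^ α := by
          rw [Real.mul_rpow (by positivity) hT0.le, ← Real.rpow_natCast, ← Real.rpow_natCast, ← Real.rpow_mul (by norm_num),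
            ← Real.rpow_mul (by norm_num), mul_comm α]
      _ ≤ (3 / 2) ^ (k + 1) * T ^ α := by
          gcongr
          exact two_rpow_le hα hα'
      _ = _ := mul_comm _ _
  have h2 : min 1 (y / T) / y ≤ 2 / (2 ^ k * T) := by
    rcases Nat.eq_zero_or_pos k with h | h
    · rw [h]
      calc _ ≤ (y / T) / y := by gcongr; exact min_le_right _ _
        _ = 1 / T := by field_simp
        _ ≤ _ := by simp only [pow_zero, one_mul]; gcongr; norm_num
    · have hlt : ¬ |t| ≤ 2 ^ (k - 1) * T := Nat.find_min hex (by omega)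
      push Not at hlt
      have e : (2:ℝ) ^ k = 2 * 2 ^ (k - 1) := by rw [← pow_succ']; congr 1; omega
      calc _ ≤ 1 / y := by gcongr; exact min_le_left _ _
        _ ≤ 1 / (2 ^ (k - 1) * T) := by
            apply one_div_le_one_div_of_le (by positivity); linarith
        _ = _ := by rw [e]; field_simp
  have h0 : 0 ≤ min 1 (y / T) / y := by positivity
  calc _ ≤ (T ^ α * (3 / 2) ^ (k + 1)) * (2 / (2 ^ k * T)) ^ 2 := by gcongr
    _ = _ := by
        rw [show (4:ℝ) ^ k = (2 ^ k) ^ 2 by rw [← pow_mul, mul_comm, pow_mul]; norm_num]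
        field_simp
        ring

theorem exists_lintegral_dyadic_le : ∃ C > (0:ℝ), ∀ T α σ M : ℝ, 3 ≤ T → 0 ≤ α → α ≤ 1 / 8 → 1 / 2 ≤ σ → σ ≤ 1 → 0 ≤ M →
    ∀ F : ℝ → ℂ, (∀ t, ‖F t‖ ≤ M * ((1 + |t|) ^ (α / 2) * (min 1 ((1 + |t|) / T) / (1 + |t|))) *
      (‖deriv riemannZeta₀ (σ + t * I)‖ + 1)) →
    ∫⁻ t, ‖F t‖ₑ ^ 2 ≤ ENNReal.ofReal (C * M ^ 2 * T ^ α * (Real.log T ^ 3 / T)) := by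
  obtain ⟨C, hC, hmean⟩ := lintegral_norm_deriv_riemannZeta₀_add_one_sq_le
  have hsum : Summable fun k : ℕ => ((k + 1 : ℕ) : ℝ) ^ 3 * (3 / 4 : ℝ) ^ (k + 1) :=
    (summable_nat_add_iff (f := fun k : ℕ => (k : ℝ) ^ 3 * (3 / 4 : ℝ) ^ k) 1).2
      (summable_pow_mul_geometric_of_norm_lt_one 3 (by rw [Real.norm_of_nonneg] <;> norm_num))
  set S := ∑' k : ℕ, ((k + 1 : ℕ) : ℝ) ^ 3 * (3 / 4 : ℝ) ^ (k + 1) with hS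
  have hS0 : 0 ≤ S := tsum_nonneg fun k => by positivity
  refine ⟨8 * C * (S + 1), by positivity, fun T α σ M hT hα hα' hσ hσ' hM F hF => ?_⟩
  have hT0 : 0 < T := by linarith
  have hlog2 : Real.log 2 ≤ Real.log T := Real.log_le_log (by norm_num) (by linarith)
  have hlog : 0 < Real.log T := Real.log_pos (by linarith)
  set D : ℝ → ℝ := fun t => (‖deriv riemannZeta₀ (σ + t * I)‖ + 1) ^ 2 with hD
  have hDc : Continuous D := by
    have : Continuous (deriv riemannZeta₀) := differentiable_riemannZeta₀.deriv.continuous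
    fun_prop
  set w : ℕ → ℝ := fun k => M ^ 2 * (T ^ α * (4 * (3 / 2) ^ (k + 1) / 4 ^ k) / T ^ 2) with hw
  have hw0 : ∀ k, 0 ≤ w k := fun k => by positivity
  have hpt : ∀ t, ‖F t‖ₑ ^ 2 ≤ ∑' k : ℕ, ENNReal.ofReal (w k) *
      (Set.Icc (-(2 ^ k * T)) (2 ^ k * T)).indicator (fun t => ENNReal.ofReal (D t)) t := fun t => by
    obtain ⟨k, hk, hkw⟩ := exists_weight_le_dyadic hT hα hα' t
    refine le_trans ?_ (ENNReal.le_tsum k)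
    rw [Set.indicator_of_mem (Set.mem_Icc.2 (abs_le.1 hk)), ← ENNReal.ofReal_mul (hw0 k), ← ofReal_norm, ← ENNReal.ofReal_pow (norm_nonneg _)]
    apply ENNReal.ofReal_le_ofReal
    calc ‖F t‖ ^ 2 ≤ _ := pow_le_pow_left₀ (norm_nonneg _) (hF t) 2
      _ = M ^ 2 * ((1 + |t|) ^ α * (min 1 ((1 + |t|) / T) / (1 + |t|)) ^ 2) * D t := by
          have : (1 + |t|) ^ α = ((1 + |t|) ^ (α / 2)) ^ 2 := by
            rw [← Real.rpow_natCast, ← Real.rpow_mul (by positivity)]; congr 1; push_cast; ring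
          rw [this]; simp only [hD]; ring
      _ ≤ _ := by
          simp only [hw]
          gcongr
  calc ∫⁻ t, ‖F t‖ₑ ^ 2 ≤ ∫⁻ t, ∑' k : ℕ, ENNReal.ofReal (w k) *
      (Set.Icc (-(2 ^ k * T)) (2 ^ k * T)).indicator (fun t => ENNReal.ofReal (D t)) t := lintegral_mono hpt
    _ = ∑' k : ℕ, ENNReal.ofReal (w k) * ∫⁻ t in Set.Icc (-(2 ^ k * T)) (2 ^ k * T), ENNReal.ofReal (D t) := by
        have hm : ∀ k : ℕ, Measurable ((Set.Icc (-(2 ^ k * T)) (2 ^ k * T)).indicator (fun t => ENNReal.ofReal (D t))) :=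
          fun k => (ENNReal.measurable_ofReal.comp hDc.measurable).indicator measurableSet_Icc
        rw [lintegral_tsum fun k => ((hm k).const_mul _).aemeasurable]
        refine tsum_congr fun k => ?_
        rw [lintegral_const_mul _ (hm k), lintegral_indicator measurableSet_Icc]
    _ ≤ ∑' k : ℕ, ENNReal.ofReal (8 * C * M ^ 2 * T ^ α * (Real.log T ^ 3 / T) *
          (((k + 1 : ℕ) : ℝ) ^ 3 * (3 / 4 : ℝ) ^ (k + 1))) := by
        refine ENNReal.tsum_le_tsum fun k => ?_
        have hk1 : (1:ℝ) ≤ 2 ^ k := one_le_pow₀ (by norm_num)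
        have hU : 3 ≤ 2 ^ k * T := by nlinarith
        refine (mul_le_mul_right (hmean _ σ hU hσ hσ') _).trans ?_
        rw [← ENNReal.ofReal_mul (hw0 k)]
        apply ENNReal.ofReal_le_ofReal
        have hl : Real.log (2 ^ k * T) ≤ ((k + 1 : ℕ) : ℝ) * Real.log T := by
          rw [Real.log_mul (by positivity) hT0.ne', Real.log_pow]
          push_cast
          nlinarith [(Nat.cast_nonneg k : (0:ℝ) ≤ k)]
        have hl0 : 0 ≤ Real.log (2 ^ k * T) := Real.log_nonneg (by linarith)
        calc _ ≤ w k * (C * (2 ^ k * T) * (((k + 1 : ℕ) : ℝ) * Real.log T) ^ 3) := by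
              have := hw0 k
              gcongr
          _ = _ := by
              simp only [hw]
              rw [show (4:ℝ) ^ k = 2 ^ k * 2 ^ k by rw [← mul_pow]; norm_num,
                show (3 / 2 : ℝ) ^ (k + 1) = (3 / 4) ^ (k + 1) * (2 ^ k * 2) by rw [← pow_succ, ← mul_pow]; norm_num]
              field_simp
              ring
    _ = ENNReal.ofReal (8 * C * M ^ 2 * T ^ α * (Real.log T ^ 3 / T) * S) := by
        rw [← ENNReal.ofReal_tsum_of_nonneg (fun k => by positivity) (hsum.mul_left _), tsum_mul_left]
    _ ≤ _ := by
        apply ENNReal.ofReal_le_ofReal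
        have : 0 ≤ 8 * C * M ^ 2 * T ^ α * (Real.log T ^ 3 / T) := by positivity
        nlinarith

theorem exists_norm_remainderAlpha_exp_le {α : ℝ} (hα' : α ≤ 1) :
    ∃ K ≥ (0:ℝ), ∀ v : ℝ, ‖(remainderAlpha α (rexp v) : ℂ)‖ ≤ K * rexp (3 * |v|) := by
  obtain ⟨K, hK, h⟩ := exists_abs_remainderAlpha_le hα'
  refine ⟨K, hK, fun v => ?_⟩
  rcases lt_or_ge v 0 with hv | hv
  · rw [remainderAlpha_of_lt (Real.exp_lt_one_iff.2 hv)]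
    simp only [Complex.ofReal_zero, norm_zero]
    positivity
  · refine (h _ (Real.one_le_exp hv)).trans (le_of_eq ?_)
    rw [abs_of_nonneg hv, ← Real.exp_mul, mul_comm v]

theorem exists_lintegral_sub_remainderAlpha_le (hRH : RiemannHypothesis) :
    ∃ C > (0:ℝ), ∀ T α : ℝ, 3 ≤ T → 0 < α → α ≤ 1 / 8 →
      ∫⁻ u : ℝ, ‖(remainderAlpha α (rexp (u + Real.log (1 + 1 / T))) : ℂ) - remainderAlpha α (rexp u)‖ₑ ^ 2 *
        ENNReal.ofReal (rexp (-2 * (1 / 2 + α / 2) * u)) ≤ ENNReal.ofReal (C * T ^ α * (Real.log T ^ 3 / T)) := by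
  obtain ⟨C, hC, hline⟩ := exists_norm_laplace_remainderAlpha_line_le hRH
  obtain ⟨C', hC', hmean⟩ := exists_lintegral_dyadic_le
  refine ⟨rexp 2 * C' * (3 * C) ^ 2, by positivity, fun T α hT hα hα' => ?_⟩
  have hT0 : 0 < T := by linarith
  have hα1 : α ≤ 1 := by linarith
  obtain ⟨A, hA, hAs⟩ := exists_differentiableAt_laplace_remainderAlpha hRH hα
  set l := Real.log (1 + 1 / T) with hl
  have hl0 : 0 ≤ l := Real.log_nonneg (by linarith [one_div_pos.2 hT0])
  have hlT : l ≤ 1 / T := log_one_add_inv_le hT0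
  have hl1 : l ≤ 1 / 3 := hlT.trans (one_div_le_one_div_of_le (by norm_num) hT)
  set σ : ℝ := 1 / 2 + α / 2 with hσ
  have hσ1 : 1 / 2 < σ := by linarith
  have hσ2 : σ ≤ 9 / 16 := by linarith
  obtain ⟨M, N, hM⟩ := exists_norm_laplace_remainderAlpha_le hRH hα hα' hσ1 hA hAs
  obtain ⟨K, hK, hrem⟩ := exists_norm_remainderAlpha_exp_le hα1
  obtain ⟨K₁, -, hrem₁⟩ := exists_abs_remainderAlpha_le hα1
  set q : ℝ → ℂ := fun u => (remainderAlpha α (rexp (u + l)) : ℂ) - remainderAlpha α (rexp u) with hq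
  have hmeas : Measurable fun x => (remainderAlpha α x : ℂ) := Complex.measurable_ofReal.comp (measurable_remainderAlpha α)
  have hqm : Measurable q :=
    (hmeas.comp (by fun_prop : Measurable fun u : ℝ => rexp (u + l))).sub (hmeas.comp Real.measurable_exp)
  have hqb : ∀ u, ‖q u‖ ≤ (K * rexp (3 * |l|) + K) * rexp (3 * |u|) := fun u => by
    calc ‖q u‖ ≤ K * rexp (3 * |u + l|) + K * rexp (3 * |u|) := (norm_sub_le _ _).trans (add_le_add (hrem _) (hrem _))
      _ ≤ K * rexp (3 * |l| + 3 * |u|) + K * rexp (3 * |u|) := by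
          gcongr K * rexp ?_ + _
          linarith [abs_add_le u l]
      _ = _ := by rw [Real.exp_add]; ring
  have hqc : ∀ᵐ u, ContinuousAt q u := by
    filter_upwards [ae_continuousAt_remainderAlpha_exp α l, ae_continuousAt_remainderAlpha_exp α 0] with u h1 h2
    simp only [add_zero] at h2
    exact h1.sub h2
  have hint : ∀ s : ℂ, 3 < s.re → Integrable fun u : ℝ => (remainderAlpha α (rexp u) : ℂ) * cexp (-s * u) := fun s hs =>
    integrable_comp_exp_of_le (h := fun x => (remainderAlpha α x : ℂ)) hmeas
      (fun x hx => by simp [remainderAlpha_of_lt hx]) hrem₁ hs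
  have hint' : ∀ s : ℂ, 3 < s.re → Integrable fun u : ℝ => (remainderAlpha α (rexp (u + l)) : ℂ) * cexp (-s * u) :=
    fun s hs => integrable_comp_add_mul_cexp (g := fun u => (remainderAlpha α (rexp u) : ℂ)) l (hint s hs)
  set B : ℂ → ℂ := fun s => (cexp (s * l) - 1) * A s with hB
  have hBq : ∀ s : ℂ, 3 < s.re → B s = ∫ v : ℝ, q v * cexp (-s * v) := fun s hs => by
    have e1 : s ≠ 1 := by rintro rfl; simp at hs
    have e2 : s ≠ 1 + α := by rintro rfl; simp at hs; linarith
    simp only [hq, sub_mul]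
    rw [integral_sub (hint' s hs) (hint s hs),
      integral_comp_add_mul_cexp (fun u => (remainderAlpha α (rexp u) : ℂ)) s l, integral_remainderAlpha_exp hα1 hs]
    simp only [hB]
    rw [hAs s (by linarith) e1 e2]
    ring
  have hexpB : ∀ s : ℂ, σ ≤ s.re → s.re ≤ 5 → ‖cexp (s * l) - 1‖ ≤ rexp 5 + 1 := fun s h1 h2 => by
    refine (norm_sub_le _ _).trans ?_
    rw [Complex.norm_exp, norm_one]
    gcongr
    simp only [Complex.re_mul_ofReal]
    nlinarith
  have h5 : ((5:ℝ):ℂ).re = 5 := Complex.ofReal_re 5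
  have hre5 : ∀ t : ℝ, (((5:ℝ):ℂ) + t * I).re = 5 := fun t => by simp
  have hPW := lintegral_enorm_sq_le_of_laplace (c := 5) (σ := σ) (B := B) hqm (by norm_num) hqb hqc
    (M := (rexp 5 + 1) * M) (N := N)
    (by
      have := (hint' (5:ℝ) (by rw [h5]; norm_num)).sub (hint (5:ℝ) (by rw [h5]; norm_num))
      refine this.congr (Filter.Eventually.of_forall fun u => ?_)
      simp only [hq, Pi.sub_apply]
      ring)
    (fun t => hBq _ (by rw [hre5]; norm_num)) (by linarith)
    (fun s h1 _ => by
      have := hA s (by linarith)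
      simp only [hB]
      fun_prop)
    (fun s h1 h2 => by
      simp only [hB]
      rw [norm_mul, mul_assoc]
      exact mul_le_mul (hexpB s h1 h2) (hM s h1 h2) (norm_nonneg _) (by positivity))
  have hBline := hmean T α σ (3 * C) hT hα.le hα' hσ1.le (by linarith) (by positivity) (fun t => B (σ + t * I)) (fun t => by
    set s : ℂ := σ + t * I with hs
    have hsre : s.re = 1 / 2 + α / 2 := by simp [hs, hσ]
    have hsim : s.im = t := by simp [hs]
    have e1 : s ≠ 1 := fun h => by rw [h] at hsre; simp at hsre; linarith
    have e2 : s ≠ 1 + α := fun h => by rw [h] at hsre; simp at hsre; linarith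
    have hAl := hline α hα hα' s hsre
    rw [← hAs s (by linarith) e1 e2, hsim] at hAl
    have hnorm : ‖s‖ ≤ 1 + |t| := by
      refine (Complex.norm_le_abs_re_add_abs_im s).trans ?_
      rw [hsim, hsre, abs_of_pos (by linarith)]; linarith
    have hw : ‖s * l‖ ≤ (1 + |t|) / T := by
      rw [norm_mul, Complex.norm_real, Real.norm_of_nonneg hl0, div_eq_mul_one_div]
      gcongr
    have hE : ‖cexp (s * l) - 1‖ ≤ 3 * min 1 ((1 + |t|) / T) := by
      refine (norm_cexp_sub_one_le_three_mul ?_).trans (by gcongr)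
      rw [Complex.re_mul_ofReal, hsre]
      nlinarith
    calc ‖B s‖ = ‖cexp (s * l) - 1‖ * ‖A s‖ := norm_mul _ _
      _ ≤ (3 * min 1 ((1 + |t|) / T)) * (C * ((1 + |t|) ^ (α / 2) / (1 + |t|)) * (‖deriv riemannZeta₀ s‖ + 1)) := by
          gcongr
      _ = _ := by ring)
  refine hPW.trans ((mul_le_mul_right hBline _).trans ?_)
  rw [← ENNReal.ofReal_mul (by positivity)]
  apply ENNReal.ofReal_le_ofReal
  have hlog : 0 ≤ Real.log T := Real.log_nonneg (by linarith)
  calc _ ≤ rexp 2 * (C' * (3 * C) ^ 2 * T ^ α * (Real.log T ^ 3 / T)) := by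
        gcongr
        nlinarith
    _ = _ := by ring

/-- Theorem 2: under RH, for any fixed `b ≥ 1`, uniformly for `0 < a ≤ δ`,
`J_b(T,a) ≪ (log T)³ / T`. -/
theorem thmprimes (hRH : RiemannHypothesis) (b : ℝ) (hb : 1 ≤ b) :
    ∃ C > (0:ℝ), ∃ δ > (0:ℝ), ∃ T₀ > (2:ℝ), ∀ T, T₀ ≤ T → ∀ a : ℝ,
      0 < a → a ≤ δ →
      Jb b T a ≤ C * Real.log T ^ 3 / T := by
  obtain ⟨C, hC, hmain⟩ := exists_lintegral_sub_remainderAlpha_le hRH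
  have he8 : (3:ℝ) ≤ rexp 8 := by linarith [Real.add_one_le_exp (8:ℝ)]
  refine ⟨rexp b * (C * rexp 1), by positivity, 1, one_pos, rexp 8, by linarith, fun T hT a ha ha1 => ?_⟩
  have hT3 : 3 ≤ T := he8.trans hT
  have hT0 : 0 < T := by linarith
  have hlog : 8 ≤ Real.log T := (Real.le_log_iff_exp_le hT0).2 hT
  set α := a / Real.log T with hα
  have hα0 : 0 < α := by positivity
  have hα1 : α ≤ 1 / 8 := by
    rw [hα]; exact div_le_div₀ (by norm_num) ha1 (by norm_num) hlog
  have hαlog : α * Real.log T = a := div_mul_cancel₀ _ (by linarith)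
  have hTα : T ^ α = rexp a := by rw [Real.rpow_def_of_pos hT0, mul_comm, hαlog]
  set l := Real.log (1 + 1 / T) with hl
  have hlexp : rexp l = 1 + 1 / T := Real.exp_log (by positivity)
  have hl0 : 0 ≤ l := Real.log_nonneg (by linarith [one_div_pos.2 hT0])
  set q : ℝ → ℂ := fun u => (remainderAlpha α (rexp (u + l)) : ℂ) - remainderAlpha α (rexp u) with hq
  set g : ℝ → ℝ := fun x => (fAlpha α (x + x / T) - fAlpha α x - MAlpha α (x + x / T) + MAlpha α x) ^ 2 / x ^ 2 with hg
  have hg0 : ∀ x, 0 ≤ g x := fun x => by positivity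
  have hTb : 1 ≤ T ^ b := Real.one_le_rpow (by linarith) (by linarith)
  have hsub : Set.Ioc 1 (T ^ b) ⊆ rexp '' Set.Ioc 0 (b * Real.log T) := fun x hx => by
    have hx0 : 0 < x := by linarith [hx.1]
    refine ⟨Real.log x, ⟨Real.log_pos hx.1, ?_⟩, Real.exp_log hx0⟩
    rw [← Real.log_rpow hT0]
    exact Real.log_le_log hx0 hx.2
  have hlint : ∫⁻ x in Set.Ioc 1 (T ^ b), ENNReal.ofReal ‖g x‖ ≤
      ENNReal.ofReal (rexp b * (C * rexp 1) * Real.log T ^ 3 / T) := by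
    calc _ ≤ ∫⁻ x in rexp '' Set.Ioc 0 (b * Real.log T), ENNReal.ofReal ‖g x‖ := lintegral_mono_set hsub
      _ = ∫⁻ u in Set.Ioc 0 (b * Real.log T), ENNReal.ofReal |rexp u| * ENNReal.ofReal ‖g (rexp u)‖ :=
          lintegral_image_eq_lintegral_abs_deriv_mul measurableSet_Ioc
            (fun u _ => (Real.hasDerivAt_exp u).hasDerivWithinAt) Real.exp_injective.injOn _
      _ ≤ ∫⁻ u in Set.Ioc 0 (b * Real.log T), ENNReal.ofReal (rexp b) *
            (‖q u‖ₑ ^ 2 * ENNReal.ofReal (rexp (-2 * (1 / 2 + α / 2) * u))) := by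
          refine setLIntegral_mono' measurableSet_Ioc fun u hu => ?_
          rw [← ofReal_norm, ← ENNReal.ofReal_pow (norm_nonneg _), ← ENNReal.ofReal_mul (by positivity),
            ← ENNReal.ofReal_mul (by positivity), ← ENNReal.ofReal_mul (by positivity)]
          apply ENNReal.ofReal_le_ofReal
          have e1 : rexp u + rexp u / T = rexp (u + l) := by rw [Real.exp_add, hlexp]; ring
          have e2 : g (rexp u) = ‖q u‖ ^ 2 * (rexp (-u) * rexp (-u)) := by
            simp only [hq, hg]
            rw [e1, ← Complex.ofReal_sub, Complex.norm_real, Real.norm_eq_abs, sq_abs,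
              remainderAlpha_of_le (Real.one_le_exp hu.1.le),
              remainderAlpha_of_le (Real.one_le_exp (by linarith [hu.1])), Real.exp_neg]
            field_simp
            ring
          rw [Real.norm_of_nonneg (hg0 _), e2, abs_of_pos (Real.exp_pos u)]
          have h1 : α * u ≤ b := by
            calc α * u ≤ α * (b * Real.log T) := by gcongr; exact hu.2
              _ = b * a := by rw [← hαlog]; ring
              _ ≤ b * 1 := by gcongr
              _ = b := mul_one b
          calc _ = ‖q u‖ ^ 2 * rexp (u + (-u + -u)) := by rw [Real.exp_add, Real.exp_add]; ring
            _ ≤ ‖q u‖ ^ 2 * rexp (b + -2 * (1 / 2 + α / 2) * u) := by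
                gcongr ‖q u‖ ^ 2 * rexp ?_
                linarith
            _ = _ := by rw [Real.exp_add]; ring
      _ ≤ ∫⁻ u, ENNReal.ofReal (rexp b) *
            (‖q u‖ₑ ^ 2 * ENNReal.ofReal (rexp (-2 * (1 / 2 + α / 2) * u))) := setLIntegral_le_lintegral _ _
      _ = ENNReal.ofReal (rexp b) * ∫⁻ u,
            (‖q u‖ₑ ^ 2 * ENNReal.ofReal (rexp (-2 * (1 / 2 + α / 2) * u))) := lintegral_const_mul' _ _ ENNReal.ofReal_ne_top
      _ ≤ ENNReal.ofReal (rexp b) * ENNReal.ofReal (C * T ^ α * (Real.log T ^ 3 / T)) :=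
          mul_le_mul_right (hmain T α hT3 hα0 hα1) _
      _ ≤ _ := by
          rw [← ENNReal.ofReal_mul (by positivity), hTα]
          apply ENNReal.ofReal_le_ofReal
          have : 0 ≤ Real.log T := by linarith
          calc _ ≤ rexp b * (C * rexp 1 * (Real.log T ^ 3 / T)) := by gcongr
            _ = _ := by ring
  have hJ : Jb b T a = ∫ x in Set.Ioc 1 (T ^ b), g x := by
    rw [Jb, intervalIntegral.integral_of_le hTb]
  rw [hJ]
  refine (le_abs_self _).trans ((norm_integral_le_lintegral_norm g).trans ?_)
  refine ENNReal.toReal_le_of_le_ofReal ?_ hlint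
  have : 0 ≤ Real.log T := by linarith
  positivity
end
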